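/- Let N ≥ 11 be an integer and let p > p_c. Then there exists a constant C* > 0, depending only on N and p, such that for every smooth divergence-free vector field a : ℝ^N → ℝ^N satisfying |a(x)| ≤ C*/(|x|+1) for all x ∈ ℝ^N, the equation −Δu + a(x)·∇u = u^p admits a positive stable solution on ℝ^N. -/

import Mathlib

open MeasureTheory Real Filter
open scoped InnerProductSpace ENNReal Topology

noncomputable section

/-- Euclidean space ℝ^N. -/
abbrev Euc (N : ℕ) := EuclideanSpace ℝ (Fin N)

/-- The Laplacian of a real-valued function on ℝ^N, as the sum of
the second partial derivatives in the coordinate directions. -/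
def lap {N : ℕ} (u : Euc N → ℝ) (x : Euc N) : ℝ :=
  ∑ i : Fin N,
    fderiv ℝ (fun y => fderiv ℝ u y (EuclideanSpace.single i 1)) x
      (EuclideanSpace.single i 1)

/-- The divergence of a vector field on ℝ^N. -/
def divg {N : ℕ} (a : Euc N → Euc N) (x : Euc N) : ℝ :=
  ∑ i : Fin N, fderiv ℝ a x (EuclideanSpace.single i 1) i

/-- The advection term `a(x) · ∇u(x)`. -/
def adv {N : ℕ} (a : Euc N → Euc N) (u : Euc N → ℝ) (x : Euc N) : ℝ :=
  ⟪a x, gradient u x⟫_ℝ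

/-- `u` is a positive smooth solution of `-Δu + a(x)·∇u = u^p` in the open set `Ω`. -/
def IsSolution {N : ℕ} (a : Euc N → Euc N) (p : ℝ) (Ω : Set (Euc N))
    (u : Euc N → ℝ) : Prop :=
  ContDiffOn ℝ (⊤ : ℕ∞) u Ω ∧ (∀ x ∈ Ω, 0 < u x) ∧
    ∀ x ∈ Ω, -lap u x + adv a u x = u x ^ p

/-- `u` is a stable solution of `-Δu + a(x)·∇u = u^p` in `Ω`: it is a positive smooth
solution and there is a smooth positive `E` with `-ΔE + a(x)·∇E ≥ p u^(p-1) E` in `Ω`. -/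
def IsStableSolution {N : ℕ} (a : Euc N → Euc N) (p : ℝ) (Ω : Set (Euc N))
    (u : Euc N → ℝ) : Prop :=
  IsSolution a p Ω u ∧
    ∃ E : Euc N → ℝ, ContDiffOn ℝ (⊤ : ℕ∞) E Ω ∧ (∀ x ∈ Ω, 0 < E x) ∧
      ∀ x ∈ Ω, p * u x ^ (p - 1) * E x ≤ -lap E x + adv a E x

/-- The Joseph–Lundgren exponent for `N ≥ 11`. -/
def pJL (N : ℕ) : ℝ :=
  (((N : ℝ) - 2) ^ 2 - 4 * N + 8 * Real.sqrt ((N : ℝ) - 1)) /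
    (((N : ℝ) - 2) * ((N : ℝ) - 10))

/-- Numerical parameters. -/
structure Par (N : ℕ) (p β Λ : ℝ) : Prop where
  hN : 11 ≤ N
  hp : 1 < p
  βpos : 0 < β
  βp : β * p = β + 2
  Λeq : Λ = β * (N - 2 - β)
  β4 : 2 * β < N - 4
  disc : 8 * (N - 2 - β) < (N - 2 - 2 * β) ^ 2

theorem par_of_pJL (N : ℕ) (hN : 11 ≤ N) (p : ℝ) (hp : pJL N < p) :
    Par N p (2 / (p - 1)) (2 / (p - 1) * (N - 2 - 2 / (p - 1))) := by
  have hN' : (11 : ℝ) ≤ N := by exact_mod_cast hN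
  unfold pJL at hp
  set s := Real.sqrt ((N : ℝ) - 1) with hs
  have hs2 : s ^ 2 = N - 1 := Real.sq_sqrt (by linarith)
  have hs3 : 3 < s := by
    rw [hs]; apply Real.lt_sqrt_of_sq_lt; linarith
  have hNs : (N : ℝ) = s ^ 2 + 1 := by linarith
  -- β0 = (N-4)/2 - s, pJL - 1 = 2/β0
  have hβ0 : 0 < ((N : ℝ) - 4) / 2 - s := by rw [hNs]; nlinarith
  have hD : 0 < ((N : ℝ) - 2) * ((N : ℝ) - 10) := by nlinarith
  have key : 2 / (((N : ℝ) - 4) / 2 - s) < p - 1 := by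
    have : 2 / (((N : ℝ) - 4) / 2 - s) + 1 = (((N : ℝ) - 2) ^ 2 - 4 * N + 8 * s) /
        (((N : ℝ) - 2) * ((N : ℝ) - 10)) := by
      rw [div_add_one hβ0.ne', div_eq_div_iff hβ0.ne' hD.ne', hNs]
      ring
    linarith
  have hp1 : 0 < p - 1 := lt_trans (by positivity) key
  have hβ : 2 / (p - 1) < ((N : ℝ) - 4) / 2 - s := by
    rw [div_lt_iff₀ hβ0] at key
    rw [div_lt_iff₀ hp1]; linarith
  have hβpos : 0 < 2 / (p - 1) := by positivity
  refine ⟨hN, by linarith, hβpos, by field_simp; ring, rfl, by linarith, ?_⟩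
  set β := 2 / (p - 1)
  nlinarith

namespace Par
variable {N : ℕ} {p β Λ : ℝ}

theorem N11 (h : Par N p β Λ) : (11 : ℝ) ≤ N := by exact_mod_cast h.hN

theorem Λpos (h : Par N p β Λ) : 0 < Λ := by
  rw [h.Λeq]; have := h.β4; have := h.βpos; have := h.N11
  apply mul_pos h.βpos; linarith

theorem pΛ (h : Par N p β Λ) : (p - 1) * Λ = 2 * (N - 2 - β) := by
  have : β * (p - 1) = 2 := by linarith [h.βp]
  rw [h.Λeq]; linear_combination (N - 2 - β) * this

theorem hardy (h : Par N p β Λ) : p * Λ < ((N - 2) / 2 : ℝ) ^ 2 := by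
  have h1 := h.pΛ
  have h2 := h.disc
  have h3 := h.Λeq
  nlinarith
end Par

/-- averaged integral -/
def AvI (N : ℕ) (H : ℝ → ℝ) (s : ℝ) : ℝ := ∫ θ in (0:ℝ)..1, θ ^ (N - 1) * H (θ * s)

theorem AvI_continuous (N : ℕ) {H : ℝ → ℝ} (hH : Continuous H) : Continuous (AvI N H) := by
  unfold AvI
  apply intervalIntegral.continuous_parametric_intervalIntegral_of_continuous'
  fun_prop

theorem AvI_eq (N : ℕ) (hN : 1 ≤ N) (H : ℝ → ℝ) (s : ℝ) :
    s ^ N * AvI N H s = ∫ t in (0:ℝ)..s, t ^ (N - 1) * H t := by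
  have h := intervalIntegral.smul_integral_comp_mul_right (a := 0) (b := 1)
    (fun t : ℝ => t ^ (N - 1) * H t) s
  simp only [zero_mul, one_mul, smul_eq_mul] at h
  rw [← h]
  unfold AvI
  obtain ⟨m, rfl⟩ : ∃ m, N = m + 1 := ⟨N - 1, by omega⟩
  simp only [Nat.add_sub_cancel]
  rw [pow_succ', mul_assoc, ← intervalIntegral.integral_const_mul]
  congr 2
  ext θ
  ring

theorem AvI_hasDerivAt (N : ℕ) (hN : 1 ≤ N) {H : ℝ → ℝ} (hH : Continuous H) (s : ℝ) :
    HasDerivAt (fun s => s ^ N * AvI N H s) (s ^ (N - 1) * H s) s := by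
  have : (fun s => s ^ N * AvI N H s) = fun s => ∫ t in (0:ℝ)..s, t ^ (N - 1) * H t := by
    ext s; exact AvI_eq N hN H s
  rw [this]
  have hc : Continuous fun t : ℝ => t ^ (N - 1) * H t := by fun_prop
  exact intervalIntegral.integral_hasDerivAt_right (hc.intervalIntegrable _ _)
    (hc.stronglyMeasurableAtFilter _ _) hc.continuousAt

theorem AvI_mem (N : ℕ) {H : ℝ → ℝ} (hH : Continuous H) (h0 : ∀ x, 0 ≤ H x)
    (h1 : ∀ x, H x ≤ 1) (s : ℝ) : 0 ≤ AvI N H s ∧ AvI N H s ≤ 1 := by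
  unfold AvI
  constructor
  · apply intervalIntegral.integral_nonneg zero_le_one
    intro θ hθ
    exact mul_nonneg (pow_nonneg hθ.1 _) (h0 _)
  · have : (∫ θ in (0:ℝ)..1, θ ^ (N - 1) * H (θ * s)) ≤ ∫ θ in (0:ℝ)..1, (1:ℝ) := by
      apply intervalIntegral.integral_mono_on zero_le_one
      · exact (by fun_prop : Continuous _).intervalIntegrable _ _
      · exact (by fun_prop : Continuous _).intervalIntegrable _ _
      · intro θ hθ
        exact mul_le_one₀ (pow_le_one₀ hθ.1 hθ.2) (h0 _) (h1 _)
    simpa using this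

theorem AvI_sub_le (N : ℕ) {H K : ℝ → ℝ} (hH : Continuous H) (hK : Continuous K)
    (s c : ℝ) (h : ∀ θ ∈ Set.Icc (0:ℝ) 1, |H (θ * s) - K (θ * s)| ≤ c) :
    |AvI N H s - AvI N K s| ≤ c := by
  unfold AvI
  rw [← intervalIntegral.integral_sub ((by fun_prop : Continuous _).intervalIntegrable _ _)
    ((by fun_prop : Continuous _).intervalIntegrable _ _)]
  have := intervalIntegral.norm_integral_le_of_norm_le_const (a := 0) (b := 1) (C := c)
    (f := fun θ => θ ^ (N - 1) * H (θ * s) - θ ^ (N - 1) * K (θ * s)) (by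
      intro θ hθ
      rw [Set.uIoc_of_le zero_le_one] at hθ
      rw [← mul_sub, Real.norm_eq_abs, abs_mul, abs_pow, abs_of_pos hθ.1]
      calc _ ≤ 1 * |H (θ * s) - K (θ * s)| := by
            gcongr; exact pow_le_one₀ hθ.1.le hθ.2
        _ ≤ c := by rw [one_mul]; exact h θ ⟨hθ.1.le, hθ.2⟩)
  simpa using this

theorem exists_fix (N : ℕ) (F : ℝ → ℝ) (q : ℝ) (hq : 0 < q)
    (hL : ∀ x y, |F x - F y| ≤ q * |x - y|) (h0 : ∀ x, 0 ≤ F x) (h1 : ∀ x, F x ≤ 1) :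
    ∃ U : ℝ → ℝ, Continuous U ∧
      ∀ r, U r = 1 - ∫ s in (0:ℝ)..r, s * AvI N (fun t => F (U t)) s := by
  have hF : Continuous F := by
    rw [Metric.continuous_iff]
    intro x ε hε
    refine ⟨ε / q, by positivity, fun y hy => ?_⟩
    rw [Real.dist_eq] at *
    calc _ ≤ q * |y - x| := hL _ _
      _ < q * (ε / q) := by gcongr
      _ = ε := by field_simp
  let W : ℝ → ℝ := fun r => Real.exp (q * r ^ 2)
  have hW : Continuous W := by fun_prop
  have hWpos : ∀ r, 0 < W r := fun r => Real.exp_pos _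
  have hcA : ∀ v : BoundedContinuousFunction ℝ ℝ,
      Continuous fun s => s * AvI N (fun t => F (W t * v t)) s := fun v =>
    continuous_id.mul (AvI_continuous N (hF.comp (hW.mul v.continuous)))
  have hder : ∀ v : BoundedContinuousFunction ℝ ℝ, ∀ r,
      HasDerivAt (fun r => ∫ s in (0:ℝ)..r, s * AvI N (fun t => F (W t * v t)) s)
        (r * AvI N (fun t => F (W t * v t)) r) r := fun v r =>
    intervalIntegral.integral_hasDerivAt_right ((hcA v).intervalIntegrable _ _)
      ((hcA v).stronglyMeasurableAtFilter _ _) (hcA v).continuousAt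
  -- bound
  have hbd : ∀ v : BoundedContinuousFunction ℝ ℝ, ∀ r,
      |∫ s in (0:ℝ)..r, s * AvI N (fun t => F (W t * v t)) s| ≤ r ^ 2 := by
    intro v r
    have := intervalIntegral.norm_integral_le_of_norm_le_const (a := 0) (b := r) (C := |r|)
      (f := fun s => s * AvI N (fun t => F (W t * v t)) s) (by
        intro s hs
        have hA : 0 ≤ AvI N (fun t => F (W t * v t)) s ∧ AvI N (fun t => F (W t * v t)) s ≤ 1 :=
          AvI_mem N (hF.comp (hW.mul v.continuous)) (fun x => h0 _) (fun x => h1 _) s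
        rw [norm_mul, Real.norm_eq_abs, Real.norm_eq_abs]
        have hs' : |s| ≤ |r| := by
          rcases Set.mem_uIoc.1 hs with h | h
          · rw [abs_of_pos h.1, abs_of_pos (by linarith)]; exact h.2
          · rw [abs_of_nonpos h.2, abs_of_neg (by linarith)]; linarith
        calc _ ≤ |r| * 1 := by
              gcongr
              rw [abs_le]; exact ⟨by linarith [hA.1], hA.2⟩
          _ = |r| := mul_one _)
    simpa [← sq] using this
  let Φ : BoundedContinuousFunction ℝ ℝ → BoundedContinuousFunction ℝ ℝ := fun v =>
    BoundedContinuousFunction.ofNormedAddCommGroup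
      (fun r => (W r)⁻¹ * (1 - ∫ s in (0:ℝ)..r, s * AvI N (fun t => F (W t * v t)) s))
      ((hW.inv₀ (fun r => (hWpos r).ne')).mul (continuous_const.sub
        (continuous_iff_continuousAt.2 fun r => (hder v r).continuousAt)))
      (1 + 1 / q) (by
        intro r
        rw [norm_mul, norm_inv, Real.norm_of_nonneg (hWpos r).le, Real.norm_eq_abs]
        rw [inv_mul_le_iff₀ (hWpos r)]
        have h2 : q * r ^ 2 + 1 ≤ W r := Real.add_one_le_exp _
        have h3 : |1 - ∫ s in (0:ℝ)..r, s * AvI N (fun t => F (W t * v t)) s| ≤ 1 + r ^ 2 := by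
          refine (abs_sub _ _).trans ?_
          rw [abs_one]; linarith [hbd v r]
        refine h3.trans ?_
        have : (q * r ^ 2 + 1) * (1 + 1 / q) ≤ W r * (1 + 1 / q) := by gcongr
        refine le_trans ?_ this
        have : (q * r ^ 2 + 1) * (1 + 1 / q) = q * r ^ 2 + 1 + r ^ 2 + 1 / q := by
          field_simp; ring
        rw [this]; have : 0 < 1 / q := by positivity
        nlinarith [sq_nonneg r])
  have hmain : ∀ v w : BoundedContinuousFunction ℝ ℝ, ∀ r,
      |(∫ s in (0:ℝ)..r, s * AvI N (fun t => F (W t * v t)) s) -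
        ∫ s in (0:ℝ)..r, s * AvI N (fun t => F (W t * w t)) s| ≤ W r * (1 / 2) * dist v w := by
    intro v w r
    rw [← intervalIntegral.integral_sub ((hcA v).intervalIntegrable _ _)
      ((hcA w).intervalIntegrable _ _)]
    have hpt : ∀ s, |s * AvI N (fun t => F (W t * v t)) s - s * AvI N (fun t => F (W t * w t)) s|
        ≤ |s| * (q * W s * dist v w) := by
      intro s
      rw [← mul_sub, abs_mul]
      gcongr
      apply AvI_sub_le N (hF.comp (hW.mul v.continuous)) (hF.comp (hW.mul w.continuous))
      intro θ hθ
      refine (hL _ _).trans ?_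
      simp only [Pi.mul_apply]
      rw [← mul_sub, abs_mul, abs_of_pos (hWpos _), mul_assoc]
      gcongr
      · apply Real.exp_le_exp.2
        have : (θ * s) ^ 2 ≤ s ^ 2 := by
          rw [mul_pow]
          have : θ ^ 2 ≤ 1 := pow_le_one₀ hθ.1 hθ.2
          nlinarith [sq_nonneg s]
        gcongr
      · rw [← Real.dist_eq]; exact BoundedContinuousFunction.dist_coe_le_dist _
    -- integral of s*W s
    have hW' : ∀ s, HasDerivAt (fun s => W s / (2 * q)) (s * W s) s := by
      intro s
      have h1 : HasDerivAt (fun s : ℝ => q * s ^ 2) (q * (2 * s)) s := by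
        simpa using (hasDerivAt_pow 2 s).const_mul q
      refine ((h1.exp).div_const (2 * q)).congr_deriv ?_
      change Real.exp (q * s ^ 2) * (q * (2 * s)) / (2 * q) = s * Real.exp (q * s ^ 2)
      field_simp
    have hIntg : ∀ r : ℝ, ∫ s in (0:ℝ)..r, s * W s = (W r - 1) / (2 * q) := by
      intro r
      rw [intervalIntegral.integral_eq_sub_of_hasDerivAt (fun s _ => hW' s)
        ((by fun_prop : Continuous fun s => s * W s).intervalIntegrable _ _)]
      simp [W]; ring
    have hc1 : Continuous fun s => |s * AvI N (fun t => F (W t * v t)) s -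
        s * AvI N (fun t => F (W t * w t)) s| := ((hcA v).sub (hcA w)).abs
    have hd : 0 ≤ dist v w := dist_nonneg
    have hfin : (q * dist v w) * ((W r - 1) / (2 * q)) ≤ W r * (1 / 2) * dist v w := by
      have : (q * dist v w) * ((W r - 1) / (2 * q)) = W r * (1 / 2) * dist v w - dist v w / 2 := by
        field_simp
      rw [this]; linarith
    rcases le_total 0 r with hr | hr
    · refine (intervalIntegral.abs_integral_le_integral_abs hr).trans ?_
      refine le_trans ?_ hfin
      rw [← hIntg, ← intervalIntegral.integral_const_mul]
      apply intervalIntegral.integral_mono_on hr (hc1.intervalIntegrable _ _)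
        ((by fun_prop : Continuous _).intervalIntegrable _ _)
      intro s hs
      refine (hpt s).trans (le_of_eq ?_)
      rw [abs_of_nonneg hs.1]; ring
    · rw [intervalIntegral.integral_symm, abs_neg]
      refine (intervalIntegral.abs_integral_le_integral_abs hr).trans ?_
      refine le_trans ?_ hfin
      have hIntg' : ∫ s in r..(0:ℝ), -(s * W s) = (W r - 1) / (2 * q) := by
        rw [intervalIntegral.integral_neg, intervalIntegral.integral_symm, neg_neg, hIntg]
      rw [← hIntg', ← intervalIntegral.integral_const_mul]
      apply intervalIntegral.integral_mono_on hr (hc1.intervalIntegrable _ _)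
        ((by fun_prop : Continuous _).intervalIntegrable _ _)
      intro s hs
      refine (hpt s).trans (le_of_eq ?_)
      rw [abs_of_nonpos hs.2]; ring
  have hcontr : ContractingWith (1 / 2) Φ := by
    refine ⟨by rw [← NNReal.coe_lt_coe]; norm_num, ?_⟩
    apply LipschitzWith.of_dist_le_mul
    intro v w
    rw [BoundedContinuousFunction.dist_le (by positivity)]
    intro r
    rw [Real.dist_eq]
    change |(W r)⁻¹ * (1 - ∫ s in (0:ℝ)..r, s * AvI N (fun t => F (W t * v t)) s) -
      (W r)⁻¹ * (1 - ∫ s in (0:ℝ)..r, s * AvI N (fun t => F (W t * w t)) s)| ≤ _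
    rw [← mul_sub, sub_sub_sub_cancel_left, abs_mul, abs_inv, abs_of_pos (hWpos r),
      inv_mul_le_iff₀ (hWpos r), abs_sub_comm]
    refine (hmain v w r).trans (le_of_eq ?_)
    simp; ring
  have hfix := hcontr.fixedPoint_isFixedPt
  set v := hcontr.fixedPoint Φ
  refine ⟨fun t => W t * v t, hW.mul v.continuous, fun r => ?_⟩
  have h := congrArg (fun f : BoundedContinuousFunction ℝ ℝ => f r) hfix
  change (W r)⁻¹ * (1 - ∫ s in (0:ℝ)..r, s * AvI N (fun t => F (W t * v t)) s) = v r at h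
  change W r * v r = 1 - ∫ s in (0:ℝ)..r, s * AvI N (fun t => F (W t * v t)) s
  rw [← h, mul_inv_cancel_left₀ (hWpos r).ne']

structure Prof (N : ℕ) (p β Λ : ℝ) (U U1 : ℝ → ℝ) : Prop where
  cont : Continuous U
  cont1 : Continuous U1
  U0 : U 0 = 1
  U10 : U1 0 = 0
  pos : ∀ r, 0 ≤ r → 0 < U r
  le1 : ∀ r, 0 ≤ r → U r ≤ 1
  d1 : ∀ r, 0 < r → HasDerivAt U (U1 r) r
  d2 : ∀ r, 0 < r → HasDerivAt U1 (-(N - 1) / r * U1 r - U r ^ p) r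
  neg1 : ∀ r, 0 < r → U1 r < 0
  ge1 : ∀ r, 0 ≤ r → -r ≤ U1 r
  Z : ∀ r, 0 ≤ r → 0 < β * U r + r * U1 r
  wle : ∀ r, 0 ≤ r → r ^ 2 * U r ^ (p - 1) ≤ Λ
  J : ∀ r, 0 ≤ r → -U1 r * (N - 2 - β) ≤ r * U r ^ p
  low : ∃ c, 0 < c ∧ ∀ r, 0 ≤ r → c * (1 + r) ^ (-β) ≤ U r
  up : ∃ c, 0 < c ∧ ∀ r, 0 ≤ r → U r ≤ c * (1 + r) ^ (-β)

theorem core_tangent {p L Λ w : ℝ} (hp : 1 < p) (hL : 0 < L) (hw : 0 ≤ w)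
    (hLp : L ^ (p - 1) = Λ) : (p - 1) * Λ * (w - L) ≤ w ^ p - Λ * w := by
  have h := one_add_mul_self_le_rpow_one_add (s := w / L - 1) (p := p)
    (by have : 0 ≤ w / L := by positivity
        linarith) hp.le
  have h2 : (1 + (w / L - 1)) ^ p = w ^ p / L ^ p := by
    rw [add_sub_cancel, Real.div_rpow hw hL.le]
  have h3 : L ^ p = Λ * L := by
    rw [← hLp, ← Real.rpow_add_one hL.ne']; ring_nf
  have hΛ : 0 < Λ := by rw [← hLp]; positivity
  rw [h2, h3, le_div_iff₀ (by positivity)] at h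
  have h4 : (1 + p * (w / L - 1)) * (Λ * L) = Λ * L + p * Λ * (w - L) := by
    field_simp
  rw [h4] at h
  linarith

section core
variable {N : ℕ} {p β Λ : ℝ} {U U1 : ℝ → ℝ} {R : ℝ}

theorem core_dZ (hr : 0 < R) (d1 : HasDerivAt U (U1 R) R)
    (d2 : HasDerivAt U1 (-(N - 1) / R * U1 R - U R ^ p) R) :
    HasDerivAt (fun r => β * U r + r * U1 r) ((β + 2 - N) * U1 R - R * U R ^ p) R := by
  refine ((d1.const_mul β).add ((hasDerivAt_id R).mul d2)).congr_deriv ?_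
  simp only [id]
  field_simp
  ring

theorem core_dw (hr : 0 < R) (d1 : HasDerivAt U (U1 R) R) :
    HasDerivAt (fun r => r ^ β * U r) (R ^ β / R * (β * U R + R * U1 R)) R := by
  refine ((Real.hasDerivAt_rpow_const (Or.inl hr.ne')).mul d1).congr_deriv ?_
  rw [Real.rpow_sub_one hr.ne']
  field_simp

theorem core_main (h : Par N p β Λ) (hR : 0 < R) (hc : Continuous U) (hc1 : Continuous U1)
    (hpos : ∀ r, 0 ≤ r → r < R → 0 < U r)
    (d1 : ∀ r, 0 < r → r < R → HasDerivAt U (U1 r) r)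
    (d2 : ∀ r, 0 < r → r < R → HasDerivAt U1 (-(N - 1) / r * U1 r - U r ^ p) r) :
    ∀ r, 0 < r → r < R → 0 < β * U r + r * U1 r ∧ r ^ 2 * U r ^ (p - 1) ≤ Λ := by
  have hβ := h.βpos
  have hΛ := h.Λpos
  have hN := h.N11
  have hβ4 := h.β4
  have hp := h.hp
  obtain ⟨L, hL⟩ : ∃ L, L = Λ ^ (1 / (p - 1)) := ⟨_, rfl⟩
  have hLpos : 0 < L := by rw [hL]; positivity
  have hLp : L ^ (p - 1) = Λ := by
    rw [hL, ← Real.rpow_mul hΛ.le, one_div, inv_mul_cancel₀ (by linarith), Real.rpow_one]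
  obtain ⟨b, hb⟩ : ∃ b : ℝ, b = N - 2 - 2 * β := ⟨_, rfl⟩
  have hbpos : 0 < b := by rw [hb]; linarith
  have hdisc : 0 ≤ b ^ 2 - 4 * ((p - 1) * Λ) := by
    rw [hb, h.pΛ]; linarith [h.disc]
  obtain ⟨μ, hμ⟩ : ∃ μ, μ = (b - √(b ^ 2 - 4 * ((p - 1) * Λ))) / 2 := ⟨_, rfl⟩
  have hsq := Real.sq_sqrt hdisc
  have hs0 := Real.sqrt_nonneg (b ^ 2 - 4 * ((p - 1) * Λ))
  have hpΛ : 0 < (p - 1) * Λ := mul_pos (by linarith) hΛ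
  have hμeq : μ * (b - μ) = (p - 1) * Λ := by
    rw [hμ]; nlinarith
  have hbμ : 0 < b - μ := by rw [hμ]; linarith
  have hμpos : 0 < μ := by
    by_contra hcon
    have : μ * (b - μ) ≤ 0 := mul_nonpos_of_nonpos_of_nonneg (by linarith) hbμ.le
    linarith
  let Z : ℝ → ℝ := fun r => β * U r + r * U1 r
  let w : ℝ → ℝ := fun r => r ^ β * U r
  let y : ℝ → ℝ := fun r => μ * (L - w r) - r ^ β * Z r
  have cZ : Continuous Z := by fun_prop
  have crp : ∀ s : ℝ, 0 < s → Continuous fun r : ℝ => r ^ s := fun s hs =>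
    Real.continuous_rpow_const hs.le
  have cβ := crp β hβ
  have cw : Continuous w := by fun_prop
  have cy : Continuous y := by fun_prop
  have hwp : ∀ r, 0 < r → r < R → r ^ β * (r ^ 2 * U r ^ p) = w r ^ p := by
    intro r hr hrR
    change _ = (r ^ β * U r) ^ p
    rw [Real.mul_rpow (by positivity) (hpos r hr.le hrR).le, ← Real.rpow_mul hr.le, h.βp,
      Real.rpow_add hr]
    norm_cast
    ring
  have dZ : ∀ r, 0 < r → r < R → HasDerivAt Z ((β + 2 - N) * U1 r - r * U r ^ p) r :=
    fun r h1 h2 => core_dZ h1 (d1 r h1 h2) (d2 r h1 h2)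
  have dw : ∀ r, 0 < r → r < R → HasDerivAt w (r ^ β / r * Z r) r :=
    fun r h1 h2 => core_dw h1 (d1 r h1 h2)
  -- derivative of s-power times r^β Z
  have drZ : ∀ r, 0 < r → r < R →
      HasDerivAt (fun r => r ^ β * Z r) (1 / r * (-b * (r ^ β * Z r) + Λ * w r - w r ^ p)) r := by
    intro r h1 h2
    refine ((Real.hasDerivAt_rpow_const (Or.inl h1.ne')).mul (dZ r h1 h2)).congr_deriv ?_
    rw [Real.rpow_sub_one h1.ne', ← hwp r h1 h2, h.Λeq, hb]
    simp only [Z, w]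
    field_simp
    ring
  have dpow : ∀ (s : ℝ) (f : ℝ → ℝ) (f' r : ℝ), 0 < r → HasDerivAt f f' r →
      HasDerivAt (fun r => r ^ s * f r) (r ^ s / r * (s * f r + r * f')) r := by
    intro s f f' r hr hf
    refine ((Real.hasDerivAt_rpow_const (Or.inl hr.ne')).mul hf).congr_deriv ?_
    rw [Real.rpow_sub_one hr.ne']
    field_simp
  have dy : ∀ r, 0 < r → r < R → HasDerivAt y
      (μ * (-(r ^ β / r * Z r)) - 1 / r * (-b * (r ^ β * Z r) + Λ * w r - w r ^ p)) r := by
    intro r h1 h2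
    exact (((dw r h1 h2).const_sub L).const_mul μ).sub (drZ r h1 h2)
  have hwpos : ∀ r, 0 < r → r < R → 0 < w r := fun r h1 h2 =>
    mul_pos (Real.rpow_pos_of_pos h1 _) (hpos r h1.le h2)
  have g1 : MonotoneOn (fun r => r ^ (b - μ) * y r) (Set.Ico 0 R) := by
    apply monotoneOn_of_deriv_nonneg (convex_Ico 0 R)
    · exact ((crp _ hbμ).mul cy).continuousOn
    · rw [interior_Ico]
      intro r hr
      exact (dpow _ _ _ r hr.1 (dy r hr.1 hr.2)).differentiableAt.differentiableWithinAt
    · rw [interior_Ico]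
      intro r hr
      rw [(dpow _ _ _ r hr.1 (dy r hr.1 hr.2)).deriv]
      have hr0 := hr.1
      apply mul_nonneg (by positivity)
      have ht := core_tangent hp hLpos (hwpos r hr.1 hr.2).le hLp
      have : (b - μ) * y r + r * (μ * (-(r ^ β / r * Z r)) -
          1 / r * (-b * (r ^ β * Z r) + Λ * w r - w r ^ p)) =
          (b - μ) * μ * (L - w r) - Λ * w r + w r ^ p := by
        simp only [y]
        field_simp
        ring
      rw [this, mul_comm (b - μ), hμeq]
      linarith
  have hy0 : y 0 = μ * L := by
    simp [y, w, Real.zero_rpow hβ.ne']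
  have hypos : ∀ r, 0 < r → r < R → 0 < y r := by
    intro r hr hrR
    have hev : ∀ᶠ t in 𝓝[>] (0:ℝ), 0 < y t := by
      apply nhdsWithin_le_nhds
      apply cy.continuousAt.eventually
      rw [hy0]
      exact lt_mem_nhds (by positivity)
    have hev2 : ∀ᶠ t in 𝓝[>] (0:ℝ), t ∈ Set.Ioo 0 r := Ioo_mem_nhdsGT hr
    obtain ⟨t, ht1, ht2⟩ := (hev.and hev2).exists
    have := g1 ⟨ht2.1.le, ht2.2.trans hrR⟩ ⟨hr.le, hrR⟩ ht2.2.le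
    have h3 : 0 < t ^ (b - μ) * y t := mul_pos (Real.rpow_pos_of_pos ht2.1 _) ht1
    exact (mul_pos_iff_of_pos_left (Real.rpow_pos_of_pos hr _)).1 (h3.trans_le this)
  have g2 : StrictAntiOn (fun r => r ^ μ * (w r - L)) (Set.Ico 0 R) := by
    apply strictAntiOn_of_deriv_neg (convex_Ico 0 R)
    · exact ((crp _ hμpos).mul (cw.sub continuous_const)).continuousOn
    · rw [interior_Ico]
      intro r hr
      rw [(dpow _ _ _ r hr.1 ((dw r hr.1 hr.2).sub_const L)).deriv]
      have hr0 := hr.1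
      apply mul_neg_of_pos_of_neg (by positivity)
      have := hypos r hr.1 hr.2
      simp only [y] at this
      have e : r * (r ^ β / r * Z r) = r ^ β * Z r := by field_simp
      rw [e]; linarith
  have hwL : ∀ r, 0 < r → r < R → w r < L := by
    intro r hr hrR
    have := g2 (a := 0) ⟨le_rfl, hR⟩ ⟨hr.le, hrR⟩ hr
    simp only [Real.zero_rpow hμpos.ne', zero_mul] at this
    by_contra hcon
    have h2 : 0 ≤ r ^ μ * (w r - L) := mul_nonneg (by positivity) (by linarith)
    linarith
  have hwΛ : ∀ r, 0 < r → r < R → w r ^ (p - 1) < Λ := by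
    intro r hr hrR
    rw [← hLp]
    exact Real.rpow_lt_rpow (hwpos r hr hrR).le (hwL r hr hrR) (by linarith)
  have g3 : StrictMonoOn (fun r => r ^ b * (r ^ β * Z r)) (Set.Ico 0 R) := by
    apply strictMonoOn_of_deriv_pos (convex_Ico 0 R)
    · exact ((crp _ hbpos).mul (cβ.mul cZ)).continuousOn
    · rw [interior_Ico]
      intro r hr
      rw [(dpow _ _ _ r hr.1 (drZ r hr.1 hr.2)).deriv]
      have hr0 := hr.1
      apply mul_pos (by positivity)
      have e : b * (r ^ β * Z r) + r * (1 / r * (-b * (r ^ β * Z r) + Λ * w r - w r ^ p)) =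
        Λ * w r - w r ^ p := by field_simp; ring
      rw [e]
      have hw0 := hwpos r hr.1 hr.2
      have : w r ^ p = w r ^ (p - 1) * w r := by
        rw [← Real.rpow_add_one hw0.ne']; ring_nf
      rw [this]
      have := hwΛ r hr.1 hr.2
      nlinarith
  intro r hr hrR
  constructor
  · have := g3 (a := 0) ⟨le_rfl, hR⟩ ⟨hr.le, hrR⟩ hr
    simp only [Real.zero_rpow hbpos.ne', zero_mul] at this
    rw [← mul_assoc] at this
    exact (mul_pos_iff_of_pos_left (by positivity)).1 this
  · have := hwΛ r hr hrR
    simp only [w] at this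
    rw [Real.mul_rpow (by positivity) (hpos r hr.le hrR).le, ← Real.rpow_mul hr.le] at this
    have e : β * (p - 1) = 2 := by linarith [h.βp]
    rw [e] at this
    exact_mod_cast this.le

end core

theorem rpow_lip {p : ℝ} (hp : 1 < p) {x y : ℝ} (hx : x ∈ Set.Icc (0:ℝ) 1)
    (hy : y ∈ Set.Icc (0:ℝ) 1) : |x ^ p - y ^ p| ≤ p * |x - y| := by
  have := (convex_Icc (0:ℝ) 1).norm_image_sub_le_of_norm_hasDerivWithin_le (f := fun x : ℝ => x ^ p)
    (f' := fun x => p * x ^ (p - 1)) (C := p)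
    (fun z _ => (Real.hasDerivAt_rpow_const (Or.inr hp.le)).hasDerivWithinAt) (by
      intro z hz
      rw [Real.norm_eq_abs, abs_of_nonneg (mul_nonneg (by linarith) (Real.rpow_nonneg hz.1 _))]
      have : z ^ (p - 1) ≤ 1 := Real.rpow_le_one hz.1 hz.2 (by linarith)
      nlinarith) hy hx
  simpa using this

theorem exists_prof {N : ℕ} {p β Λ : ℝ} (h : Par N p β Λ) :
    ∃ U U1 : ℝ → ℝ, Prof N p β Λ U U1 := by
  have hp := h.hp
  have hN := h.N11
  have hβ := h.βpos
  have hcl : ∀ x : ℝ, max 0 (min x 1) ∈ Set.Icc (0:ℝ) 1 := fun x =>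
    ⟨le_max_left _ _, max_le zero_le_one (min_le_right _ _)⟩
  let F : ℝ → ℝ := fun x => (max 0 (min x 1)) ^ p
  have hF0 : ∀ x, 0 ≤ F x := fun x => Real.rpow_nonneg (hcl x).1 _
  have hF1 : ∀ x, F x ≤ 1 := fun x => Real.rpow_le_one (hcl x).1 (hcl x).2 (by linarith)
  have hFc : Continuous F := by
    apply Continuous.rpow_const (by fun_prop)
    intro x; right; linarith
  obtain ⟨U, hUc, hU⟩ := exists_fix N F p (by linarith) (by
    intro x y
    refine (rpow_lip hp (hcl x) (hcl y)).trans ?_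
    refine mul_le_mul_of_nonneg_left ?_ (by linarith)
    calc |max 0 (min x 1) - max 0 (min y 1)| ≤ max |0 - 0| |min x 1 - min y 1| :=
          abs_max_sub_max_le_max _ _ _ _
      _ = |min x 1 - min y 1| := by simp
      _ ≤ max |x - y| |1 - 1| := abs_min_sub_min_le_max _ _ _ _
      _ = |x - y| := by simp) hF0 hF1
  let A : ℝ → ℝ := AvI N (fun t => F (U t))
  have hFU : Continuous fun t => F (U t) := hFc.comp hUc
  have hA : Continuous A := AvI_continuous N hFU
  have hAm := AvI_mem N hFU (fun x => hF0 _) (fun x => hF1 _)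
  let U1 : ℝ → ℝ := fun r => -(r * A r)
  have hc1 : Continuous U1 := by fun_prop
  have hU0 : U 0 = 1 := by rw [hU]; simp
  have d1 : ∀ r, HasDerivAt U (U1 r) r := by
    intro r
    have hc : Continuous fun s => s * A s := by fun_prop
    have := (intervalIntegral.integral_hasDerivAt_right (hc.intervalIntegrable 0 r)
      (hc.stronglyMeasurableAtFilter _ _) hc.continuousAt).const_sub 1
    have e : U = fun r => 1 - ∫ s in (0:ℝ)..r, s * A s := by ext r; exact hU r
    rw [e]; exact this
  have d2' : ∀ r, 0 < r → HasDerivAt U1 (-(N - 1) / r * U1 r - F (U r)) r := by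
    intro r hr
    have h1 := AvI_hasDerivAt N (by have := h.hN; omega) hFU r
    have h2 : HasDerivAt (fun r : ℝ => r * (r ^ N)⁻¹)
        ((1 - N) * (r ^ N)⁻¹) r := by
      have e := (hasDerivAt_id r).mul ((hasDerivAt_pow N r).inv (pow_ne_zero N hr.ne'))
      refine e.congr_deriv ?_
      obtain ⟨m, hm⟩ : ∃ m, N = m + 1 := ⟨N - 1, by have := h.hN; omega⟩
      simp only [id, Pi.inv_apply]
      rw [hm]
      simp only [Nat.add_sub_cancel]
      have : r ^ m ≠ 0 := pow_ne_zero _ hr.ne'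
      field_simp
      ring
    have h3 := (h2.mul h1).neg
    have e : U1 =ᶠ[𝓝 r] -(fun r : ℝ => r * (r ^ N)⁻¹ * (r ^ N * A r)) := by
      filter_upwards [lt_mem_nhds hr] with t ht
      simp only [U1, Pi.neg_apply]
      have : t ^ N ≠ 0 := pow_ne_zero _ ht.ne'
      field_simp
    refine (h3.congr_of_eventuallyEq e).congr_deriv ?_
    simp only [U1]
    have hrN : r ^ N ≠ 0 := pow_ne_zero _ hr.ne'
    have : r * (r ^ N)⁻¹ * (r ^ (N - 1)) = 1 := by
      have : r ^ N = r * r ^ (N - 1) := by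
        rw [← pow_succ']; congr 1; have := h.hN; omega
      rw [this]; field_simp
    change -((1 - N) * (r ^ N)⁻¹ * (r ^ N * A r) + r * (r ^ N)⁻¹ * (r ^ (N - 1) * F (U r))) = _
    rw [← mul_assoc _ (r ^ (N - 1)), this]
    field_simp
    ring
  have hU1np : ∀ r, 0 ≤ r → U1 r ≤ 0 := fun r hr => by
    have := mul_nonneg hr (hAm r).1
    simp only [U1]; linarith
  have hanti : AntitoneOn U (Set.Ici 0) := by
    apply antitoneOn_of_deriv_nonpos (convex_Ici 0) hUc.continuousOn
    · intro r _; exact (d1 r).differentiableAt.differentiableWithinAt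
    · rw [interior_Ici]; intro r hr; rw [(d1 r).deriv]; exact hU1np r (le_of_lt hr)
  have hle1 : ∀ r, 0 ≤ r → U r ≤ 1 := fun r hr => by
    rw [← hU0]; exact hanti (Set.self_mem_Ici) hr hr
  have hFe : ∀ r, 0 ≤ r → 0 ≤ U r → F (U r) = U r ^ p := fun r hr h0 => by
    simp only [F]; rw [min_eq_left (hle1 r hr), max_eq_right h0]
  -- positivity
  have hpos : ∀ r, 0 ≤ r → 0 < U r := by
    by_contra hcon
    push Not at hcon
    obtain ⟨r1, hr1, hr1'⟩ := hcon
    -- first zero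
    obtain ⟨R, hR⟩ : ∃ R, IsLeast {r | 0 ≤ r ∧ U r ≤ 0} R := by
      have hcl : IsClosed {r | 0 ≤ r ∧ U r ≤ 0} :=
        (isClosed_le continuous_const continuous_id).inter (isClosed_le hUc continuous_const)
      exact ⟨_, hcl.isLeast_csInf ⟨r1, hr1, hr1'⟩ ⟨0, fun r hr => hr.1⟩⟩
    have hRpos : 0 < R := by
      rcases hR.1.1.lt_or_eq with h | h
      · exact h
      · have := hR.1.2; rw [← h, hU0] at this; linarith
    have hposR : ∀ r, 0 ≤ r → r < R → 0 < U r := by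
      intro r h1 h2
      by_contra hc
      exact absurd (hR.2 ⟨h1, not_lt.1 hc⟩) (by linarith)
    have hm := core_main h hRpos hUc hc1 hposR (fun r _ _ => d1 r) (fun r h1 h2 => by
      have := d2' r h1
      rwa [hFe r h1.le (hposR r h1.le h2).le] at this)
    have hmono : MonotoneOn (fun r => r ^ β * U r) (Set.Icc 0 R) := by
      apply monotoneOn_of_deriv_nonneg (convex_Icc 0 R)
      · exact ((Real.continuous_rpow_const hβ.le).mul hUc).continuousOn
      · rw [interior_Icc]; intro r hr
        exact (core_dw hr.1 (d1 r)).differentiableAt.differentiableWithinAt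
      · rw [interior_Icc]; intro r hr
        rw [(core_dw hr.1 (d1 r)).deriv]
        have := hr.1
        exact mul_nonneg (by positivity) (hm r hr.1 hr.2).1.le
    have h1 := hmono (a := R / 2) (b := R) ⟨by linarith, by linarith⟩ ⟨hRpos.le, le_rfl⟩ (by linarith)
    have h2 : 0 < (R / 2) ^ β * U (R / 2) :=
      mul_pos (by positivity) (hposR _ (by linarith) (by linarith))
    have h3 : R ^ β * U R ≤ 0 := mul_nonpos_of_nonneg_of_nonpos (by positivity) hR.1.2
    simp only at h1
    linarith
  have d2 : ∀ r, 0 < r → HasDerivAt U1 (-(N - 1) / r * U1 r - U r ^ p) r := by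
    intro r hr
    have := d2' r hr
    rwa [hFe r hr.le (hpos r hr.le).le] at this
  have hm : ∀ r, 0 < r → 0 < β * U r + r * U1 r ∧ r ^ 2 * U r ^ (p - 1) ≤ Λ := fun r hr =>
    core_main (R := r + 1) h (by linarith) hUc hc1 (fun r h _ => hpos r h)
      (fun r _ _ => d1 r) (fun r h _ => d2 r h) r hr (by linarith)
  have hw : MonotoneOn (fun r => r ^ β * U r) (Set.Ici 0) := by
    apply monotoneOn_of_deriv_nonneg (convex_Ici 0)
    · exact ((Real.continuous_rpow_const hβ.le).mul hUc).continuousOn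
    · rw [interior_Ici]; intro r hr
      exact (core_dw hr (d1 r)).differentiableAt.differentiableWithinAt
    · rw [interior_Ici]; intro r hr
      rw [(core_dw hr (d1 r)).deriv]
      have : 0 < r := hr
      exact mul_nonneg (by positivity) (hm r hr).1.le
  have hJ : ∀ r, 0 < r → (N - 2 - β) * (r ^ N * A r) ≤ r ^ N * U r ^ p := by
    have hdA : ∀ r, 0 < r → HasDerivAt (fun s => s ^ N * A s) (r ^ (N - 1) * U r ^ p) r := by
      intro r hr
      have := AvI_hasDerivAt N (by have := h.hN; omega) hFU r
      rwa [hFe r hr.le (hpos r hr.le).le] at this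
    have hmono : MonotoneOn (fun r => r ^ N * U r ^ p - (N - 2 - β) * (r ^ N * A r)) (Set.Ici 0) := by
      have hd : ∀ r, 0 < r → HasDerivAt
          (fun r => r ^ N * U r ^ p - (N - 2 - β) * (r ^ N * A r))
          (N * r ^ (N - 1) * U r ^ p + r ^ N * (U1 r * p * U r ^ (p - 1)) -
            (N - 2 - β) * (r ^ (N - 1) * U r ^ p)) r := by
        intro r hr
        exact ((hasDerivAt_pow N r).mul
          ((d1 r).rpow_const (Or.inl (hpos r hr.le).ne'))).sub ((hdA r hr).const_mul _)
      apply monotoneOn_of_deriv_nonneg (convex_Ici 0)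
      · apply ContinuousOn.sub
        · exact ((continuous_pow N).mul (hUc.rpow_const (fun x => Or.inr (by linarith)))).continuousOn
        · exact (by fun_prop : Continuous fun r => (N - 2 - β) * (r ^ N * A r)).continuousOn
      · rw [interior_Ici]; intro r hr
        exact (hd r hr).differentiableAt.differentiableWithinAt
      · rw [interior_Ici]; intro r hr
        have hr' : 0 < r := hr
        rw [(hd r hr).deriv]
        have hU := hpos r hr'.le
        have e1 : U r ^ p = U r ^ (p - 1) * U r := by
          rw [← Real.rpow_add_one hU.ne']; ring_nf
        have e2 : r ^ N = r * r ^ (N - 1) := by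
          rw [← pow_succ']; congr 1; have := h.hN; omega
        rw [e1, e2]
        have e3 : N * r ^ (N - 1) * (U r ^ (p - 1) * U r) +
            r * r ^ (N - 1) * (U1 r * p * U r ^ (p - 1)) -
            (N - 2 - β) * (r ^ (N - 1) * (U r ^ (p - 1) * U r)) =
            r ^ (N - 1) * U r ^ (p - 1) * ((β + 2) * U r + p * (r * U1 r)) := by ring
        rw [e3]
        apply mul_nonneg (by positivity)
        have := (hm r hr').1
        rw [← h.βp]
        nlinarith
    intro r hr
    have := hmono (a := 0) (b := r) (by simp) hr.le hr.le
    have hN0 : N ≠ 0 := by have := h.hN; omega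
    simp [hN0] at this
    linarith
  have hJ' : ∀ r, 0 < r → (N - 2 - β) * A r ≤ U r ^ p := by
    intro r hr
    have := hJ r hr
    have h2 : 0 < r ^ N := by positivity
    have e : (N - 2 - β) * (r ^ N * A r) = r ^ N * ((N - 2 - β) * A r) := by ring
    rw [e] at this
    exact le_of_mul_le_mul_left this h2
  refine ⟨U, U1, hUc, hc1, hU0, by simp [U1], hpos, hle1, fun r _ => d1 r, d2, ?_, ?_, ?_, ?_, ?_,
    ?_, ?_⟩
  · intro r hr
    have hAp : 0 < r ^ N * A r := by
      have hcc : Continuous fun t => t ^ (N - 1) * F (U t) := by fun_prop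
      have e := AvI_eq N (by have := h.hN; omega) (fun t => F (U t)) r
      change r ^ N * A r = _ at e
      rw [e]
      apply intervalIntegral.intervalIntegral_pos_of_pos_on (hcc.intervalIntegrable _ _) _ hr
      intro t ht
      rw [hFe t ht.1.le (hpos t ht.1.le).le]
      have := hpos t ht.1.le
      have := ht.1
      positivity
    have : 0 < A r := (mul_pos_iff_of_pos_left (by positivity)).1 hAp
    simp only [U1]
    nlinarith
  · intro r hr
    have := (hAm r).2
    simp only [U1]
    change -r ≤ -(r * AvI N (fun t => F (U t)) r)
    nlinarith
  · intro r hr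
    rcases hr.lt_or_eq with h | h
    · exact (hm r h).1
    · rw [← h, hU0]; simpa using hβ
  · intro r hr
    rcases hr.lt_or_eq with h' | h'
    · exact (hm r h').2
    · rw [← h']; simpa using h.Λpos.le
  · intro r hr
    rcases hr.lt_or_eq with h | h
    · have := hJ' r h
      simp only [U1]
      nlinarith
    · rw [← h]; simp [U1]
  · refine ⟨U 1, hpos 1 zero_le_one, fun r hr => ?_⟩
    have h1 : (1 + r) ^ (-β) ≤ 1 := Real.rpow_le_one_of_one_le_of_nonpos (by linarith) (by linarith)
    have hU1 := hpos 1 zero_le_one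
    rcases le_total r 1 with h | h
    · have := hanti (a := r) (b := 1) hr (by simp) h
      nlinarith
    · have := hw (a := 1) (b := r) (by simp) hr h
      simp only [Real.one_rpow, one_mul] at this
      have hr0 : 0 < r := by linarith
      rw [Real.rpow_neg (by linarith), ← div_eq_mul_inv, div_le_iff₀ (by positivity)]
      refine this.trans ?_
      rw [mul_comm]
      have := hpos r hr
      gcongr
      linarith
  · have hΛ := h.Λpos
    refine ⟨2 ^ β * (1 + Λ ^ (1 / (p - 1))), by positivity, fun r hr => ?_⟩
    have hLp : 0 < Λ ^ (1 / (p - 1)) := by positivity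
    rw [Real.rpow_neg (by linarith), ← div_eq_mul_inv, le_div_iff₀ (by positivity)]
    have hUr := hpos r hr
    rcases le_total r 1 with h' | h'
    · have h1 : (1 + r) ^ β ≤ 2 ^ β := by gcongr; linarith
      have h2 := hle1 r hr
      have : U r * (1 + r) ^ β ≤ 1 * 2 ^ β := by gcongr
      have h3 : (0:ℝ) < 2 ^ β := by positivity
      nlinarith
    · have hr0 : 0 < r := by linarith
      have h1 : (1 + r) ^ β ≤ (2 * r) ^ β := by gcongr; linarith
      rw [Real.mul_rpow (by norm_num) hr] at h1
      have h2 : r ^ β * U r ≤ Λ ^ (1 / (p - 1)) := by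
        have h3 := (hm r hr0).2
        have e : β * (p - 1) = 2 := by linarith [h.βp]
        have h4 : (r ^ β * U r) ^ (p - 1) = r ^ 2 * U r ^ (p - 1) := by
          rw [Real.mul_rpow (by positivity) hUr.le, ← Real.rpow_mul hr, e]; norm_cast
        rw [← h4] at h3
        have h5 := Real.rpow_le_rpow (by positivity) h3 (by
          have : 0 < p - 1 := by linarith
          positivity : 0 ≤ 1 / (p - 1))
        rwa [← Real.rpow_mul (by positivity), mul_one_div_cancel (by linarith), Real.rpow_one] at h5
      calc U r * (1 + r) ^ β ≤ U r * (2 ^ β * r ^ β) := by gcongr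
        _ = 2 ^ β * (r ^ β * U r) := by ring
        _ ≤ 2 ^ β * (1 + Λ ^ (1 / (p - 1))) := by gcongr; linarith

/-- `f` is differentiable near `0`, with first derivative `a` and second derivative `b` at zero. -/
def D2 (f : ℝ → ℝ) (a b : ℝ) : Prop :=
  ∃ d : ℝ → ℝ, (∀ᶠ t in 𝓝 (0:ℝ), HasDerivAt f (d t) t) ∧ d 0 = a ∧ HasDerivAt d b 0

theorem D2.congr {f : ℝ → ℝ} {a b a' b' : ℝ} (h : D2 f a b) (ha : a = a') (hb : b = b') :
    D2 f a' b' := by subst ha hb; exact h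

theorem D2.add {f g : ℝ → ℝ} {a b a' b' : ℝ} (hf : D2 f a b) (hg : D2 g a' b') :
    D2 (fun s => f s + g s) (a + a') (b + b') := by
  obtain ⟨d, h1, h2, h3⟩ := hf
  obtain ⟨d', h1', h2', h3'⟩ := hg
  refine ⟨fun t => d t + d' t, ?_, by simp only [h2, h2'], h3.add h3'⟩
  filter_upwards [h1, h1'] with t ht ht' using ht.add ht'

theorem D2.mul {f g : ℝ → ℝ} {a b a' b' : ℝ} (hf : D2 f a b) (hg : D2 g a' b') :
    D2 (fun s => f s * g s) (a * g 0 + f 0 * a') (b * g 0 + 2 * (a * a') + f 0 * b') := by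
  obtain ⟨d, h1, h2, h3⟩ := hf
  obtain ⟨d', h1', h2', h3'⟩ := hg
  refine ⟨fun t => d t * g t + f t * d' t, ?_, by simp only [h2, h2'], ?_⟩
  · filter_upwards [h1, h1'] with t ht ht' using ht.mul ht'
  · refine ((h3.mul h1'.self_of_nhds).add (h1.self_of_nhds.mul h3')).congr_deriv ?_
    rw [h2, h2']; ring

theorem D2.const_mul {f : ℝ → ℝ} {a b : ℝ} (c : ℝ) (hf : D2 f a b) :
    D2 (fun s => c * f s) (c * a) (c * b) := by
  obtain ⟨d, h1, h2, h3⟩ := hf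
  refine ⟨fun t => c * d t, ?_, by simp only [h2], h3.const_mul c⟩
  filter_upwards [h1] with t ht using ht.const_mul c

theorem D2.comp {f φ φ1 : ℝ → ℝ} {a b y c : ℝ} (hf : D2 f a b) (hy : f 0 = y)
    (hφ : ∀ᶠ y' in 𝓝 y, HasDerivAt φ (φ1 y') y') (hφ1 : HasDerivAt φ1 c y) :
    D2 (fun s => φ (f s)) (φ1 y * a) (c * a ^ 2 + φ1 y * b) := by
  obtain ⟨d, h1, h2, h3⟩ := hf
  subst hy
  refine ⟨fun t => φ1 (f t) * d t, ?_, by simp only [h2], ?_⟩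
  · filter_upwards [h1, h1.self_of_nhds.continuousAt.eventually hφ] with t ht ht'
    exact ht'.comp t ht
  · refine ((hφ1.comp 0 h1.self_of_nhds).mul h3).congr_deriv ?_
    simp only [Function.comp]
    rw [h2]; ring

theorem D2.le_zero {f : ℝ → ℝ} {a b : ℝ} (hf : D2 f a b) (hm : IsLocalMax f 0) : b ≤ 0 := by
  obtain ⟨d, h1, h2, h3⟩ := hf
  by_contra hb
  push Not at hb
  have hd : deriv f =ᶠ[𝓝 0] d := by
    filter_upwards [h1] with t ht using ht.deriv
  have h4 : deriv (deriv f) 0 = b := by rw [hd.deriv_eq, h3.deriv]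
  have hmin := isLocalMin_of_deriv_deriv_pos (f := f) (x₀ := 0) (by rw [h4]; exact hb)
    hm.deriv_eq_zero h1.self_of_nhds.continuousAt
  have hc : f =ᶠ[𝓝 0] fun _ => f 0 := by
    filter_upwards [hm, hmin] with t ht ht' using le_antisymm ht ht'
  have : deriv (deriv f) 0 = 0 := by
    rw [hc.deriv.deriv_eq]; simp
  linarith

/-- coordinate vector -/
abbrev ee {N : ℕ} (i : Fin N) : Euc N := EuclideanSpace.single i (1:ℝ)

/-- `B` has first partials `g` and pure second partials `h` at `x`. -/
def HL {N : ℕ} (B : Euc N → ℝ) (x : Euc N) (g h : Fin N → ℝ) : Prop :=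
  ∀ i, D2 (fun s : ℝ => B (x + s • ee i)) (g i) (h i)

section HL
variable {N : ℕ} {B C : Euc N → ℝ} {x : Euc N} {g h g' h' : Fin N → ℝ}

theorem HL.congr (hB : HL B x g h) (hg : ∀ i, g i = g' i) (hh : ∀ i, h i = h' i) :
    HL B x g' h' := fun i => (hB i).congr (hg i) (hh i)

theorem HL.congr_fun (hB : HL B x g h) (hC : C =ᶠ[𝓝 x] B) : HL C x g h := by
  intro i
  obtain ⟨d, h1, h2, h3⟩ := hB i
  refine ⟨d, ?_, h2, h3⟩
  have hc : ContinuousAt (fun s : ℝ => x + s • ee (N := N) i) 0 := by fun_prop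
  have : ∀ᶠ s in 𝓝 (0:ℝ), C (x + s • ee i) = B (x + s • ee i) := by
    have hc' : Tendsto (fun s : ℝ => x + s • ee (N := N) i) (𝓝 0) (𝓝 x) := by
      simpa [ContinuousAt] using hc
    exact hc'.eventually hC
  filter_upwards [h1, this.eventually_nhds] with t ht ht'
  exact ht.congr_of_eventuallyEq ht'

theorem HL.add (hB : HL B x g h) (hC : HL C x g' h') :
    HL (fun y => B y + C y) x (fun i => g i + g' i) (fun i => h i + h' i) :=
  fun i => (hB i).add (hC i)

theorem HL.mul (hB : HL B x g h) (hC : HL C x g' h') :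
    HL (fun y => B y * C y) x (fun i => g i * C x + B x * g' i)
      (fun i => h i * C x + 2 * (g i * g' i) + B x * h' i) :=
  fun i => ((hB i).mul (hC i)).congr (by simp) (by simp)

theorem HL.const_mul (c : ℝ) (hB : HL B x g h) :
    HL (fun y => c * B y) x (fun i => c * g i) (fun i => c * h i) :=
  fun i => (hB i).const_mul c

theorem HL.sub (hB : HL B x g h) (hC : HL C x g' h') :
    HL (fun y => B y - C y) x (fun i => g i - g' i) (fun i => h i - h' i) := by
  have := hB.add (hC.const_mul (-1))
  intro i
  have h2 := (this i).congr (a' := g i - g' i) (b' := h i - h' i) (by ring) (by ring)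
  convert h2 using 2
  ring

theorem HL.comp {φ φ1 : ℝ → ℝ} {y c : ℝ} (hB : HL B x g h) (hy : B x = y)
    (hφ : ∀ᶠ y' in 𝓝 y, HasDerivAt φ (φ1 y') y') (hφ1 : HasDerivAt φ1 c y) :
    HL (fun z => φ (B z)) x (fun i => φ1 y * g i) (fun i => c * g i ^ 2 + φ1 y * h i) :=
  fun i => (hB i).comp (by simpa using hy) hφ hφ1

theorem HL_inner (a x : Euc N) : HL (fun y => ⟪y, a⟫_ℝ) x (fun i => a i) (fun _ => 0) := by
  intro i
  refine ⟨fun _ => a i, ?_, rfl, hasDerivAt_const _ _⟩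
  refine Eventually.of_forall fun t => ?_
  have e : (fun s : ℝ => ⟪x + s • ee i, a⟫_ℝ) = fun s => ⟪x, a⟫_ℝ + s * a i := by
    ext s
    rw [inner_add_left, inner_smul_left]
    simp [EuclideanSpace.inner_single_left]
  rw [e]
  simpa using ((hasDerivAt_id t).mul_const (a i)).const_add ⟪x, a⟫_ℝ

theorem HL_normsq (x : Euc N) : HL (fun y => ‖y‖ ^ 2) x (fun i => 2 * x i) (fun _ => 2) := by
  intro i
  refine ⟨fun t => 2 * x i + 2 * t, ?_, by simp, ?_⟩
  · refine Eventually.of_forall fun t => ?_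
    have e : (fun s : ℝ => ‖x + s • ee i‖ ^ 2) = fun s => ‖x‖ ^ 2 + 2 * x i * s + s ^ 2 := by
      ext s
      rw [norm_add_sq_real, inner_smul_right, norm_smul]
      simp [EuclideanSpace.inner_single_right]
      ring
    rw [e]
    refine ((((hasDerivAt_id t).const_mul (2 * x i)).const_add (‖x‖ ^ 2)).add
      (hasDerivAt_pow 2 t)).congr_deriv ?_
    simp
  · simpa using ((hasDerivAt_id (0:ℝ)).const_mul 2).const_add (2 * x i)

theorem HL_norm {x : Euc N} (hx : x ≠ 0) :
    HL (fun y => ‖y‖) x (fun i => x i / ‖x‖) (fun i => 1 / ‖x‖ - x i ^ 2 / ‖x‖ ^ 3) := by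
  have hn : 0 < ‖x‖ := norm_pos_iff.2 hx
  have hs : √(‖x‖ ^ 2) = ‖x‖ := Real.sqrt_sq hn.le
  have h1 : ∀ᶠ y in 𝓝 (‖x‖ ^ 2), HasDerivAt (fun y => √y) (1 / (2 * √y)) y := by
    filter_upwards [lt_mem_nhds (show 0 < ‖x‖ ^ 2 by positivity)] with y hy
    exact Real.hasDerivAt_sqrt hy.ne'
  have h2 : HasDerivAt (fun y => 1 / (2 * √y)) (-1 / (4 * ‖x‖ ^ 3)) (‖x‖ ^ 2) := by
    have h3 := (Real.hasDerivAt_sqrt (show ‖x‖ ^ 2 ≠ 0 by positivity)).const_mul 2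
    have h4 := h3.inv (by rw [hs]; positivity)
    simp only [one_div]
    refine h4.congr_deriv ?_
    rw [hs]; field_simp; norm_num
  have := (HL_normsq x).comp rfl h1 h2
  simp only [Real.sqrt_sq (norm_nonneg _)] at this
  refine this.congr (fun i => ?_) (fun i => ?_)
  · field_simp
  · field_simp; ring

theorem sum_sq_eq (x : Euc N) : ∑ i, x i ^ 2 = ‖x‖ ^ 2 := by
  rw [EuclideanSpace.norm_sq_eq]; simp

/-- radial functions -/
theorem HL_radial {f f1 : ℝ → ℝ} {c : ℝ} {x : Euc N} (hx : x ≠ 0)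
    (hf : ∀ r, 0 < r → HasDerivAt f (f1 r) r) (hf1 : HasDerivAt f1 c ‖x‖) :
    HL (fun y => f ‖y‖) x (fun i => f1 ‖x‖ * (x i / ‖x‖))
      (fun i => c * (x i / ‖x‖) ^ 2 + f1 ‖x‖ * (1 / ‖x‖ - x i ^ 2 / ‖x‖ ^ 3)) :=
  (HL_norm hx).comp rfl
    (by filter_upwards [lt_mem_nhds (norm_pos_iff.2 hx)] with y hy using hf y hy) hf1

theorem sum_radial {x : Euc N} (hx : x ≠ 0) (c d : ℝ) :
    ∑ i, (c * (x i / ‖x‖) ^ 2 + d * (1 / ‖x‖ - x i ^ 2 / ‖x‖ ^ 3)) = c + (N - 1) / ‖x‖ * d := by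
  have hn : 0 < ‖x‖ := norm_pos_iff.2 hx
  have e : ∀ i, (c * (x i / ‖x‖) ^ 2 + d * (1 / ‖x‖ - x i ^ 2 / ‖x‖ ^ 3)) =
      (c / ‖x‖ ^ 2 - d / ‖x‖ ^ 3) * x i ^ 2 + d / ‖x‖ := by
    intro i; field_simp; ring
  simp only [e]
  rw [Finset.sum_add_distrib, ← Finset.mul_sum, sum_sq_eq]
  simp
  field_simp
  ring

theorem HL_of_contDiff {v : Euc N → ℝ} (hv : ContDiff ℝ 2 v) (x : Euc N) :
    HL v x (fun i => fderiv ℝ v x (ee i))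
      (fun i => fderiv ℝ (fun y => fderiv ℝ v y (ee i)) x (ee i)) := by
  intro i
  have hline : ∀ t : ℝ, HasDerivAt (fun s : ℝ => x + s • ee (N := N) i) (ee i) t := by
    intro t
    simpa using ((hasDerivAt_id t).smul_const (ee (N := N) i)).const_add x
  refine ⟨fun t => fderiv ℝ v (x + t • ee i) (ee i), ?_, by simp, ?_⟩
  · refine Eventually.of_forall fun t => ?_
    exact ((hv.differentiable (by norm_num)) _).hasFDerivAt.comp_hasDerivAt t (hline t)
  · have hd : Differentiable ℝ (fun y => fderiv ℝ v y (ee i)) :=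
      ((hv.fderiv_right (m := 1) (by norm_num)).clm_apply contDiff_const).differentiable (by norm_num)
    have := (hd (x + (0:ℝ) • ee i)).hasFDerivAt.comp_hasDerivAt (0:ℝ) (hline 0)
    have e : x + (0:ℝ) • ee (N := N) i = x := by simp
    rw [e] at this
    exact this

theorem max_principle {Ω : Set (Euc N)} (hΩ : IsOpen Ω) {W : Euc N → ℝ}
    (hc : ContinuousOn W Ω)
    (hcpt : ∀ δ > 0, ∃ K ⊆ Ω, IsCompact K ∧ ∀ x ∈ Ω, δ ≤ W x → x ∈ K)
    (hlap : ∀ x ∈ Ω, ∃ g h, HL W x g h ∧ 0 < ∑ i, h i) : ∀ x ∈ Ω, W x ≤ 0 := by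
  intro x0 hx0
  by_contra hpos
  push Not at hpos
  obtain ⟨K, hKΩ, hK, hKm⟩ := hcpt _ hpos
  have hx0K := hKm x0 hx0 le_rfl
  obtain ⟨x1, hx1, hmax⟩ := hK.exists_isMaxOn ⟨x0, hx0K⟩ (hc.mono hKΩ)
  have hall : ∀ y ∈ Ω, W y ≤ W x1 := by
    intro y hy
    by_cases h : W x0 ≤ W y
    · exact hmax (hKm y hy h)
    · exact (not_le.1 h).le.trans (hmax hx0K)
  obtain ⟨g, h, hHL, hs⟩ := hlap x1 (hKΩ hx1)
  have : ∑ i, h i ≤ 0 := by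
    apply Finset.sum_nonpos
    intro i _
    apply (hHL i).le_zero
    have hcl : ContinuousAt (fun s : ℝ => x1 + s • ee (N := N) i) 0 := by fun_prop
    have : ∀ᶠ s in 𝓝 (0:ℝ), x1 + s • ee i ∈ Ω := by
      have hc' : Tendsto (fun s : ℝ => x1 + s • ee (N := N) i) (𝓝 0) (𝓝 x1) := by
        simpa [ContinuousAt] using hcl
      exact hc'.eventually (hΩ.mem_nhds (hKΩ hx1))
    filter_upwards [this] with s hs
    simpa using hall _ hs
  linarith
end HL

section kernels
variable {N : ℕ}

theorem finrank_Euc : Module.finrank ℝ (Euc N) = N := by simp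

/-- the dominating function -/
theorem integrable_dom (hN : 1 ≤ N) {s τ : ℝ} (hs0 : 0 ≤ s) (hs : s < N) (hτ : 0 ≤ τ)
    (hsτ : N < s + τ) :
    Integrable (fun z : Euc N => ‖z‖ ^ (-s) * (1 + ‖z‖) ^ (-τ)) := by
  have hmeas : Measurable fun z : Euc N => ‖z‖ ^ (-s) := by fun_prop
  have h1 : IntegrableOn (fun z : Euc N => ‖z‖ ^ (-s)) (Metric.ball 0 1) := by
    apply integrableOn_ball_of_norm_le_rpow (C := 1) (α := s) (by rw [finrank_Euc]; exact hN)
      (by rw [finrank_Euc]; exact hs) _ hmeas.aestronglyMeasurable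
    refine Eventually.of_forall fun z => ?_
    rw [one_mul, Real.norm_of_nonneg (by positivity)]
  have h2 : Integrable (fun z : Euc N => (2:ℝ) ^ s * (1 + ‖z‖) ^ (-(s + τ))) :=
    (integrable_one_add_norm (by rw [finrank_Euc]; exact hsτ)).const_mul _
  have h3 : Integrable ((Metric.ball (0 : Euc N) 1).indicator (fun z : Euc N => ‖z‖ ^ (-s))) :=
    (integrable_indicator_iff measurableSet_ball).2 h1
  refine (h3.add h2).mono' (by fun_prop) (Eventually.of_forall fun z => ?_)
  rw [Real.norm_of_nonneg (by positivity)]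
  simp only [Pi.add_apply]
  by_cases hz : z ∈ Metric.ball (0 : Euc N) 1
  · rw [Set.indicator_of_mem hz]
    have : (1 + ‖z‖) ^ (-τ) ≤ 1 :=
      Real.rpow_le_one_of_one_le_of_nonpos (by linarith [norm_nonneg z]) (by linarith)
    have h4 : 0 ≤ (2:ℝ) ^ s * (1 + ‖z‖) ^ (-(s + τ)) := by positivity
    have h5 : 0 ≤ ‖z‖ ^ (-s) := by positivity
    nlinarith
  · rw [Set.indicator_of_notMem hz, zero_add]
    have hz' : 1 ≤ ‖z‖ := by simpa using hz
    rw [neg_add, Real.rpow_add (by positivity), ← mul_assoc]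
    gcongr
    rw [Real.rpow_neg (by positivity), Real.rpow_neg (by positivity), ← div_eq_mul_inv,
      inv_eq_one_div, div_le_div_iff₀ (by positivity) (by positivity), one_mul,
      ← Real.mul_rpow (by norm_num) (by positivity)]
    gcongr
    linarith

/-- kernel integral -/
def cv (k g : Euc N → ℝ) (x : Euc N) : ℝ := ∫ z, k z * g (x - z)

theorem shift_bound {τ : ℝ} (hτ : 0 ≤ τ) {R : ℝ} (x z : Euc N) (hx : ‖x‖ ≤ R) :
    (1 + ‖x - z‖) ^ (-τ) ≤ (1 + R) ^ τ * (1 + ‖z‖) ^ (-τ) := by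
  have hR : 0 ≤ R := (norm_nonneg x).trans hx
  have h1 : ‖z‖ ≤ ‖x‖ + ‖x - z‖ := by
    calc ‖z‖ = ‖x - (x - z)‖ := by congr 1; abel
      _ ≤ _ := norm_sub_le _ _
  rw [Real.rpow_neg (by positivity), Real.rpow_neg (by positivity), ← div_eq_mul_inv,
      inv_eq_one_div, div_le_div_iff₀ (by positivity) (by positivity), one_mul,
      ← Real.mul_rpow (by positivity) (by positivity)]
  gcongr
  nlinarith [norm_nonneg (x - z)]

/-- hypotheses on a kernel and a density -/
structure KerHyp (k g : Euc N → ℝ) (s τ C D : ℝ) : Prop where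
  hN : 1 ≤ N
  s0 : 0 ≤ s
  sN : s < N
  τ0 : 0 ≤ τ
  sτ : N < s + τ
  km : Measurable k
  kb : ∀ z, |k z| ≤ C * ‖z‖ ^ (-s)
  gm : Measurable g
  gb : ∀ y, |g y| ≤ D * (1 + ‖y‖) ^ (-τ)

theorem KerHyp.dom {k g : Euc N → ℝ} {s τ C D : ℝ} (h : KerHyp k g s τ C D) {R : ℝ} (x z : Euc N)
    (hx : ‖x‖ ≤ R) : ‖k z * g (x - z)‖ ≤
      (C * D * (1 + R) ^ τ) * (‖z‖ ^ (-s) * (1 + ‖z‖) ^ (-τ)) := by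
  rw [norm_mul, Real.norm_eq_abs, Real.norm_eq_abs]
  have hD : 0 ≤ D := by
    have := (abs_nonneg _).trans (h.gb 0); simpa using this
  calc |k z| * |g (x - z)| ≤ (C * ‖z‖ ^ (-s)) * (D * (1 + ‖x - z‖) ^ (-τ)) := by
        gcongr
        · exact (abs_nonneg _).trans (h.kb z)
        · exact h.kb z
        · exact h.gb _
    _ ≤ (C * ‖z‖ ^ (-s)) * (D * ((1 + R) ^ τ * (1 + ‖z‖) ^ (-τ))) := by
        gcongr
        · exact (abs_nonneg _).trans (h.kb z)
        · exact shift_bound h.τ0 x z hx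
    _ = _ := by ring

theorem KerHyp.integrable {k g : Euc N → ℝ} {s τ C D : ℝ} (h : KerHyp k g s τ C D) (x : Euc N) :
    Integrable fun z => k z * g (x - z) := by
  refine ((integrable_dom h.hN h.s0 h.sN h.τ0 h.sτ).const_mul (C * D * (1 + ‖x‖) ^ τ)).mono' ?_
    (Eventually.of_forall fun z => h.dom x z le_rfl)
  have := h.km; have := h.gm
  exact (h.km.mul (h.gm.comp (measurable_const.sub measurable_id))).aestronglyMeasurable

theorem KerHyp.continuous {k g : Euc N → ℝ} {s τ C D : ℝ} (h : KerHyp k g s τ C D)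
    (hg : Continuous g) : Continuous (cv k g) := by
  rw [continuous_iff_continuousAt]
  intro x0
  apply continuousAt_of_dominated
    (bound := fun z => (C * D * (1 + (‖x0‖ + 1)) ^ τ) * (‖z‖ ^ (-s) * (1 + ‖z‖) ^ (-τ)))
  · exact Eventually.of_forall fun x => (h.integrable x).aestronglyMeasurable
  · filter_upwards [Metric.ball_mem_nhds x0 one_pos] with x hx
    refine Eventually.of_forall fun z => h.dom x z ?_
    have : ‖x - x0‖ < 1 := by simpa [dist_eq_norm] using hx
    have h2 := norm_add_le (x - x0) x0
    rw [sub_add_cancel] at h2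
    linarith
  · exact (integrable_dom h.hN h.s0 h.sN h.τ0 h.sτ).const_mul _
  · refine Eventually.of_forall fun z => ?_
    fun_prop

/-- Newton kernel -/
def Gam (N : ℕ) (z : Euc N) : ℝ := ‖z‖ ^ (-((N:ℝ) - 2))
/-- regularised Newton kernel -/
def GamE (N : ℕ) (ε : ℝ) (z : Euc N) : ℝ := (ε ^ 2 + ‖z‖ ^ 2) ^ (-(((N:ℝ) - 2) / 2))
/-- gradient of Newton kernel -/
def dGam (N : ℕ) (i : Fin N) (z : Euc N) : ℝ := -((N:ℝ) - 2) * (z i * ‖z‖ ^ (-(N:ℝ)))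
/-- gradient of regularised Newton kernel -/
def dGamE (N : ℕ) (ε : ℝ) (i : Fin N) (z : Euc N) : ℝ :=
  -((N:ℝ) - 2) * (z i * (ε ^ 2 + ‖z‖ ^ 2) ^ (-((N:ℝ) / 2)))
/-- approximate identity -/
def rhoE (N : ℕ) (ε : ℝ) (z : Euc N) : ℝ :=
  N * (N - 2) * ε ^ 2 * (ε ^ 2 + ‖z‖ ^ 2) ^ (-(((N:ℝ) + 2) / 2))

theorem Gam_meas : Measurable (Gam N) := by unfold Gam; fun_prop
theorem dGam_meas (i : Fin N) : Measurable (dGam N i) := by unfold dGam; fun_prop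

theorem sq_rpow_half {r : ℝ} (hr : 0 ≤ r) (t : ℝ) : (r ^ 2) ^ (-(t / 2)) = r ^ (-t) := by
  rw [← Real.rpow_natCast, ← Real.rpow_mul hr]; congr 1; push_cast; ring

theorem reg_le {ε t : ℝ} (ht : 0 ≤ t) (z : Euc N) (hz : z ≠ 0) :
    (ε ^ 2 + ‖z‖ ^ 2) ^ (-(t / 2)) ≤ ‖z‖ ^ (-t) := by
  have hn := norm_pos_iff.2 hz
  rw [← sq_rpow_half hn.le]
  apply Real.rpow_le_rpow_of_nonpos (by positivity) (by nlinarith [sq_nonneg ε]) (by linarith)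

theorem reg_tendsto {t : ℝ} (z : Euc N) (hz : z ≠ 0) :
    Tendsto (fun ε : ℝ => (ε ^ 2 + ‖z‖ ^ 2) ^ (-(t / 2))) (𝓝 0) (𝓝 (‖z‖ ^ (-t))) := by
  have hn := norm_pos_iff.2 hz
  rw [← sq_rpow_half hn.le]
  have : ContinuousAt (fun ε : ℝ => (ε ^ 2 + ‖z‖ ^ 2) ^ (-(t / 2))) 0 := by
    apply ContinuousAt.rpow_const (by fun_prop)
    left; simp [hz]
  simpa [ContinuousAt] using this

theorem reg_contDiff {ε t : ℝ} (hε : ε ≠ 0) {n : WithTop ℕ∞} :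
    ContDiff ℝ n fun z : Euc N => (ε ^ 2 + ‖z‖ ^ 2) ^ t := by
  apply ContDiff.rpow_const_of_ne
  · exact contDiff_const.add (contDiff_norm_sq ℝ)
  · intro z; positivity

theorem reg_HL {ε t : ℝ} (hε : ε ≠ 0) (z : Euc N) :
    HL (fun z : Euc N => (ε ^ 2 + ‖z‖ ^ 2) ^ t) z
      (fun i => 2 * t * (z i * (ε ^ 2 + ‖z‖ ^ 2) ^ (t - 1)))
      (fun i => 4 * t * (t - 1) * z i ^ 2 * (ε ^ 2 + ‖z‖ ^ 2) ^ (t - 2) +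
        2 * t * (ε ^ 2 + ‖z‖ ^ 2) ^ (t - 1)) := by
  have hq : ∀ (t q : ℝ), 0 < ε ^ 2 + q →
      HasDerivAt (fun q => (ε ^ 2 + q) ^ t) (t * (ε ^ 2 + q) ^ (t - 1)) q := by
    intro t q hq
    have := ((hasDerivAt_id q).const_add (ε ^ 2)).rpow_const (p := t) (Or.inl hq.ne')
    simpa using this
  have h0 : 0 < ε ^ 2 + ‖z‖ ^ 2 := by positivity
  have h1 : ∀ᶠ q in 𝓝 (‖z‖ ^ 2), HasDerivAt (fun q => (ε ^ 2 + q) ^ t)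
      (t * (ε ^ 2 + q) ^ (t - 1)) q := by
    have : ∀ᶠ q in 𝓝 (‖z‖ ^ 2), 0 < ε ^ 2 + q := by
      have hcq : Tendsto (fun q : ℝ => ε ^ 2 + q) (𝓝 (‖z‖ ^ 2)) (𝓝 (ε ^ 2 + ‖z‖ ^ 2)) :=
        (continuous_const.add continuous_id).tendsto _
      exact hcq.eventually (lt_mem_nhds h0)
    filter_upwards [this] with q hq' using hq t q hq'
  have h2 := (hq (t - 1) _ h0).const_mul t
  refine ((HL_normsq z).comp rfl h1 h2).congr (fun i => ?_) (fun i => ?_)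
  · ring
  · rw [show t - 1 - 1 = t - 2 by ring]; ring

theorem D2.unique {f : ℝ → ℝ} {a b a' b' : ℝ} (h : D2 f a b) (h' : D2 f a' b') :
    a = a' ∧ b = b' := by
  obtain ⟨d, h1, h2, h3⟩ := h
  obtain ⟨d', h1', h2', h3'⟩ := h'
  have e : d =ᶠ[𝓝 0] d' := by
    filter_upwards [h1, h1'] with t ht ht' using ht.unique ht'
  refine ⟨by rw [← h2, ← h2', e.self_of_nhds], (h3.congr_of_eventuallyEq e.symm).unique h3'⟩

theorem HL.lap_eq {v : Euc N → ℝ} (hv : ContDiff ℝ 2 v) {x : Euc N} {g h : Fin N → ℝ}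
    (hHL : HL v x g h) : lap v x = ∑ i, h i := by
  unfold lap
  apply Finset.sum_congr rfl
  intro i _
  exact ((HL_of_contDiff hv x i).unique (hHL i)).2

theorem HL.fderiv_eq {v : Euc N → ℝ} (hv : ContDiff ℝ 2 v) {x : Euc N} {g h : Fin N → ℝ}
    (hHL : HL v x g h) (i : Fin N) : fderiv ℝ v x (ee i) = g i :=
  ((HL_of_contDiff hv x i).unique (hHL i)).1

theorem lap_GamE {ε : ℝ} (hε : ε ≠ 0) (z : Euc N) : lap (GamE N ε) z = -rhoE N ε z := by
  unfold GamE
  rw [(reg_HL hε z).lap_eq (reg_contDiff hε)]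
  rw [Finset.sum_add_distrib, ← Finset.sum_mul, ← Finset.mul_sum, sum_sq_eq]
  simp only [Finset.sum_const, Finset.card_univ, Fintype.card_fin, nsmul_eq_mul]
  unfold rhoE
  have hq : 0 < ε ^ 2 + ‖z‖ ^ 2 := by positivity
  rw [show -(((N:ℝ) + 2) / 2) = -(((N:ℝ) - 2) / 2) - 2 by ring]
  rw [show (ε ^ 2 + ‖z‖ ^ 2) ^ (-(((N:ℝ) - 2) / 2) - 1) =
    (ε ^ 2 + ‖z‖ ^ 2) ^ (-(((N:ℝ) - 2) / 2) - 2) * (ε ^ 2 + ‖z‖ ^ 2) by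
    rw [← Real.rpow_add_one hq.ne']; congr 1; ring]
  ring

theorem fderiv_GamE {ε : ℝ} (hε : ε ≠ 0) (z : Euc N) (i : Fin N) :
    fderiv ℝ (GamE N ε) z (ee i) = dGamE N ε i z := by
  have : ContDiff ℝ 2 (GamE N ε) := reg_contDiff hε
  rw [(reg_HL hε z : HL (GamE N ε) z _ _).fderiv_eq this]
  unfold dGamE
  rw [show -(((N:ℝ) - 2) / 2) - 1 = -((N:ℝ) / 2) by ring]
  ring

end kernels

section newton
variable {N : ℕ}

theorem two_le_sm : (2 : WithTop ℕ∞) ≤ ((⊤ : ℕ∞) : WithTop ℕ∞) :=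
  WithTop.coe_le_coe.2 (le_top : (2 : ℕ∞) ≤ ⊤)

/-- test functions -/
structure TF (φ : Euc N → ℝ) : Prop where
  sm : ContDiff ℝ (⊤ : ℕ∞) φ
  cs : HasCompactSupport φ

theorem TF.pd {φ : Euc N → ℝ} (h : TF φ) (v : Euc N) : TF (fun x => fderiv ℝ φ x v) := by
  refine ⟨?_, h.cs.fderiv_apply ℝ v⟩
  exact (h.sm.fderiv_right (m := (⊤ : ℕ∞)) (by simp)).clm_apply contDiff_const

theorem TF.add {φ ψ : Euc N → ℝ} (h : TF φ) (h' : TF ψ) : TF (fun x => φ x + ψ x) :=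
  ⟨h.sm.add h'.sm, h.cs.add h'.cs⟩

theorem TF.zero : TF (fun _ : Euc N => (0:ℝ)) := ⟨contDiff_const, HasCompactSupport.zero⟩

theorem TF.sum {ι : Type*} (s : Finset ι) {φ : ι → Euc N → ℝ} (h : ∀ i, TF (φ i)) :
    TF (fun x => ∑ i ∈ s, φ i x) := by
  classical
  induction s using Finset.induction_on with
  | empty => simpa using TF.zero
  | insert a s ha ih =>
    simp only [Finset.sum_insert ha]
    exact (h a).add ih

theorem TF.lap {φ : Euc N → ℝ} (h : TF φ) : TF (lap φ) := by
  unfold _root_.lap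
  exact TF.sum _ fun i => (h.pd _).pd _

theorem TF.cont {φ : Euc N → ℝ} (h : TF φ) : Continuous φ := h.sm.continuous

theorem TF.bdd {φ : Euc N → ℝ} (h : TF φ) : ∃ C, 0 ≤ C ∧ ∀ x, |φ x| ≤ C := by
  obtain ⟨C, hC⟩ := h.cs.exists_bound_of_continuous h.cont
  exact ⟨C, (norm_nonneg _).trans (hC 0), hC⟩

theorem cs_bound {φ : Euc N → ℝ} (hc : Continuous φ) (hs : HasCompactSupport φ) (τ : ℝ) :
    ∃ C, 0 ≤ C ∧ ∀ x, |φ x| ≤ C * (1 + ‖x‖) ^ (-τ) := by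
  have h1 : Continuous fun x : Euc N => φ x * (1 + ‖x‖) ^ τ := by
    apply hc.mul
    apply Continuous.rpow_const (by fun_prop)
    intro x; left; positivity
  obtain ⟨C, hC⟩ := HasCompactSupport.exists_bound_of_continuous (f := fun x : Euc N => φ x * (1 + ‖x‖) ^ τ)
    hs.mul_right h1
  refine ⟨C, (norm_nonneg _).trans (hC 0), fun x => ?_⟩
  have := hC x
  rw [Real.norm_eq_abs, abs_mul, abs_of_pos (by positivity : 0 < (1 + ‖x‖) ^ τ)] at this
  rw [Real.rpow_neg (by positivity), ← div_eq_mul_inv, le_div_iff₀ (by positivity)]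
  exact this

theorem ibp1 {f φ : Euc N → ℝ} (hf : ContDiff ℝ 1 f) (hφ : ContDiff ℝ 1 φ)
    (hs : HasCompactSupport φ) (v : Euc N) :
    ∫ x, f x * fderiv ℝ φ x v = - ∫ x, fderiv ℝ f x v * φ x := by
  have c1 : Continuous fun x => fderiv ℝ f x v := (hf.continuous_fderiv one_ne_zero).clm_apply continuous_const
  have c2 : Continuous fun x => fderiv ℝ φ x v := (hφ.continuous_fderiv one_ne_zero).clm_apply continuous_const
  apply integral_mul_fderiv_eq_neg_fderiv_mul_of_integrable
  · exact (c1.mul hφ.continuous).integrable_of_hasCompactSupport hs.mul_left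
  · exact (hf.continuous.mul c2).integrable_of_hasCompactSupport (hs.fderiv_apply ℝ v).mul_left
  · exact (hf.continuous.mul hφ.continuous).integrable_of_hasCompactSupport hs.mul_left
  · intro x _; exact hf.differentiable one_ne_zero x
  · intro x _; exact hφ.differentiable one_ne_zero x

theorem fderiv_refl {φ : Euc N → ℝ} (hφ : Differentiable ℝ φ) (x z v : Euc N) :
    fderiv ℝ (fun z => φ (x - z)) z v = - fderiv ℝ φ (x - z) v := by
  have h := (hφ (x - z)).hasFDerivAt.comp z ((hasFDerivAt_id z).const_sub x)
  have h2 : HasFDerivAt (fun z => φ (x - z)) _ z := h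
  rw [h2.fderiv]; simp

theorem cv_pd {k φ : Euc N → ℝ} (hk : ContDiff ℝ 1 k) (hφ : TF φ) (x v : Euc N) :
    cv k (fun y => fderiv ℝ φ y v) x = cv (fun z => fderiv ℝ k z v) φ x := by
  unfold cv
  have h1 : TF fun z => φ (x - z) :=
    ⟨hφ.sm.comp (contDiff_const.sub contDiff_id), hφ.cs.comp_homeomorph (Homeomorph.subLeft x)⟩
  have := ibp1 hk (h1.sm.of_le (by simp)) h1.cs v
  simp only [fderiv_refl (hφ.sm.differentiable (by simp)), mul_neg, integral_neg, neg_inj] at this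
  exact this

theorem cv_lap {k φ : Euc N → ℝ} (hk : ContDiff ℝ 2 k) (hφ : TF φ) (x : Euc N) :
    cv k (lap φ) x = cv (lap k) φ x := by
  have hk1 : ∀ i : Fin N, ContDiff ℝ 1 fun z => fderiv ℝ k z (ee i) := fun i =>
    (hk.fderiv_right (m := 1) (by norm_num)).clm_apply contDiff_const
  have hk2 : ∀ i : Fin N, Continuous fun z => fderiv ℝ (fun z => fderiv ℝ k z (ee i)) z (ee i) := fun i =>
    ((hk1 i).continuous_fderiv one_ne_zero).clm_apply continuous_const
  have e : ∀ i : Fin N, cv k (fun y => fderiv ℝ (fun y => fderiv ℝ φ y (ee i)) y (ee i)) x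
      = cv (fun z => fderiv ℝ (fun z => fderiv ℝ k z (ee i)) z (ee i)) φ x := fun i => by
    rw [cv_pd (hk.of_le (by norm_num)) (hφ.pd _), cv_pd (hk1 i) hφ]
  have hcs : ∀ {f : Euc N → ℝ}, TF f → TF (fun z => f (x - z)) := fun {f} hf =>
    ⟨hf.sm.comp (contDiff_const.sub contDiff_id), hf.cs.comp_homeomorph (Homeomorph.subLeft x)⟩
  unfold cv lap at *
  simp only [Finset.mul_sum, Finset.sum_mul]
  rw [integral_finsetSum, integral_finsetSum]
  · exact Finset.sum_congr rfl fun i _ => e i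
  · intro i _
    exact ((hk2 i).mul (hcs hφ).cont).integrable_of_hasCompactSupport (hcs hφ).cs.mul_left
  · intro i _
    exact (hk.continuous.mul (hcs ((hφ.pd _).pd _)).cont).integrable_of_hasCompactSupport
      (hcs ((hφ.pd _).pd _)).cs.mul_left

theorem ae_ne0 (hN : 1 ≤ N) : ∀ᵐ z : Euc N, z ≠ 0 := by
  have : Nonempty (Fin N) := ⟨⟨0, hN⟩⟩
  have : Nontrivial (Euc N) := inferInstance
  rw [ae_iff]; simp

/-- dominated convergence for kernels -/
theorem cv_tendsto {ι : Type*} {l : Filter ι} [l.IsCountablyGenerated] {k : ι → Euc N → ℝ}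
    {k0 g : Euc N → ℝ} {s τ C D : ℝ} (h : KerHyp k0 g s τ C D) (x : Euc N)
    (hm : ∀ᶠ ε in l, Measurable (k ε))
    (hb : ∀ᶠ ε in l, ∀ z, z ≠ 0 → |k ε z| ≤ C * ‖z‖ ^ (-s))
    (hl : ∀ z, z ≠ 0 → Tendsto (fun ε => k ε z) l (𝓝 (k0 z))) :
    Tendsto (fun ε => cv (k ε) g x) l (𝓝 (cv k0 g x)) := by
  have hD : 0 ≤ D := by
    have := (abs_nonneg _).trans (h.gb 0); simpa using this
  unfold cv
  apply tendsto_integral_filter_of_dominated_convergence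
    (fun z => (C * D * (1 + ‖x‖) ^ τ) * (‖z‖ ^ (-s) * (1 + ‖z‖) ^ (-τ)))
  · filter_upwards [hm] with ε hm
    exact (hm.mul (h.gm.comp (measurable_const.sub measurable_id))).aestronglyMeasurable
  · filter_upwards [hb] with ε hb
    filter_upwards [ae_ne0 h.hN] with z hz
    have hC := (abs_nonneg _).trans (hb z hz)
    rw [norm_mul, Real.norm_eq_abs, Real.norm_eq_abs]
    calc |k ε z| * |g (x - z)| ≤ (C * ‖z‖ ^ (-s)) * (D * (1 + ‖x - z‖) ^ (-τ)) := by
          gcongr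
          · exact hb z hz
          · exact h.gb _
      _ ≤ (C * ‖z‖ ^ (-s)) * (D * ((1 + ‖x‖) ^ τ * (1 + ‖z‖) ^ (-τ))) := by
          gcongr
          exact shift_bound h.τ0 x z le_rfl
      _ = _ := by ring
  · exact (integrable_dom h.hN h.s0 h.sN h.τ0 h.sτ).const_mul _
  · filter_upwards [ae_ne0 h.hN] with z hz
    exact (hl z hz).mul_const _

theorem GamE_le {ε : ℝ} (hN : 3 ≤ N) (z : Euc N) (hz : z ≠ 0) :
    |GamE N ε z| ≤ 1 * ‖z‖ ^ (-((N:ℝ) - 2)) := by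
  have : (3:ℝ) ≤ N := by exact_mod_cast hN
  unfold GamE
  rw [abs_of_nonneg (by positivity), one_mul]
  exact reg_le (by linarith) z hz

theorem abs_coord_le (z : Euc N) (i : Fin N) : |z i| ≤ ‖z‖ := by
  have h := EuclideanSpace.norm_eq z
  rw [h]
  apply Real.le_sqrt_of_sq_le
  rw [sq_abs]
  have := Finset.single_le_sum (f := fun j => ‖z j‖ ^ 2) (fun j _ => by positivity) (Finset.mem_univ i)
  simpa using this

theorem dGamE_le {ε : ℝ} (hN : 3 ≤ N) (i : Fin N) (z : Euc N) (hz : z ≠ 0) :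
    |dGamE N ε i z| ≤ ((N:ℝ) - 2) * ‖z‖ ^ (-((N:ℝ) - 1)) := by
  have hN' : (3:ℝ) ≤ N := by exact_mod_cast hN
  have hn := norm_pos_iff.2 hz
  unfold dGamE
  rw [abs_mul, abs_neg, abs_of_pos (by linarith : (0:ℝ) < (N:ℝ) - 2), abs_mul]
  have h1 : |(ε ^ 2 + ‖z‖ ^ 2) ^ (-((N:ℝ) / 2))| ≤ ‖z‖ ^ (-(N:ℝ)) := by
    rw [abs_of_nonneg (by positivity)]
    exact reg_le (by linarith) z hz
  have h2 : ‖z‖ ^ (-((N:ℝ) - 1)) = ‖z‖ * ‖z‖ ^ (-(N:ℝ)) := by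
    rw [mul_comm, ← Real.rpow_add_one hn.ne']; congr 1; ring
  rw [h2]
  have : (0:ℝ) ≤ (N:ℝ) - 2 := by linarith
  gcongr
  exact abs_coord_le z i

theorem Gam_le (z : Euc N) : |Gam N z| ≤ 1 * ‖z‖ ^ (-((N:ℝ) - 2)) := by
  unfold Gam; rw [abs_of_nonneg (by positivity), one_mul]

theorem dGam_le (hN : 3 ≤ N) (i : Fin N) (z : Euc N) :
    |dGam N i z| ≤ ((N:ℝ) - 2) * ‖z‖ ^ (-((N:ℝ) - 1)) := by
  have hN' : (3:ℝ) ≤ N := by exact_mod_cast hN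
  rcases eq_or_ne z 0 with rfl | hz
  · simp [dGam]; apply mul_nonneg (by linarith); positivity
  have hn := norm_pos_iff.2 hz
  unfold dGam
  rw [abs_mul, abs_neg, abs_of_pos (by linarith : (0:ℝ) < (N:ℝ) - 2), abs_mul,
    abs_of_nonneg (by positivity : (0:ℝ) ≤ ‖z‖ ^ (-(N:ℝ)))]
  have h2 : ‖z‖ ^ (-((N:ℝ) - 1)) = ‖z‖ * ‖z‖ ^ (-(N:ℝ)) := by
    rw [mul_comm, ← Real.rpow_add_one hn.ne']; congr 1; ring
  rw [h2]
  have : (0:ℝ) ≤ (N:ℝ) - 2 := by linarith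
  gcongr
  exact abs_coord_le z i

theorem GamE_tendsto (z : Euc N) (hz : z ≠ 0) :
    Tendsto (fun ε => GamE N ε z) (𝓝[>] 0) (𝓝 (Gam N z)) :=
  (reg_tendsto (t := (N:ℝ) - 2) z hz).mono_left nhdsWithin_le_nhds

theorem dGamE_tendsto (i : Fin N) (z : Euc N) (hz : z ≠ 0) :
    Tendsto (fun ε => dGamE N ε i z) (𝓝[>] 0) (𝓝 (dGam N i z)) :=
  (((reg_tendsto (t := (N:ℝ)) z hz).mono_left nhdsWithin_le_nhds).const_mul _).const_mul _

theorem KerHyp.gam (hN : 3 ≤ N) {g : Euc N → ℝ} {τ D : ℝ} (hτ : 2 < τ) (hg : Measurable g)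
    (hb : ∀ y, |g y| ≤ D * (1 + ‖y‖) ^ (-τ)) : KerHyp (Gam N) g (N - 2) τ 1 D := by
  have hN' : (3:ℝ) ≤ N := by exact_mod_cast hN
  exact ⟨by omega, by linarith, by linarith, by linarith, by linarith, Gam_meas, Gam_le, hg, hb⟩

theorem KerHyp.dgam (hN : 3 ≤ N) (i : Fin N) {g : Euc N → ℝ} {τ D : ℝ} (hτ : 1 < τ)
    (hg : Measurable g) (hb : ∀ y, |g y| ≤ D * (1 + ‖y‖) ^ (-τ)) :
    KerHyp (dGam N i) g (N - 1) τ (N - 2) D := by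
  have hN' : (3:ℝ) ≤ N := by exact_mod_cast hN
  exact ⟨by omega, by linarith, by linarith, by linarith, by linarith, dGam_meas i, dGam_le hN i, hg, hb⟩

/-- normalisation constant -/
def kap (N : ℕ) : ℝ := ∫ z : Euc N, rhoE N 1 z

theorem rhoE_cont {ε : ℝ} (hε : 0 < ε) : Continuous (rhoE N ε) := by
  unfold rhoE
  apply Continuous.mul continuous_const
  exact (reg_contDiff (n := 0) hε.ne').continuous

theorem rho1_int : Integrable (rhoE N 1) := by
  have := (integrable_rpow_neg_one_add_norm_sq (E := Euc N) (μ := volume) (r := (N:ℝ) + 2)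
    (by rw [finrank_Euc]; linarith)).const_mul (N * ((N:ℝ) - 2))
  unfold rhoE
  refine this.congr (Eventually.of_forall fun z => ?_)
  simp only [one_pow, mul_one]
  rw [neg_div]

theorem kap_pos (hN : 3 ≤ N) : 0 < kap N := by
  have hN' : (3:ℝ) ≤ N := by exact_mod_cast hN
  have hp : ∀ z : Euc N, 0 < rhoE N 1 z := fun z => by
    unfold rhoE
    have : (0:ℝ) < N - 2 := by linarith
    positivity
  unfold kap
  exact integral_pos_of_integrable_nonneg_nonzero (x := 0) (rhoE_cont one_pos) rho1_int (fun z => (hp z).le) (hp 0).ne'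

theorem rhoE_scale (hN : 3 ≤ N) {ε : ℝ} (hε : 0 < ε) (g : Euc N → ℝ) (x : Euc N) :
    cv (rhoE N ε) g x = ∫ w, rhoE N 1 w * g (x - ε • w) := by
  unfold cv
  have h1 := Measure.integral_comp_smul volume (fun z : Euc N => rhoE N ε z * g (x - z)) ε
  rw [finrank_Euc, abs_of_pos (by positivity), smul_eq_mul] at h1
  have h2 : ∀ w : Euc N, rhoE N ε (ε • w) = (ε ^ N)⁻¹ * rhoE N 1 w := by
    intro w
    unfold rhoE
    rw [norm_smul, Real.norm_of_nonneg hε.le]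
    rw [show ε ^ 2 + (ε * ‖w‖) ^ 2 = ε ^ 2 * (1 ^ 2 + ‖w‖ ^ 2) by ring,
      Real.mul_rpow (by positivity) (by positivity), sq_rpow_half hε.le]
    have : ε ^ (-((N:ℝ) + 2)) = (ε ^ N)⁻¹ * (ε ^ 2)⁻¹ := by
      rw [Real.rpow_neg hε.le, Real.rpow_add hε, Real.rpow_natCast, mul_inv]; norm_cast
    rw [this]; field_simp
  have h3 : (ε ^ N)⁻¹ ≠ 0 := by positivity
  apply mul_left_cancel₀ h3
  rw [← h1, ← integral_const_mul]
  congr 1; ext w; rw [h2]; ring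

theorem rhoE_tendsto (hN : 3 ≤ N) {g : Euc N → ℝ} (hg : Continuous g) {C : ℝ} (hb : ∀ x, |g x| ≤ C)
    (x : Euc N) : Tendsto (fun ε => cv (rhoE N ε) g x) (𝓝[>] 0) (𝓝 (kap N * g x)) := by
  have h : Tendsto (fun ε : ℝ => ∫ w, rhoE N 1 w * g (x - ε • w)) (𝓝[>] 0) (𝓝 (∫ w, rhoE N 1 w * g x)) := by
    apply tendsto_integral_filter_of_dominated_convergence (fun z => ‖rhoE N 1 z‖ * C)
    · refine Eventually.of_forall fun ε => ?_
      exact ((rhoE_cont one_pos).mul (hg.comp (by fun_prop))).aestronglyMeasurable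
    · refine Eventually.of_forall fun ε => Eventually.of_forall fun w => ?_
      rw [norm_mul]
      exact mul_le_mul_of_nonneg_left (hb _) (norm_nonneg _)
    · exact rho1_int.norm.mul_const C
    · refine Eventually.of_forall fun w => ?_
      apply Tendsto.mono_left _ (nhdsWithin_le_nhds)
      have : Continuous fun ε : ℝ => rhoE N 1 w * g (x - ε • w) := by fun_prop
      simpa using this.tendsto 0
  rw [integral_mul_const] at h
  refine h.congr' ?_
  filter_upwards [self_mem_nhdsWithin] with ε hε
  exact (rhoE_scale hN hε g x).symm

theorem GamE_contDiff {ε : ℝ} (hε : 0 < ε) {n : WithTop ℕ∞} : ContDiff ℝ n (GamE N ε) :=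
  reg_contDiff hε.ne'

theorem dGamE_contDiff {ε : ℝ} (hε : 0 < ε) (i : Fin N) {n : WithTop ℕ∞} :
    ContDiff ℝ n (dGamE N ε i) := by
  unfold dGamE
  apply contDiff_const.mul
  apply ContDiff.mul _ (reg_contDiff hε.ne')
  fun_prop

/-- Newton representation -/
theorem newton (hN : 3 ≤ N) {φ : Euc N → ℝ} (hφ : TF φ) (x : Euc N) :
    cv (Gam N) (lap φ) x = -(kap N * φ x) := by
  obtain ⟨D, -, hD⟩ := cs_bound hφ.lap.cont hφ.lap.cs 3
  have K := KerHyp.gam hN (by norm_num) hφ.lap.cont.measurable hD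
  have h1 := cv_tendsto K x (l := 𝓝[>] (0:ℝ)) (k := GamE N)
    (by filter_upwards [self_mem_nhdsWithin] with ε hε using (GamE_contDiff (n := 0) hε).continuous.measurable)
    (Eventually.of_forall fun ε => GamE_le hN) GamE_tendsto
  obtain ⟨C, -, hC⟩ := hφ.bdd
  have h2 := (rhoE_tendsto hN hφ.cont hC x).neg
  refine tendsto_nhds_unique h1 (h2.congr' ?_)
  filter_upwards [self_mem_nhdsWithin] with ε hε
  have hε : 0 < ε := hε
  rw [cv_lap (GamE_contDiff hε) hφ]
  unfold cv
  rw [← integral_neg]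
  congr 1; ext z
  rw [lap_GamE hε.ne']; ring

theorem dnewton (hN : 3 ≤ N) {φ : Euc N → ℝ} (hφ : TF φ) (i : Fin N) (x : Euc N) :
    cv (dGam N i) φ x = cv (Gam N) (fun y => fderiv ℝ φ y (ee i)) x := by
  obtain ⟨D, -, hD⟩ := cs_bound hφ.cont hφ.cs 3
  obtain ⟨D', -, hD'⟩ := cs_bound (hφ.pd (ee i)).cont (hφ.pd (ee i)).cs 3
  have K := KerHyp.dgam hN i (by norm_num) hφ.cont.measurable hD
  have K' := KerHyp.gam hN (by norm_num) (hφ.pd (ee i)).cont.measurable hD'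
  have h1 := cv_tendsto K x (l := 𝓝[>] (0:ℝ)) (k := fun ε => dGamE N ε i)
    (by filter_upwards [self_mem_nhdsWithin] with ε hε using
        (dGamE_contDiff (n := 0) hε i).continuous.measurable)
    (Eventually.of_forall fun ε => dGamE_le hN i) (dGamE_tendsto i)
  have h2 := cv_tendsto K' x (l := 𝓝[>] (0:ℝ)) (k := GamE N)
    (by filter_upwards [self_mem_nhdsWithin] with ε hε using (GamE_contDiff (n := 0) hε).continuous.measurable)
    (Eventually.of_forall fun ε => GamE_le hN) GamE_tendsto
  refine tendsto_nhds_unique h1 (h2.congr' ?_)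
  filter_upwards [self_mem_nhdsWithin] with ε hε
  have hε : 0 < ε := hε
  rw [cv_pd (GamE_contDiff hε) hφ]
  unfold cv
  congr 1; ext z
  show fderiv ℝ (GamE N ε) z (ee i) * φ (x - z) = _
  rw [fderiv_GamE hε.ne']

theorem locInt_of_le (hN : 1 ≤ N) {k : Euc N → ℝ} {s C : ℝ} (hs : s < N) (hk : Measurable k)
    (hb : ∀ z, |k z| ≤ C * ‖z‖ ^ (-s)) : LocallyIntegrable k := by
  apply locallyIntegrable_of_norm_le_rpow (C := C) (α := s) (by rw [finrank_Euc]; exact hN)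
      (by rw [finrank_Euc]; exact hs) (Eventually.of_forall hb) hk.aestronglyMeasurable

theorem cv_eq_conv (k g : Euc N → ℝ) : cv k g = convolution k g (ContinuousLinearMap.mul ℝ ℝ) volume := by
  ext x; simp [cv, convolution]

theorem cv_smooth {k g : Euc N → ℝ} (hk : LocallyIntegrable k) (hg : TF g) :
    ContDiff ℝ (⊤ : ℕ∞) (cv k g) := by
  rw [cv_eq_conv]
  exact hg.cs.contDiff_convolution_right _ hk hg.sm

theorem cv_fderiv {k g : Euc N → ℝ} (hk : LocallyIntegrable k) (hg : TF g) (x v : Euc N) :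
    fderiv ℝ (cv k g) x v = cv k (fun y => fderiv ℝ g y v) x := by
  rw [cv_eq_conv]
  have h := hg.cs.hasFDerivAt_convolution_right (ContinuousLinearMap.mul ℝ ℝ) hk
    (hg.sm.of_le (by simp)) x
  rw [h.fderiv]
  unfold cv convolution
  rw [ContinuousLinearMap.integral_apply]
  · rfl
  · have := (hg.cs.fderiv ℝ).convolutionExists_right
      ((ContinuousLinearMap.mul ℝ ℝ).precompR (Euc N)) hk (hg.sm.continuous_fderiv (by simp)) x
    exact this

theorem cv_lap_right {k g : Euc N → ℝ} (hk : LocallyIntegrable k) (hg : TF g) (x : Euc N) :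
    lap (cv k g) x = cv k (lap g) x := by
  have e : ∀ v : Euc N, (fun y => fderiv ℝ (cv k g) y v) = cv k (fun y => fderiv ℝ g y v) :=
    fun v => funext fun y => cv_fderiv hk hg y v
  unfold lap
  simp only [e, cv_fderiv hk (hg.pd _)]
  unfold cv
  simp only [Finset.mul_sum]
  rw [integral_finsetSum]
  intro i _
  have := ((hg.pd (ee i)).pd (ee i)).cs.convolutionExists_right (ContinuousLinearMap.mul ℝ ℝ) hk
    ((hg.pd (ee i)).pd (ee i)).cont x
  exact this

/-- the Newton potential -/
def Kop (g : Euc N → ℝ) (x : Euc N) : ℝ := (kap N)⁻¹ * cv (Gam N) g x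

theorem Gam_locInt (hN : 3 ≤ N) : LocallyIntegrable (Gam N) :=
  locInt_of_le (by omega) (by linarith) Gam_meas Gam_le

theorem Kop_smooth (hN : 3 ≤ N) {g : Euc N → ℝ} (hg : TF g) : ContDiff ℝ (⊤ : ℕ∞) (Kop g) :=
  contDiff_const.mul (cv_smooth (Gam_locInt hN) hg)

theorem lap_const_mul {v : Euc N → ℝ} (hv : ContDiff ℝ 2 v) (c : ℝ) (x : Euc N) :
    lap (fun y => c * v y) x = c * lap v x := by
  have h := (HL_of_contDiff hv x).const_mul c
  rw [h.lap_eq (contDiff_const.mul hv), ← Finset.mul_sum]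
  rfl

theorem Kop_lap (hN : 3 ≤ N) {g : Euc N → ℝ} (hg : TF g) (x : Euc N) : lap (Kop g) x = - g x := by
  show lap (fun y => (kap N)⁻¹ * cv (Gam N) g y) x = _
  rw [lap_const_mul ((cv_smooth (Gam_locInt hN) hg).of_le two_le_sm), cv_lap_right (Gam_locInt hN) hg, newton hN hg]
  have := (kap_pos hN).ne'
  field_simp

theorem Kop_HL (hN : 3 ≤ N) {g : Euc N → ℝ} (hg : TF g) (x : Euc N) :
    ∃ G H, HL (Kop g) x G H ∧ ∑ i, H i = - g x := by
  refine ⟨_, _, HL_of_contDiff ((Kop_smooth hN hg).of_le two_le_sm) x, ?_⟩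
  rw [← Kop_lap hN hg x]; rfl

theorem Kop_decay (hN : 3 ≤ N) {g : Euc N → ℝ} (hg : TF g) :
    ∀ δ > 0, ∃ R : ℝ, ∀ x, R ≤ ‖x‖ → |Kop g x| ≤ δ := by
  intro δ hδ
  have hN' : (3:ℝ) ≤ N := by exact_mod_cast hN
  obtain ⟨R, hR0, hR⟩ : ∃ R : ℝ, 0 < R ∧ ∀ x, R < ‖x‖ → g x = 0 := by
    obtain ⟨R, hR⟩ := hg.cs.isBounded.subset_closedBall 0
    refine ⟨max R 1, by positivity, fun x hx => ?_⟩
    by_contra h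
    have := hR (subset_tsupport _ h)
    simp at this
    linarith [le_max_left R 1]
  set I := ∫ y, |g y| with hI
  have hI0 : 0 ≤ I := integral_nonneg fun _ => abs_nonneg _
  have hgi : Integrable fun y => |g y| := (hg.cont.integrable_of_hasCompactSupport hg.cs).abs
  have hκ := kap_pos hN
  -- bound
  have hb : ∀ x : Euc N, 2 * R ≤ ‖x‖ → |Kop g x| ≤ (kap N)⁻¹ * ((‖x‖ / 2) ^ (-((N:ℝ) - 2)) * I) := by
    intro x hx
    unfold Kop cv
    rw [abs_mul, abs_of_pos (by positivity)]
    gcongr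
    have hxi : ∫ z, |g (x - z)| = I := integral_sub_left_eq_self (fun y => |g y|) volume x
    rw [← hxi, ← integral_const_mul, ← Real.norm_eq_abs]
    apply norm_integral_le_of_norm_le
    · exact (hgi.comp_sub_left x).const_mul _
    · refine Eventually.of_forall fun z => ?_
      rw [norm_mul, Real.norm_eq_abs, Real.norm_eq_abs]
      by_cases hz : R < ‖x - z‖
      · rw [hR _ hz]; simp
      · push Not at hz
        apply mul_le_mul_of_nonneg_right _ (abs_nonneg _)
        unfold Gam
        rw [abs_of_nonneg (by positivity)]
        have : ‖x‖ ≤ ‖x - z‖ + ‖z‖ := by simpa using norm_add_le (x - z) z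
        apply Real.rpow_le_rpow_of_nonpos (by linarith) (by linarith) (by linarith)
  have ht : Tendsto (fun r : ℝ => (kap N)⁻¹ * ((r / 2) ^ (-((N:ℝ) - 2)) * I)) atTop (𝓝 ((kap N)⁻¹ * (0 * I))) := by
    apply Tendsto.const_mul
    apply Tendsto.mul_const
    exact (tendsto_rpow_neg_atTop (by linarith : (0:ℝ) < (N:ℝ) - 2)).comp (tendsto_id.atTop_div_const (by norm_num))
  rw [zero_mul, mul_zero] at ht
  obtain ⟨R1, hR1⟩ := eventually_atTop.1 (ht.eventually (gt_mem_nhds hδ))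
  refine ⟨max R1 (2 * R), fun x hx => ?_⟩
  exact (hb x ((le_max_right _ _).trans hx)).trans (hR1 _ ((le_max_left _ _).trans hx)).le

end newton

section rep
variable {N : ℕ}

/-- admissible densities -/
structure Adm (τ : ℝ) (h : Euc N → ℝ) : Prop where
  cont : Continuous h
  bd : ∃ C, ∀ x, |h x| ≤ C * (1 + ‖x‖) ^ (-τ)

theorem TF.adm {φ : Euc N → ℝ} (h : TF φ) (τ : ℝ) : Adm τ φ := by
  obtain ⟨C, -, hC⟩ := cs_bound h.cont h.cs τ
  exact ⟨h.cont, C, hC⟩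

theorem Adm.mono {τ τ' : ℝ} {h : Euc N → ℝ} (hh : Adm τ h) (ht : τ' ≤ τ) : Adm τ' h := by
  obtain ⟨C, hC⟩ := hh.bd
  refine ⟨hh.cont, C, fun x => (hC x).trans ?_⟩
  have : 0 ≤ C := by simpa using (abs_nonneg _).trans (hC 0)
  have h1 : 1 ≤ 1 + ‖x‖ := by linarith [norm_nonneg x]
  exact mul_le_mul_of_nonneg_left (Real.rpow_le_rpow_of_exponent_le h1 (by linarith)) this

theorem one_add_rpow_cont (τ : ℝ) : Continuous fun x : Euc N => (1 + ‖x‖) ^ τ :=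
  Continuous.rpow_const (by fun_prop) fun x => Or.inl (by positivity)

theorem Adm.pow (τ : ℝ) : Adm τ fun x : Euc N => (1 + ‖x‖) ^ (-τ) :=
  ⟨one_add_rpow_cont _, 1, fun x => by rw [one_mul, abs_of_nonneg (by positivity)]⟩

theorem Adm.add {τ : ℝ} {f g : Euc N → ℝ} (hf : Adm τ f) (hg : Adm τ g) :
    Adm τ fun x => f x + g x := by
  obtain ⟨C, hC⟩ := hf.bd
  obtain ⟨D, hD⟩ := hg.bd
  refine ⟨hf.cont.add hg.cont, C + D, fun x => ?_⟩
  rw [add_mul]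
  exact (abs_add_le _ _).trans (add_le_add (hC x) (hD x))

theorem Adm.const_mul {τ : ℝ} {f : Euc N → ℝ} (c : ℝ) (hf : Adm τ f) :
    Adm τ fun x => c * f x := by
  obtain ⟨C, hC⟩ := hf.bd
  refine ⟨continuous_const.mul hf.cont, |c| * C, fun x => ?_⟩
  rw [abs_mul, mul_assoc]
  exact mul_le_mul_of_nonneg_left (hC x) (abs_nonneg c)

theorem Adm.kh (hN : 3 ≤ N) {τ : ℝ} (hτ : 2 < τ) {f : Euc N → ℝ} (hf : Adm τ f) :
    ∃ D, KerHyp (Gam N) f (N - 2) τ 1 D := by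
  obtain ⟨D, hD⟩ := hf.bd
  exact ⟨D, KerHyp.gam hN hτ hf.cont.measurable hD⟩

theorem Adm.int (hN : 3 ≤ N) {τ : ℝ} (hτ : 2 < τ) {f : Euc N → ℝ} (hf : Adm τ f) (x : Euc N) :
    Integrable fun z => Gam N z * f (x - z) := by
  obtain ⟨D, hD⟩ := hf.kh hN hτ
  exact hD.integrable x

theorem Kop_cont (hN : 3 ≤ N) {τ : ℝ} (hτ : 2 < τ) {f : Euc N → ℝ} (hf : Adm τ f) :
    Continuous (Kop f) := by
  obtain ⟨D, hD⟩ := hf.kh hN hτ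
  exact continuous_const.mul (hD.continuous hf.cont)

theorem Kop_add (hN : 3 ≤ N) {τ : ℝ} (hτ : 2 < τ) {f g : Euc N → ℝ} (hf : Adm τ f)
    (hg : Adm τ g) (x : Euc N) : Kop (fun y => f y + g y) x = Kop f x + Kop g x := by
  unfold Kop cv
  simp only [mul_add]
  rw [integral_add (hf.int hN hτ x) (hg.int hN hτ x)]; ring

theorem Kop_const_mul (c : ℝ) (f : Euc N → ℝ) (x : Euc N) :
    Kop (fun y => c * f y) x = c * Kop f x := by
  unfold Kop cv
  rw [show (fun z => Gam N z * (c * f (x - z))) = fun z => c * (Gam N z * f (x - z)) by ext z; ring,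
    integral_const_mul]; ring

theorem Kop_mono (hN : 3 ≤ N) {τ : ℝ} (hτ : 2 < τ) {f g : Euc N → ℝ} (hf : Adm τ f)
    (hg : Adm τ g) (h : ∀ y, f y ≤ g y) (x : Euc N) : Kop f x ≤ Kop g x := by
  unfold Kop cv
  have := kap_pos hN
  gcongr ?_ * ?_
  apply integral_mono (hf.int hN hτ x) (hg.int hN hτ x)
  intro z
  apply mul_le_mul_of_nonneg_left (h _)
  unfold Gam; positivity

theorem Kop_abs_le (hN : 3 ≤ N) {τ : ℝ} (hτ : 2 < τ) {f g : Euc N → ℝ} (hf : Adm τ f)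
    (hg : Adm τ g) (h : ∀ y, |f y| ≤ g y) (x : Euc N) : |Kop f x| ≤ Kop g x := by
  rw [abs_le]
  constructor
  · have := Kop_mono hN hτ (hg.const_mul (-1)) hf (fun y => by linarith [neg_abs_le (f y), h y]) x
    rw [Kop_const_mul] at this; linarith
  · exact Kop_mono hN hτ hf hg (fun y => (le_abs_self _).trans (h y)) x

theorem Kop_isom (L : Euc N ≃ₗᵢ[ℝ] Euc N) (f : Euc N → ℝ) (x : Euc N) :
    Kop (fun y => f (L y)) x = Kop f (L x) := by
  unfold Kop cv
  congr 1
  have h := L.measurePreserving.integral_comp L.toHomeomorph.measurableEmbedding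
    (fun z => Gam N z * f (L x - z))
  rw [← h]
  simp [Gam]

theorem approx_TF {σ C : ℝ} (hσ : 0 < σ) {h : Euc N → ℝ} (hc : Continuous h)
    (hb : ∀ x, |h x| ≤ C * (1 + ‖x‖) ^ (-(σ + 2))) {ε : ℝ} (hε : 0 < ε) :
    ∃ h', TF h' ∧ ∀ x, |h x - h' x| ≤ ε * (1 + ‖x‖) ^ (-(σ / 2 + 2)) := by
  have hC : 0 ≤ C := by simpa using (abs_nonneg _).trans (hb 0)
  have ht : Tendsto (fun r : ℝ => C * (1 + r) ^ (-(σ / 2))) atTop (𝓝 (C * 0)) := by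
    apply Tendsto.const_mul
    exact (tendsto_rpow_neg_atTop (by linarith : (0:ℝ) < σ / 2)).comp
      (tendsto_atTop_add_const_left _ _ tendsto_id)
  rw [mul_zero] at ht
  obtain ⟨R, hR⟩ := eventually_atTop.1 (ht.eventually (gt_mem_nhds (half_pos hε)))
  let χ : Euc N → ℝ := fun x => max 0 (min 1 (R + 1 - ‖x‖))
  have hχ : Continuous χ := by fun_prop
  have hχ0 : ∀ x, 0 ≤ χ x := fun x => le_max_left _ _
  have hχ1 : ∀ x, χ x ≤ 1 := fun x => max_le zero_le_one (min_le_left _ _)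
  have hcs : HasCompactSupport fun x => χ x * h x := by
    apply HasCompactSupport.of_support_subset_isCompact (isCompact_closedBall (0 : Euc N) (R + 1))
    intro x hx
    by_contra hx'
    apply hx
    have : R + 1 < ‖x‖ := by simpa using hx'
    have : χ x = 0 := max_eq_left ((min_le_right _ _).trans (by linarith))
    show χ x * h x = 0
    rw [this, zero_mul]
  obtain ⟨g, hg1, hg2, hg3⟩ := (hχ.mul hc).exists_contDiff_approx ⊤
    (ε := fun x => ε / 2 * (1 + ‖x‖) ^ (-(σ / 2 + 2)))
    (continuous_const.mul (one_add_rpow_cont _)) (fun x => by positivity)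
  refine ⟨g, ⟨hg1, hcs.mono hg3⟩, fun x => ?_⟩
  have h1 := (hg2 x).le
  rw [dist_comm, Real.dist_eq] at h1
  have h2 : |h x - χ x * h x| ≤ ε / 2 * (1 + ‖x‖) ^ (-(σ / 2 + 2)) := by
    by_cases hx : ‖x‖ ≤ R
    · have : χ x = 1 := by
        show max 0 (min 1 (R + 1 - ‖x‖)) = 1
        rw [min_eq_left (by linarith), max_eq_right zero_le_one]
      rw [this, one_mul, sub_self, abs_zero]; positivity
    · push Not at hx
      have e : h x - χ x * h x = (1 - χ x) * h x := by ring
      rw [e, abs_mul, abs_of_nonneg (by linarith [hχ1 x])]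
      calc (1 - χ x) * |h x| ≤ 1 * |h x| :=
            mul_le_mul_of_nonneg_right (by linarith [hχ0 x]) (abs_nonneg _)
        _ ≤ C * (1 + ‖x‖) ^ (-(σ + 2)) := by rw [one_mul]; exact hb x
        _ = (C * (1 + ‖x‖) ^ (-(σ / 2))) * (1 + ‖x‖) ^ (-(σ / 2 + 2)) := by
            rw [mul_assoc, ← Real.rpow_add (by positivity)]; congr 2; ring
        _ ≤ _ := by
            gcongr
            exact (hR _ hx.le).le
  calc |h x - g x| ≤ |h x - χ x * h x| + |χ x * h x - g x| := abs_sub_le _ _ _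
    _ ≤ _ := by
      have h1' : |χ x * h x - g x| ≤ ε / 2 * (1 + ‖x‖) ^ (-(σ / 2 + 2)) := h1
      linarith

theorem exists_bar {σ : ℝ} (hσ : 0 < σ) (hσN : σ / 2 < N - 2) :
    ∃ B : Euc N → ℝ, Continuous B ∧ (∀ x, 0 ≤ B x) ∧ (∃ M, ∀ x, B x ≤ M) ∧
      (∀ δ > 0, ∃ R : ℝ, ∀ x, R ≤ ‖x‖ → B x ≤ δ) ∧
      ∀ x, ∃ g h, HL B x g h ∧ (1 + ‖x‖) ^ (-(σ / 2 + 2)) ≤ -∑ i, h i := by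
  set b := σ / 2 with hb
  have hb0 : 0 < b := by positivity
  set c := b * (N - 2 - b) with hc
  have hc0 : 0 < c := mul_pos hb0 (by linarith)
  have hq : ∀ x : Euc N, 0 < (1:ℝ) ^ 2 + ‖x‖ ^ 2 := fun x => by positivity
  have hone : ∀ x : Euc N, (1:ℝ) ≤ 1 ^ 2 + ‖x‖ ^ 2 := fun x => by nlinarith [norm_nonneg x]
  refine ⟨fun x => c⁻¹ * ((1:ℝ) ^ 2 + ‖x‖ ^ 2) ^ (-(b / 2)), ?_, fun x => by positivity, ⟨c⁻¹, fun x => ?_⟩, ?_, ?_⟩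
  · exact continuous_const.mul (reg_contDiff (n := 0) one_ne_zero).continuous
  · have : ((1:ℝ) ^ 2 + ‖x‖ ^ 2) ^ (-(b / 2)) ≤ 1 :=
      Real.rpow_le_one_of_one_le_of_nonpos (hone x) (by linarith)
    have h2 := mul_le_mul_of_nonneg_left this (by positivity : 0 ≤ c⁻¹)
    rwa [mul_one] at h2
  · intro δ hδ
    have ht : Tendsto (fun r : ℝ => c⁻¹ * r ^ (-b)) atTop (𝓝 (c⁻¹ * 0)) :=
      (tendsto_rpow_neg_atTop hb0).const_mul _
    rw [mul_zero] at ht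
    obtain ⟨R, hR⟩ := eventually_atTop.1 (ht.eventually (gt_mem_nhds hδ))
    refine ⟨max R 1, fun x hx => ?_⟩
    have hx0 : x ≠ 0 := by
      rw [← norm_pos_iff]; linarith [le_max_right R 1]
    calc _ ≤ c⁻¹ * ‖x‖ ^ (-b) :=
          mul_le_mul_of_nonneg_left (reg_le hb0.le x hx0) (by positivity)
      _ ≤ δ := (hR _ ((le_max_left _ _).trans hx)).le
  · intro x
    refine ⟨_, _, (reg_HL one_ne_zero x).const_mul c⁻¹, ?_⟩
    rw [← Finset.mul_sum, Finset.sum_add_distrib, ← Finset.sum_mul, ← Finset.mul_sum, sum_sq_eq]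
    simp only [Finset.sum_const, Finset.card_univ, Fintype.card_fin, nsmul_eq_mul]
    set q := (1:ℝ) ^ 2 + ‖x‖ ^ 2 with hqd
    have hqp : 0 < q := hq x
    rw [show -(b / 2) - 1 = (-(b / 2) - 2) + 1 by ring, Real.rpow_add_one hqp.ne']
    have h1 : -(c⁻¹ * (4 * -(b / 2) * (-(b / 2) - 1) * ‖x‖ ^ 2 * q ^ (-(b / 2) - 2) +
        ↑N * (2 * -(b / 2) * (q ^ (-(b / 2) - 2) * q)))) =
        c⁻¹ * (q ^ (-(b / 2) - 2) * (b * N * q - b * (b + 2) * ‖x‖ ^ 2)) := by ring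
    rw [show (-(b / 2) - 2 + 1 : ℝ) = -(b / 2) - 1 by ring] at *
    rw [h1]
    have h2 : c * q ≤ b * N * q - b * (b + 2) * ‖x‖ ^ 2 := by
      rw [hc, hqd]; nlinarith [mul_pos hb0 (by linarith : 0 < b + 2)]
    calc (1 + ‖x‖) ^ (-(b + 2)) ≤ q ^ (-(b / 2) - 1) := by
          rw [show -(b / 2) - 1 = -((b + 2) / 2) by ring, ← sq_rpow_half (by positivity)]
          apply Real.rpow_le_rpow_of_nonpos hqp _ (by linarith)
          rw [hqd]; nlinarith [norm_nonneg x]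
      _ = c⁻¹ * (q ^ (-(b / 2) - 2) * (c * q)) := by
          rw [show -(b / 2) - 1 = (-(b / 2) - 2) + 1 by ring, Real.rpow_add_one hqp.ne']
          field_simp
      _ ≤ _ := by gcongr

/-- one-sided representation -/
theorem rep_le (hN : 4 ≤ N) {σ : ℝ} (hσ : 0 < σ) (hσN : σ / 2 < N - 2) {ψ h : Euc N → ℝ}
    (hψ : Continuous ψ) (hψ0 : ∀ δ > 0, ∃ R : ℝ, ∀ x, R ≤ ‖x‖ → |ψ x| ≤ δ)
    (hh : Adm (σ + 2) h) (hHL : ∀ x, x ≠ 0 → ∃ g H, HL ψ x g H ∧ ∑ i, H i = - h x)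
    (x : Euc N) (hx : x ≠ 0) : ψ x ≤ Kop h x := by
  obtain ⟨C, hC⟩ := hh.bd
  obtain ⟨B, hBc, hB0, ⟨M, hBM⟩, hBd, hBl⟩ := exists_bar (N := N) hσ hσN
  have hN3 : 3 ≤ N := by omega
  have hτ : 2 < σ / 2 + 2 := by linarith
  set P := Kop (fun x : Euc N => (1 + ‖x‖) ^ (-(σ / 2 + 2))) x
  have key : ∀ ε > 0, ∀ δ > 0, ψ x ≤ Kop h x + ε * (P + 2 * M) + δ * ‖x‖⁻¹ := by
    intro ε hε δ hδ
    obtain ⟨h', hTF, hap⟩ := approx_TF hσ hh.cont hC hε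
    have hclose : Kop h' x ≤ Kop h x + ε * P := by
      have := Kop_mono hN3 hτ (hTF.adm _) ((hh.mono (by linarith)).add ((Adm.pow (σ / 2 + 2)).const_mul ε))
        (fun y => by have := (abs_le.1 (hap y)).1; linarith) x
      rw [Kop_add hN3 hτ (hh.mono (by linarith)) ((Adm.pow (σ / 2 + 2)).const_mul ε), Kop_const_mul] at this
      exact this
    set W : Euc N → ℝ := fun y => ψ y - Kop h' y - 2 * ε * B y - δ * ‖y‖⁻¹ with hW
    have hKc := Kop_cont hN3 hτ (hTF.adm (σ / 2 + 2))
    have hcont : ContinuousOn W {0}ᶜ := by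
      intro y hy
      have hy : ‖y‖ ≠ 0 := by simpa using hy
      apply ContinuousAt.continuousWithinAt
      have := continuous_norm.continuousAt (x := y)
      exact ((hψ.continuousAt.sub hKc.continuousAt).sub (continuousAt_const.mul hBc.continuousAt)).sub
        (continuousAt_const.mul (this.inv₀ hy))
    have hmax := max_principle (Ω := {0}ᶜ) isOpen_compl_singleton hcont ?_ ?_ x hx
    · have := mul_le_mul_of_nonneg_left (hBM x) (by positivity : 0 ≤ 2 * ε)
      simp only [hW] at hmax
      linarith
    · intro η hη
      obtain ⟨R1, hR1⟩ := hψ0 (η / 4) (by positivity)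
      obtain ⟨R2, hR2⟩ := Kop_decay hN3 hTF (η / 4) (by positivity)
      have hloc : Continuous fun y => ψ y - Kop h' y := hψ.sub hKc
      obtain ⟨A, hA⟩ := (isCompact_closedBall (0 : Euc N) 1).exists_bound_of_continuousOn hloc.continuousOn
      have hA0 : 0 ≤ A := (norm_nonneg _).trans (hA 0 (by simp))
      set r0 := min 1 (δ / (A + 1)) with hr0
      have hr0p : 0 < r0 := by positivity
      refine ⟨Metric.closedBall 0 (max R1 R2) \ Metric.ball 0 r0, ?_, (isCompact_closedBall _ _).diff Metric.isOpen_ball, ?_⟩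
      · rintro y ⟨-, hy⟩ rfl
        exact hy (by simpa using hr0p)
      · intro y hy hyW
        have hyn : 0 < ‖y‖ := norm_pos_iff.2 hy
        have hBy := hB0 y
        have e1 : 0 ≤ 2 * ε * B y := by positivity
        have e2 : 0 ≤ δ * ‖y‖⁻¹ := by positivity
        constructor
        · rw [mem_closedBall_zero_iff]
          by_contra hcon
          push Not at hcon
          have a1 := (abs_le.1 (hR1 y ((le_max_left _ _).trans hcon.le))).2
          have a2 := (abs_le.1 (hR2 y ((le_max_right _ _).trans hcon.le))).1
          simp only [hW] at hyW
          linarith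
        · rw [mem_ball_zero_iff]
          intro hlt
          have a1 : ψ y - Kop h' y ≤ A :=
            (le_abs_self _).trans (hA y (by simpa using (hlt.trans_le (min_le_left _ _)).le))
          have a2 : A + 1 ≤ δ * ‖y‖⁻¹ := by
            rw [← div_eq_mul_inv, le_div_iff₀ hyn]
            have := hlt.le.trans (min_le_right _ _)
            rw [le_div_iff₀ (by linarith)] at this
            linarith
          simp only [hW] at hyW
          linarith
    · intro y hy
      have hyn : 0 < ‖y‖ := norm_pos_iff.2 hy
      obtain ⟨g1, H1, a1, b1⟩ := hHL y hy
      obtain ⟨g2, H2, a2, b2⟩ := Kop_HL hN3 hTF y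
      obtain ⟨g3, H3, a3, b3⟩ := hBl y
      have a4 := HL_radial (N := N) (f := fun r => r⁻¹) (f1 := fun r => -(r ^ 2)⁻¹) (c := 2 * (‖y‖ ^ 3)⁻¹) hy
        (fun r hr => hasDerivAt_inv hr.ne') (by
          refine (((hasDerivAt_id ‖y‖).pow 2).inv (by simp; exact hy)).neg.congr_deriv ?_
          simp; field_simp)
      have b4 := sum_radial hy (2 * (‖y‖ ^ 3)⁻¹) (-(‖y‖ ^ 2)⁻¹)
      refine ⟨_, _, ((a1.sub a2).sub (a3.const_mul (2 * ε))).sub (a4.const_mul δ), ?_⟩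
      simp only [Finset.sum_sub_distrib, ← Finset.mul_sum, b1, b2]
      rw [b4]
      have h5 := (abs_le.1 (hap y)).2
      have h6 : 2 * (‖y‖ ^ 3)⁻¹ + (↑N - 1) / ‖y‖ * -(‖y‖ ^ 2)⁻¹ ≤ 0 := by
        have : 2 * (‖y‖ ^ 3)⁻¹ + (↑N - 1) / ‖y‖ * -(‖y‖ ^ 2)⁻¹ = (3 - N) * (‖y‖ ^ 3)⁻¹ := by
          field_simp; ring
        rw [this]
        have h4 : (4:ℝ) ≤ N := by exact_mod_cast hN
        exact mul_nonpos_of_nonpos_of_nonneg (by linarith) (by positivity)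
      have h7 : 0 < ε * (1 + ‖y‖) ^ (-(σ / 2 + 2)) := by positivity
      have h8 := mul_le_mul_of_nonneg_left b3 (by positivity : 0 ≤ 2 * ε)
      have h9 := mul_nonpos_of_nonneg_of_nonpos hδ.le h6
      linarith
  have h1 : ∀ ε > 0, ψ x ≤ Kop h x + ε * (P + 2 * M) := by
    intro ε hε
    apply le_of_forall_pos_le_add
    intro η hη
    have := key ε hε (η * ‖x‖) (mul_pos hη (norm_pos_iff.2 hx))
    rwa [mul_assoc, mul_inv_cancel₀ (norm_ne_zero_iff.2 hx), mul_one] at this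
  have h2 : Tendsto (fun ε : ℝ => Kop h x + ε * (P + 2 * M)) (𝓝[>] 0) (𝓝 (Kop h x + 0 * (P + 2 * M))) :=
    ((continuous_const.add (continuous_id.mul continuous_const)).tendsto 0).mono_left nhdsWithin_le_nhds
  rw [zero_mul, add_zero] at h2
  exact ge_of_tendsto h2 (by filter_upwards [self_mem_nhdsWithin] with ε hε using h1 ε hε)

theorem Euc_nontrivial (hN : 1 ≤ N) : Nontrivial (Euc N) := by
  have : Nonempty (Fin N) := ⟨⟨0, hN⟩⟩
  infer_instance

theorem rep (hN : 4 ≤ N) {σ : ℝ} (hσ : 0 < σ) (hσN : σ / 2 < N - 2) {ψ h : Euc N → ℝ}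
    (hψ : Continuous ψ) (hψ0 : ∀ δ > 0, ∃ R : ℝ, ∀ x, R ≤ ‖x‖ → |ψ x| ≤ δ)
    (hh : Adm (σ + 2) h) (hHL : ∀ x, x ≠ 0 → ∃ g H, HL ψ x g H ∧ ∑ i, H i = - h x) :
    ∀ x, ψ x = Kop h x := by
  have := Euc_nontrivial (N := N) (by omega)
  have hd : Dense ({0}ᶜ : Set (Euc N)) := dense_compl_singleton 0
  have hc := Kop_cont (by omega) (by linarith) hh
  have : Set.EqOn ψ (Kop h) {0}ᶜ := by
    intro x hx
    apply le_antisymm (rep_le hN hσ hσN hψ hψ0 hh hHL x hx)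
    have := rep_le hN hσ hσN (ψ := fun x => (-1) * ψ x) (h := fun x => (-1) * h x)
      (continuous_const.mul hψ) (fun δ hδ => by simpa using hψ0 δ hδ) (hh.const_mul (-1))
      (fun x hx => by
        obtain ⟨g, H, h1, h2⟩ := hHL x hx
        exact ⟨_, _, h1.const_mul (-1), by rw [← Finset.mul_sum, h2]; ring⟩) x hx
    rw [Kop_const_mul] at this
    linarith
  exact fun x => congrFun (hψ.ext_on hd hc this) x

end rep

open scoped BoundedContinuousFunction

section kk
variable {N : ℕ} {p β Λ : ℝ} {U U1 : ℝ → ℝ}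

theorem Par.N3 (h : Par N p β Λ) : 3 ≤ N := by have := h.hN; omega
theorem Par.N4 (h : Par N p β Λ) : 4 ≤ N := by have := h.hN; omega
theorem Par.ppos (h : Par N p β Λ) : 0 < p := by linarith [h.hp]

theorem Prof.Upos (P : Prof N p β Λ U U1) (x : Euc N) : 0 < U ‖x‖ := P.pos _ (norm_nonneg _)

theorem Prof.Ucont (P : Prof N p β Λ U U1) : Continuous fun x : Euc N => U ‖x‖ :=
  P.cont.comp continuous_norm

theorem Prof.Upc (P : Prof N p β Λ U U1) (t : ℝ) : Continuous fun x : Euc N => U ‖x‖ ^ t :=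
  P.Ucont.rpow_const fun x => Or.inl (P.Upos x).ne'

theorem Prof.Up_bd (P : Prof N p β Λ U U1) (h : Par N p β Λ) :
    ∃ C, 0 < C ∧ ∀ x : Euc N, U ‖x‖ ^ p ≤ C * (1 + ‖x‖) ^ (-(β + 2)) := by
  obtain ⟨c, hc, hu⟩ := P.up
  refine ⟨c ^ p, by positivity, fun x => ?_⟩
  calc U ‖x‖ ^ p ≤ (c * (1 + ‖x‖) ^ (-β)) ^ p :=
        Real.rpow_le_rpow (P.Upos x).le (hu _ (norm_nonneg _)) h.ppos.le
    _ = _ := by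
        rw [Real.mul_rpow hc.le (by positivity), ← Real.rpow_mul (by positivity), ← h.βp]
        congr 2; ring

theorem Prof.adm (P : Prof N p β Λ U U1) (h : Par N p β Λ) {f : Euc N → ℝ} (hf : Continuous f)
    {M : ℝ} (hM : ∀ x, |f x| ≤ M) : Adm (β + 2) fun y => U ‖y‖ ^ p * f y := by
  obtain ⟨C, hC, hb⟩ := P.Up_bd h
  refine ⟨(P.Upc p).mul hf, C * M, fun x => ?_⟩
  rw [abs_mul, abs_of_pos (Real.rpow_pos_of_pos (P.Upos x) _)]
  calc U ‖x‖ ^ p * |f x| ≤ (C * (1 + ‖x‖) ^ (-(β + 2))) * M :=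
        mul_le_mul (hb x) (hM x) (abs_nonneg _) (by positivity)
    _ = _ := by ring

theorem Prof.HLU (P : Prof N p β Λ U U1) {x : Euc N} (hx : x ≠ 0) :
    ∃ g H, HL (fun y : Euc N => U ‖y‖) x g H ∧ ∑ i, H i = - (U ‖x‖ ^ p) := by
  have hn := norm_pos_iff.2 hx
  refine ⟨_, _, HL_radial hx P.d1 (P.d2 _ hn), ?_⟩
  rw [sum_radial hx]
  field_simp
  ring

theorem Prof.U_decay (P : Prof N p β Λ U U1) (h : Par N p β Λ) :
    ∀ δ > 0, ∃ R : ℝ, ∀ x : Euc N, R ≤ ‖x‖ → |U ‖x‖| ≤ δ := by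
  intro δ hδ
  obtain ⟨c, hc, hu⟩ := P.up
  have ht : Tendsto (fun r : ℝ => c * (1 + r) ^ (-β)) atTop (𝓝 (c * 0)) := by
    apply Tendsto.const_mul
    exact (tendsto_rpow_neg_atTop h.βpos).comp (tendsto_atTop_add_const_left _ _ tendsto_id)
  rw [mul_zero] at ht
  obtain ⟨R, hR⟩ := eventually_atTop.1 (ht.eventually (gt_mem_nhds hδ))
  refine ⟨R, fun x hx => ?_⟩
  rw [abs_of_pos (P.Upos x)]
  exact (hu _ (norm_nonneg _)).trans (hR _ hx).le

theorem Par.bN (h : Par N p β Λ) : β / 2 < (N:ℝ) - 2 := by linarith [h.β4, h.βpos, h.N11]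

theorem Prof.KU (P : Prof N p β Λ U U1) (h : Par N p β Λ) (x : Euc N) :
    Kop (fun y => U ‖y‖ ^ p) x = U ‖x‖ := by
  have hA : Adm (N := N) (β + 2) fun y => U ‖y‖ ^ p := by
    simpa using P.adm h (f := fun _ => 1) continuous_const (M := 1) (by simp)
  exact (rep h.N4 h.βpos h.bN P.Ucont (P.U_decay h) hA (fun x hx => P.HLU hx) x).symm

theorem Prof.K_bound (P : Prof N p β Λ U U1) (h : Par N p β Λ) {f : Euc N → ℝ} (hf : Continuous f)
    {M : ℝ} (hM : ∀ x, |f x| ≤ M) (x : Euc N) : |Kop (fun y => U ‖y‖ ^ p * f y) x| ≤ M * U ‖x‖ := by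
  have hA : Adm (N := N) (β + 2) fun y => U ‖y‖ ^ p := by
    simpa using P.adm h (f := fun _ => 1) continuous_const (M := 1) (by simp)
  have := Kop_abs_le h.N3 (by linarith [h.βpos]) (P.adm h hf hM) (hA.const_mul M) (fun y => by
    rw [abs_mul, abs_of_pos (Real.rpow_pos_of_pos (P.Upos y) _), mul_comm]
    exact mul_le_mul_of_nonneg_right (hM y) (Real.rpow_nonneg (P.Upos y).le _)) x
  rwa [Kop_const_mul, P.KU h] at this

theorem Prof.KU_le (P : Prof N p β Λ U U1) (h : Par N p β Λ) {f : Euc N → ℝ} (hf : Continuous f)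
    {M : ℝ} (hM : ∀ x, |f x| ≤ M) (x : Euc N) :
    ‖(U ‖x‖)⁻¹ * Kop (fun y => U ‖y‖ ^ p * f y) x‖ ≤ M := by
  rw [Real.norm_eq_abs, abs_mul, abs_of_pos (inv_pos.2 (P.Upos x)), inv_mul_le_iff₀ (P.Upos x), mul_comm]
  exact P.K_bound h hf hM x

theorem bcf_bd (f : Euc N →ᵇ ℝ) (x : Euc N) : |f x| ≤ ‖f‖ := f.norm_coe_le_norm x

/-- the linear operator `f ↦ U⁻¹ K (U^p f)` on bounded continuous functions -/
def KK (h : Par N p β Λ) (P : Prof N p β Λ U U1) : (Euc N →ᵇ ℝ) →L[ℝ] (Euc N →ᵇ ℝ) :=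
  LinearMap.mkContinuous
    { toFun := fun f => BoundedContinuousFunction.ofNormedAddCommGroup
        (fun x => (U ‖x‖)⁻¹ * Kop (fun y => U ‖y‖ ^ p * f y) x)
        ((P.Ucont.inv₀ fun x => (P.Upos x).ne').mul
          (Kop_cont h.N3 (by linarith [h.βpos]) (P.adm h f.continuous (bcf_bd f)))) ‖f‖
        (P.KU_le h f.continuous (bcf_bd f))
      map_add' := fun f g => by
        ext x
        have := Kop_add h.N3 (by linarith [h.βpos]) (P.adm h f.continuous (bcf_bd f))
          (P.adm h g.continuous (bcf_bd g)) x
        simp only [BoundedContinuousFunction.coe_ofNormedAddCommGroup, BoundedContinuousFunction.coe_add, Pi.add_apply, mul_add, this]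
      map_smul' := fun c f => by
        ext x
        have := Kop_const_mul c (fun y => U ‖y‖ ^ p * f y) x
        simp only [BoundedContinuousFunction.coe_ofNormedAddCommGroup, BoundedContinuousFunction.coe_smul, smul_eq_mul,
          RingHom.id_apply]
        rw [show (fun y => U ‖y‖ ^ p * (c * f y)) = fun y => c * (U ‖y‖ ^ p * f y) by ext y; ring, this]
        ring } 1 (fun f => by
      rw [one_mul]
      exact BoundedContinuousFunction.norm_ofNormedAddCommGroup_le _ (norm_nonneg f)
        (P.KU_le h f.continuous (bcf_bd f)))

theorem KK_apply (h : Par N p β Λ) (P : Prof N p β Λ U U1) (f : Euc N →ᵇ ℝ) (x : Euc N) :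
    KK h P f x = (U ‖x‖)⁻¹ * Kop (fun y => U ‖y‖ ^ p * f y) x := rfl

theorem KK_le (h : Par N p β Λ) (P : Prof N p β Λ U U1) (f : Euc N →ᵇ ℝ) : ‖KK h P f‖ ≤ ‖f‖ := by
  have : ‖KK h P‖ ≤ 1 := LinearMap.mkContinuous_norm_le _ zero_le_one _
  simpa using (KK h P).le_of_opNorm_le this f

/-- composition with an isometry -/
def pb (L : Euc N ≃ₗᵢ[ℝ] Euc N) (f : Euc N →ᵇ ℝ) : Euc N →ᵇ ℝ :=
  f.compContinuous ⟨L, L.continuous⟩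

@[simp] theorem pb_apply (L : Euc N ≃ₗᵢ[ℝ] Euc N) (f : Euc N →ᵇ ℝ) (x : Euc N) : pb L f x = f (L x) := rfl

theorem KK_pb (h : Par N p β Λ) (P : Prof N p β Λ U U1) (L : Euc N ≃ₗᵢ[ℝ] Euc N) (f : Euc N →ᵇ ℝ) :
    KK h P (pb L f) = pb L (KK h P f) := by
  ext x
  rw [KK_apply, pb_apply, KK_apply, ← Kop_isom]
  simp

/-- the linearised operator -/
def TT (h : Par N p β Λ) (P : Prof N p β Λ U U1) : (Euc N →ᵇ ℝ) →L[ℝ] (Euc N →ᵇ ℝ) := p • KK h P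

theorem TT_apply (h : Par N p β Λ) (P : Prof N p β Λ U U1) (f : Euc N →ᵇ ℝ) (x : Euc N) :
    TT h P f x = (U ‖x‖)⁻¹ * Kop (fun y => p * U ‖y‖ ^ p * f y) x := by
  have : TT h P f x = p * KK h P f x := rfl
  rw [this, KK_apply, show (fun y => p * U ‖y‖ ^ p * f y) = fun y => p * (U ‖y‖ ^ p * f y) by ext y; ring,
    Kop_const_mul]; ring

theorem TT_pb (h : Par N p β Λ) (P : Prof N p β Λ U U1) (L : Euc N ≃ₗᵢ[ℝ] Euc N) (f : Euc N →ᵇ ℝ) :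
    TT h P (pb L f) = pb L (TT h P f) := by
  have e : ∀ g, TT h P g = p • KK h P g := fun _ => rfl
  rw [e, e, KK_pb]; rfl

/-- reflection -/
abbrev Rf (a : Euc N) : Euc N ≃ₗᵢ[ℝ] Euc N := (ℝ ∙ a)ᗮ.reflection

theorem Rf_apply (a x : Euc N) : Rf a x = x - (2 * (⟪a, x⟫_ℝ / ‖a‖ ^ 2)) • a := by
  unfold Rf
  rw [Submodule.reflection_orthogonal_apply, Submodule.reflection_singleton_apply]
  simp [two_mul, add_smul, two_smul]

theorem Rf_inner_self (a x : Euc N) : ⟪Rf a x, a⟫_ℝ = - ⟪x, a⟫_ℝ := by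
  rcases eq_or_ne a 0 with rfl | ha
  · simp
  have hn : ‖a‖ ≠ 0 := norm_ne_zero_iff.2 ha
  rw [Rf_apply, inner_sub_left, inner_smul_left, real_inner_self_eq_norm_sq, real_inner_comm a x]
  simp; field_simp; ring

theorem Rf_inner_orth {a b : Euc N} (hab : ⟪a, b⟫_ℝ = 0) (x : Euc N) : ⟪Rf a x, b⟫_ℝ = ⟪x, b⟫_ℝ := by
  rw [Rf_apply, inner_sub_left, inner_smul_left, hab]; simp

theorem Rf_fix {a x : Euc N} (h : ⟪x, a⟫_ℝ = 0) : Rf a x = x := by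
  rw [Rf_apply, real_inner_comm, h]; simp

theorem Rf_invol (a x : Euc N) : Rf a (Rf a x) = x := Submodule.reflection_reflection _ x

theorem Rf_comm {a b : Euc N} (hab : ⟪a, b⟫_ℝ = 0) (x : Euc N) : Rf a (Rf b x) = Rf b (Rf a x) := by
  have hba : ⟪b, a⟫_ℝ = 0 := by rw [real_inner_comm]; exact hab
  simp only [Rf_apply, inner_sub_right, inner_smul_right, hab, hba]
  simp only [mul_zero, sub_zero]
  abel

end kk

section oddodd
variable {N : ℕ} {p β Λ : ℝ} {U U1 : ℝ → ℝ}

theorem TF.isom {φ : Euc N → ℝ} (h : TF φ) (L : Euc N ≃ₗᵢ[ℝ] Euc N) : TF fun x => φ (L x) :=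
  ⟨h.sm.comp L.contDiff, h.cs.comp_homeomorph L.toHomeomorph⟩

theorem TF.const_mul {φ : Euc N → ℝ} (h : TF φ) (c : ℝ) : TF fun x => c * φ x :=
  ⟨contDiff_const.mul h.sm, h.cs.mul_left⟩

/-- quarter space -/
def QQ (a b : Euc N) : Set (Euc N) := {x | 0 < ⟪x, a⟫_ℝ ∧ 0 < ⟪x, b⟫_ℝ}

theorem QQ_open (a b : Euc N) : IsOpen (QQ a b) := by
  have cA : Continuous fun y : Euc N => ⟪y, a⟫_ℝ := by fun_prop
  have cB : Continuous fun y : Euc N => ⟪y, b⟫_ℝ := by fun_prop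
  exact (isOpen_lt continuous_const cA).inter (isOpen_lt continuous_const cB)

/-- odd-odd part -/
def oo (a b : Euc N) (f : Euc N → ℝ) (x : Euc N) : ℝ :=
  f x - f (Rf a x) - f (Rf b x) + f (Rf a (Rf b x))

theorem oo_odd_a {a b : Euc N} (hab : ⟪a, b⟫_ℝ = 0) (f : Euc N → ℝ) (x : Euc N) :
    oo a b f (Rf a x) = - oo a b f x := by
  unfold oo
  rw [Rf_invol, ← Rf_comm hab x, Rf_invol]; ring

theorem oo_odd_b {a b : Euc N} (hab : ⟪a, b⟫_ℝ = 0) (f : Euc N → ℝ) (x : Euc N) :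
    oo a b f (Rf b x) = - oo a b f x := by
  unfold oo
  rw [Rf_invol]; ring

theorem approx_odd {σ C : ℝ} (hσ : 0 < σ) {h : Euc N → ℝ} (hc : Continuous h)
    (hb : ∀ x, |h x| ≤ C * (1 + ‖x‖) ^ (-(σ + 2))) {a b : Euc N} (hab : ⟪a, b⟫_ℝ = 0)
    (ha1 : ∀ x, h (Rf a x) = - h x) (hb1 : ∀ x, h (Rf b x) = - h x) {ε : ℝ} (hε : 0 < ε) :
    ∃ h', TF h' ∧ (∀ x, |h x - h' x| ≤ ε * (1 + ‖x‖) ^ (-(σ / 2 + 2))) ∧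
      (∀ x, h' (Rf a x) = - h' x) ∧ (∀ x, h' (Rf b x) = - h' x) := by
  obtain ⟨g, hg, hap⟩ := approx_TF hσ hc hb hε
  refine ⟨fun x => 4⁻¹ * oo a b g x, ?_, fun x => ?_, fun x => ?_,
    fun x => ?_⟩
  · have := (((hg.add ((hg.isom (Rf a)).const_mul (-1))).add ((hg.isom (Rf b)).const_mul (-1))).add
      (hg.isom ((Rf b).trans (Rf a)))).const_mul 4⁻¹
    convert this using 2
    unfold oo
    simp only [LinearIsometryEquiv.trans_apply]
    ring
  · have e : h x - 4⁻¹ * oo a b g x = 4⁻¹ * ((h x - g x) - (h (Rf a x) - g (Rf a x))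
        - (h (Rf b x) - g (Rf b x)) + (h (Rf a (Rf b x)) - g (Rf a (Rf b x)))) := by
      unfold oo
      rw [ha1, hb1, ha1, hb1]; ring
    rw [e, abs_mul, abs_of_pos (by norm_num : (0:ℝ) < 4⁻¹)]
    have h1 := hap x
    have h2 := hap (Rf a x)
    have h3 := hap (Rf b x)
    have h4 := hap (Rf a (Rf b x))
    simp only [LinearIsometryEquiv.norm_map] at h2 h3 h4
    rw [abs_le] at h1 h2 h3 h4
    have : |(h x - g x) - (h (Rf a x) - g (Rf a x))
        - (h (Rf b x) - g (Rf b x)) + (h (Rf a (Rf b x)) - g (Rf a (Rf b x)))| ≤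
        4 * (ε * (1 + ‖x‖) ^ (-(σ / 2 + 2))) := by
      rw [abs_le]; constructor <;> linarith
    linarith
  · show 4⁻¹ * oo a b g (Rf a x) = -(4⁻¹ * oo a b g x)
    rw [oo_odd_a hab]; ring
  · show 4⁻¹ * oo a b g (Rf b x) = -(4⁻¹ * oo a b g x)
    rw [oo_odd_b hab]; ring

theorem odd_compare (hN : 4 ≤ N) {σ : ℝ} (hσ : 0 < σ) (hσN : σ / 2 < N - 2) {a b : Euc N}
    (hab : ⟪a, b⟫_ℝ = 0) {g : Euc N → ℝ} (hg : Adm (σ + 2) g)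
    (ha1 : ∀ x, g (Rf a x) = - g x) (hb1 : ∀ x, g (Rf b x) = - g x)
    {B : Euc N → ℝ} (hBc : ContinuousOn B (QQ a b)) (hB0 : ∀ x ∈ QQ a b, 0 ≤ B x)
    (hBl : ∀ x ∈ QQ a b, ∃ G H, HL B x G H ∧ |g x| ≤ -∑ i, H i) (x : Euc N) (hx : x ∈ QQ a b) :
    Kop g x ≤ B x := by
  obtain ⟨C, hC⟩ := hg.bd
  obtain ⟨A, hAc, hA0, ⟨M, hAM⟩, hAd, hAl⟩ := exists_bar (N := N) hσ hσN
  have hN3 : 3 ≤ N := by omega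
  have hτ : 2 < σ / 2 + 2 := by linarith
  set P := Kop (fun x : Euc N => (1 + ‖x‖) ^ (-(σ / 2 + 2))) x
  have key : ∀ ε > 0, Kop g x ≤ B x + ε * (P + 2 * M) := by
    intro ε hε
    obtain ⟨h', hTF, hap, hoa, hob⟩ := approx_odd hσ hg.cont hC hab ha1 hb1 hε
    have hclose : Kop g x ≤ Kop h' x + ε * P := by
      have := Kop_mono hN3 hτ (hg.mono (by linarith)) ((hTF.adm _).add ((Adm.pow (σ / 2 + 2)).const_mul ε))
        (fun y => by have := (abs_le.1 (hap y)).2; linarith) x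
      rw [Kop_add hN3 hτ (hTF.adm _) ((Adm.pow (σ / 2 + 2)).const_mul ε), Kop_const_mul] at this
      exact this
    have hKc := Kop_cont hN3 hτ (hTF.adm (σ / 2 + 2))
    have hz : ∀ c : Euc N, (∀ x, h' (Rf c x) = - h' x) → ∀ y, ⟪y, c⟫_ℝ = 0 → Kop h' y = 0 := by
      intro c hc y hy
      have h1 := Kop_isom (Rf c) h' y
      rw [Rf_fix hy] at h1
      simp only [hc] at h1
      have h2 := Kop_const_mul (-1) h' y
      simp only [neg_one_mul] at h2
      linarith
    have hmax := max_principle (Ω := QQ a b) (W := fun y => Kop h' y - B y - 2 * ε * A y)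
      (QQ_open a b) ((hKc.continuousOn.sub hBc).sub
        (continuous_const.mul hAc).continuousOn) ?_ ?_ x hx
    · have := mul_le_mul_of_nonneg_left (hAM x) (by positivity : 0 ≤ 2 * ε)
      linarith
    · intro δ hδ
      obtain ⟨R, hR⟩ := Kop_decay hN3 hTF (δ / 2) (by positivity)
      have cA : Continuous fun y : Euc N => ⟪y, a⟫_ℝ := by fun_prop
      have cB : Continuous fun y : Euc N => ⟪y, b⟫_ℝ := by fun_prop
      refine ⟨Metric.closedBall 0 R ∩ ({y | δ ≤ Kop h' y} ∩ ({y | 0 ≤ ⟪y, a⟫_ℝ} ∩ {y | 0 ≤ ⟪y, b⟫_ℝ})), ?_, ?_, ?_⟩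
      · rintro y ⟨-, h1, h2, h3⟩
        simp only [Set.mem_ofPred_eq] at h1 h2 h3
        constructor
        · refine lt_of_le_of_ne h2 fun h0 => ?_
          rw [hz a hoa y h0.symm] at h1; linarith
        · refine lt_of_le_of_ne h3 fun h0 => ?_
          rw [hz b hob y h0.symm] at h1; linarith
      · exact (isCompact_closedBall _ _).inter_right ((isClosed_le continuous_const hKc).inter
          ((isClosed_le continuous_const cA).inter (isClosed_le continuous_const cB)))
      · intro y hy hyW
        have e1 := hB0 y hy
        have e2 : 0 ≤ 2 * ε * A y := mul_nonneg (by positivity) (hA0 y)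
        have e3 : δ ≤ Kop h' y := by linarith
        refine ⟨?_, e3, hy.1.le, hy.2.le⟩
        rw [mem_closedBall_zero_iff]
        by_contra hcon
        push Not at hcon
        have := (abs_le.1 (hR y hcon.le)).2
        linarith
    · intro y hy
      obtain ⟨g1, H1, a1, b1⟩ := hBl y hy
      obtain ⟨g2, H2, a2, b2⟩ := Kop_HL hN3 hTF y
      obtain ⟨g3, H3, a3, b3⟩ := hAl y
      refine ⟨_, _, (a2.sub a1).sub (a3.const_mul (2 * ε)), ?_⟩
      simp only [Finset.sum_sub_distrib, ← Finset.mul_sum, b2]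
      have h5 := (abs_le.1 (hap y)).1
      have h6 := (le_abs_self _).trans b1
      have h7 : 0 < ε * (1 + ‖y‖) ^ (-(σ / 2 + 2)) := by positivity
      have h8 := mul_le_mul_of_nonneg_left b3 (by positivity : 0 ≤ 2 * ε)
      linarith
  have h2 : Tendsto (fun ε : ℝ => B x + ε * (P + 2 * M)) (𝓝[>] 0) (𝓝 (B x + 0 * (P + 2 * M))) :=
    ((continuous_const.add (continuous_id.mul continuous_const)).tendsto 0).mono_left nhdsWithin_le_nhds
  rw [zero_mul, add_zero] at h2
  exact ge_of_tendsto h2 (by filter_upwards [self_mem_nhdsWithin] with ε hε using key ε hε)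

theorem odd_compare_abs (hN : 4 ≤ N) {σ : ℝ} (hσ : 0 < σ) (hσN : σ / 2 < N - 2) {a b : Euc N}
    (hab : ⟪a, b⟫_ℝ = 0) {g : Euc N → ℝ} (hg : Adm (σ + 2) g)
    (ha1 : ∀ x, g (Rf a x) = - g x) (hb1 : ∀ x, g (Rf b x) = - g x)
    {B : Euc N → ℝ} (hBc : ContinuousOn B (QQ a b)) (hB0 : ∀ x ∈ QQ a b, 0 ≤ B x)
    (hBl : ∀ x ∈ QQ a b, ∃ G H, HL B x G H ∧ |g x| ≤ -∑ i, H i) (x : Euc N) (hx : x ∈ QQ a b) :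
    |Kop g x| ≤ B x := by
  rw [abs_le]
  constructor
  · have := odd_compare hN hσ hσN hab (hg.const_mul (-1)) (fun x => by rw [ha1]; ring)
      (fun x => by rw [hb1]; ring) hBc hB0 (fun x hx => by simpa using hBl x hx) x hx
    rw [Kop_const_mul] at this; linarith
  · exact odd_compare hN hσ hσN hab hg ha1 hb1 hBc hB0 hBl x hx

/-- angular barrier -/
def bs (a b : Euc N) (s : ℝ) (x : Euc N) : ℝ := ‖x‖ ^ (-(2 * s)) * (⟪x, a⟫_ℝ ^ s * ⟪x, b⟫_ℝ ^ s)

theorem HL_inner_rpow (a x : Euc N) (s : ℝ) (hX : 0 < ⟪x, a⟫_ℝ) :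
    HL (fun y => ⟪y, a⟫_ℝ ^ s) x (fun i => s * ⟪x, a⟫_ℝ ^ (s - 1) * a i)
      (fun i => s * ((s - 1) * ⟪x, a⟫_ℝ ^ (s - 2)) * a i ^ 2) := by
  have h1 : ∀ t (y : ℝ), 0 < y → HasDerivAt (fun y : ℝ => y ^ t) (t * y ^ (t - 1)) y :=
    fun t y hy => Real.hasDerivAt_rpow_const (Or.inl hy.ne')
  refine ((HL_inner a x).comp (φ := fun y => y ^ s) rfl
    (by filter_upwards [lt_mem_nhds hX] with y hy using h1 s y hy)
    ((h1 (s - 1) _ hX).const_mul s)).congr (fun i => rfl) (fun i => ?_)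
  rw [show s - 1 - 1 = s - 2 by ring]; ring

theorem sum_mul_inner (x a : Euc N) : ∑ i, x i * a i = ⟪x, a⟫_ℝ := by
  rw [real_inner_comm]
  simp [PiLp.inner_apply]

theorem HL_bs (P : Prof N p β Λ U U1) {a b : Euc N} (ha : ‖a‖ = 1) (hb : ‖b‖ = 1)
    (hab : ⟪a, b⟫_ℝ = 0) (s : ℝ) {x : Euc N} (hx : x ∈ QQ a b) :
    ∃ G H, HL (fun y => U ‖y‖ * bs a b s y) x G H ∧ -∑ i, H i = U ‖x‖ * bs a b s x *
      (U ‖x‖ ^ (p - 1) + 2 * s * (N - 2 + 2 * s) / ‖x‖ ^ 2 +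
        s * (1 - s) * (1 / ⟪x, a⟫_ℝ ^ 2 + 1 / ⟪x, b⟫_ℝ ^ 2)) := by
  obtain ⟨hX, hY⟩ := hx
  have hx0 : x ≠ 0 := by rintro rfl; simp at hX
  have hr : 0 < ‖x‖ := norm_pos_iff.2 hx0
  set r := ‖x‖ with hrd
  set X := ⟪x, a⟫_ℝ with hXd
  set Y := ⟪x, b⟫_ℝ with hYd
  have dpow : ∀ R : ℝ, 0 < R → HasDerivAt (fun R : ℝ => R ^ (-(2 * s))) (-(2 * s) * (R ^ (-(2 * s)) / R)) R := by
    intro R hR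
    have := Real.hasDerivAt_rpow_const (x := R) (p := -(2 * s)) (Or.inl hR.ne')
    rwa [Real.rpow_sub_one hR.ne'] at this
  have dV : ∀ R : ℝ, 0 < R → HasDerivAt (fun R => U R * R ^ (-(2 * s)))
      (R ^ (-(2 * s)) * (U1 R - 2 * s * (U R / R))) R := by
    intro R hR
    refine ((P.d1 R hR).mul (dpow R hR)).congr_deriv ?_
    ring
  have dV1 := (dpow r hr).mul ((P.d2 r hr).sub (((P.d1 r hr).div (hasDerivAt_id r) hr.ne').const_mul (2 * s)))
  have hA := HL_radial hx0 dV dV1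
  have hB := HL_inner_rpow a x s hX
  have hC := HL_inner_rpow b x s hY
  refine ⟨_, _, (hA.mul (hB.mul hC)).congr_fun (Eventually.of_forall fun y => ?_), ?_⟩
  · simp only [bs]; ring
  have s1 : ∑ i, a i ^ 2 = 1 := by rw [sum_sq_eq, ha]; norm_num
  have s2 : ∑ i, b i ^ 2 = 1 := by rw [sum_sq_eq, hb]; norm_num
  have s3 : ∑ i, a i * b i = 0 := by rw [sum_mul_inner, hab]
  have s4 : ∑ i, x i * a i = X := sum_mul_inner x a
  have s5 : ∑ i, x i * b i = Y := sum_mul_inner x b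
  have s6 := sum_radial hx0 (-(2 * s) * (r ^ (-(2 * s)) / r) * (U1 r - 2 * s * (U r / r)) +
    r ^ (-(2 * s)) * (-(N - 1) / r * U1 r - U r ^ p - 2 * s * ((U1 r * r - U r * 1) / r ^ 2)))
    (r ^ (-(2 * s)) * (U1 r - 2 * s * (U r / r)))
  have e1 : X ^ (s - 1) = X ^ s / X := Real.rpow_sub_one hX.ne' s
  have e2 : X ^ (s - 2) = X ^ s / X ^ 2 := by
    rw [Real.rpow_sub hX]; norm_cast
  have e3 : Y ^ (s - 1) = Y ^ s / Y := Real.rpow_sub_one hY.ne' s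
  have e4 : Y ^ (s - 2) = Y ^ s / Y ^ 2 := by
    rw [Real.rpow_sub hY]; norm_cast
  have e5 : U r ^ p = U r ^ (p - 1) * U r := by
    rw [← Real.rpow_add_one (P.pos r hr.le).ne']; congr 1; ring
  simp only [id_eq, ← hrd, ← hXd, ← hYd, Pi.mul_apply, Pi.div_apply, Pi.sub_apply]
  rw [← hrd] at s6
  set V1 := r ^ (-(2 * s)) * (U1 r - 2 * s * (U r / r)) with hV1
  set V2 := -(2 * s) * (r ^ (-(2 * s)) / r) * (U1 r - 2 * s * (U r / r)) +
    r ^ (-(2 * s)) * (-(N - 1) / r * U1 r - U r ^ p - 2 * s * ((U1 r * r - U r * 1) / r ^ 2)) with hV2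
  have hsum : ∀ i, (V2 * (x i / r) ^ 2 + V1 * (1 / r - x i ^ 2 / r ^ 3)) * (X ^ s * Y ^ s) +
      2 * (V1 * (x i / r) * (s * X ^ (s - 1) * a i * Y ^ s + X ^ s * (s * Y ^ (s - 1) * b i))) +
      U r * r ^ (-(2 * s)) * (s * ((s - 1) * X ^ (s - 2)) * a i ^ 2 * Y ^ s +
        2 * (s * X ^ (s - 1) * a i * (s * Y ^ (s - 1) * b i)) +
        X ^ s * (s * ((s - 1) * Y ^ (s - 2)) * b i ^ 2)) =
      (X ^ s * Y ^ s) * (V2 * (x i / r) ^ 2 + V1 * (1 / r - x i ^ 2 / r ^ 3)) +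
      (2 * (V1 / r) * s * X ^ (s - 1) * Y ^ s) * (x i * a i) +
      (2 * (V1 / r) * s * Y ^ (s - 1) * X ^ s) * (x i * b i) +
      (U r * r ^ (-(2 * s)) * s * ((s - 1) * X ^ (s - 2)) * Y ^ s) * a i ^ 2 +
      (U r * r ^ (-(2 * s)) * 2 * s * X ^ (s - 1) * s * Y ^ (s - 1)) * (a i * b i) +
      (U r * r ^ (-(2 * s)) * X ^ s * (s * ((s - 1) * Y ^ (s - 2)))) * b i ^ 2 := by
    intro i; ring
  rw [Finset.sum_congr rfl fun i _ => hsum i]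
  simp only [Finset.sum_add_distrib, ← Finset.mul_sum, s1, s2, s3, s4, s5, s6]
  unfold bs
  rw [← hrd, ← hXd, ← hYd, e1, e2, e3, e4, hV1, hV2, e5]
  field_simp
  ring

end oddodd

section oddodd2
variable {N : ℕ} {p β Λ : ℝ} {U U1 : ℝ → ℝ}

theorem bessel2 {a b : Euc N} (ha : ‖a‖ = 1) (hb : ‖b‖ = 1) (hab : ⟪a, b⟫_ℝ = 0) (x : Euc N) :
    ⟪x, a⟫_ℝ ^ 2 + ⟪x, b⟫_ℝ ^ 2 ≤ ‖x‖ ^ 2 := by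
  have h0 : 0 ≤ ‖x - ⟪x, a⟫_ℝ • a - ⟪x, b⟫_ℝ • b‖ ^ 2 := by positivity
  have hba : ⟪b, a⟫_ℝ = 0 := by rw [real_inner_comm]; exact hab
  rw [← real_inner_self_eq_norm_sq] at h0
  simp only [inner_sub_left, inner_sub_right, inner_smul_left, inner_smul_right,
    real_inner_self_eq_norm_sq, ha, hb, hab, hba, real_inner_comm x a, real_inner_comm x b] at h0
  simp only [conj_trivial] at h0
  nlinarith

theorem bs_facts {a b : Euc N} (ha : ‖a‖ = 1) (hb : ‖b‖ = 1) (hab : ⟪a, b⟫_ℝ = 0) {s : ℝ}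
    (hs0 : 0 < s) (hs1 : s < 1) {x : Euc N} (hx : x ∈ QQ a b) :
    0 < ‖x‖ ∧ 0 < bs a b s x ∧ bs a b s x ≤ 1 ∧
      ⟪x, a⟫_ℝ * ⟪x, b⟫_ℝ / ‖x‖ ^ 2 ≤ bs a b s x := by
  obtain ⟨hX, hY⟩ := hx
  have hx0 : x ≠ 0 := by rintro rfl; simp at hX
  have hr : 0 < ‖x‖ := norm_pos_iff.2 hx0
  have hB := bessel2 ha hb hab x
  have e : bs a b s x = (⟪x, a⟫_ℝ * ⟪x, b⟫_ℝ / ‖x‖ ^ 2) ^ s := by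
    unfold bs
    rw [Real.div_rpow (by positivity) (by positivity), Real.mul_rpow hX.le hY.le, Real.rpow_neg hr.le,
      Real.rpow_mul hr.le]
    norm_num
    ring
  have ht0 : 0 < ⟪x, a⟫_ℝ * ⟪x, b⟫_ℝ / ‖x‖ ^ 2 := by positivity
  have ht1 : ⟪x, a⟫_ℝ * ⟪x, b⟫_ℝ / ‖x‖ ^ 2 ≤ 1 := by
    rw [div_le_one (by positivity)]
    nlinarith [sq_nonneg (⟪x, a⟫_ℝ - ⟪x, b⟫_ℝ)]
  rw [e]
  refine ⟨hr, Real.rpow_pos_of_pos ht0 _, Real.rpow_le_one ht0.le ht1 hs0.le, ?_⟩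
  simpa using Real.rpow_le_rpow_of_exponent_ge ht0 ht1 hs1.le

theorem inv_sq_facts {a b : Euc N} (ha : ‖a‖ = 1) (hb : ‖b‖ = 1) (hab : ⟪a, b⟫_ℝ = 0)
    {x : Euc N} (hx : x ∈ QQ a b) :
    4 / ‖x‖ ^ 2 ≤ 1 / ⟪x, a⟫_ℝ ^ 2 + 1 / ⟪x, b⟫_ℝ ^ 2 ∧
    2 / (⟪x, a⟫_ℝ * ⟪x, b⟫_ℝ) ≤ 1 / ⟪x, a⟫_ℝ ^ 2 + 1 / ⟪x, b⟫_ℝ ^ 2 := by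
  obtain ⟨hX, hY⟩ := hx
  have hx0 : x ≠ 0 := by rintro rfl; simp at hX
  have hr : 0 < ‖x‖ := norm_pos_iff.2 hx0
  have hB := bessel2 ha hb hab x
  set X := ⟪x, a⟫_ℝ
  set Y := ⟪x, b⟫_ℝ
  have h2 : 2 / (X * Y) ≤ 1 / X ^ 2 + 1 / Y ^ 2 := by
    have : 1 / X ^ 2 + 1 / Y ^ 2 - 2 / (X * Y) = (1 / X - 1 / Y) ^ 2 := by field_simp; ring
    nlinarith [sq_nonneg (1 / X - 1 / Y)]
  refine ⟨le_trans ?_ h2, h2⟩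
  rw [div_le_div_iff₀ (by positivity) (by positivity)]
  nlinarith [sq_nonneg (X - Y)]

theorem odd_TT (h : Par N p β Λ) (P : Prof N p β Λ U U1) {a b : Euc N} (ha : ‖a‖ = 1) (hb : ‖b‖ = 1)
    (hab : ⟪a, b⟫_ℝ = 0) {s : ℝ} (hs0 : 0 < s) (hs1 : s < 1) {f : Euc N →ᵇ ℝ}
    (fa : ∀ x, f (Rf a x) = - f x) (fb : ∀ x, f (Rf b x) = - f x) {A : ℝ} (hA : 0 ≤ A)
    (hf : ∀ x ∈ QQ a b, p * U ‖x‖ ^ (p - 1) * |f x| ≤ A * (bs a b s x *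
      (U ‖x‖ ^ (p - 1) + 2 * s * (N - 2 + 2 * s) / ‖x‖ ^ 2 +
        s * (1 - s) * (1 / ⟪x, a⟫_ℝ ^ 2 + 1 / ⟪x, b⟫_ℝ ^ 2)))) (x : Euc N) (hx : x ∈ QQ a b) :
    |TT h P f x| ≤ A * bs a b s x := by
  have hAdm : Adm (β + 2) fun y => p * U ‖y‖ ^ p * f y := by
    simpa [mul_assoc] using (P.adm h f.continuous (bcf_bd f)).const_mul p
  rw [TT_apply, abs_mul, abs_of_pos (inv_pos.2 (P.Upos x)), inv_mul_le_iff₀ (P.Upos x)]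
  have hcont : ContinuousOn (fun y => A * (U ‖y‖ * bs a b s y)) (QQ a b) := by
    refine continuousOn_const.mul (P.Ucont.continuousOn.mul ?_)
    intro y hy
    have hy0 := (bs_facts ha hb hab hs0 hs1 hy).1
    apply ContinuousAt.continuousWithinAt
    unfold bs
    have c1 : ContinuousAt (fun y : Euc N => ⟪y, a⟫_ℝ) y := by fun_prop
    have c2 : ContinuousAt (fun y : Euc N => ⟪y, b⟫_ℝ) y := by fun_prop
    exact ((continuous_norm.continuousAt).rpow_const (Or.inl hy0.ne')).mul
      ((c1.rpow_const (Or.inl hy.1.ne')).mul (c2.rpow_const (Or.inl hy.2.ne')))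
  have := odd_compare_abs h.N4 h.βpos h.bN hab hAdm
    (fun y => by simp only [fa, LinearIsometryEquiv.norm_map]; ring)
    (fun y => by simp only [fb, LinearIsometryEquiv.norm_map]; ring)
    (B := fun y => A * (U ‖y‖ * bs a b s y)) hcont
    (fun y hy => mul_nonneg hA (mul_nonneg (P.Upos y).le (bs_facts ha hb hab hs0 hs1 hy).2.1.le))
    (fun y hy => by
      obtain ⟨G, H, h1, h2⟩ := HL_bs P ha hb hab s hy
      refine ⟨_, _, h1.const_mul A, ?_⟩
      rw [← Finset.mul_sum, ← mul_neg, h2, abs_mul, abs_of_pos (mul_pos h.ppos (Real.rpow_pos_of_pos (P.Upos y) _))]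
      have e5 : U ‖y‖ ^ p = U ‖y‖ ^ (p - 1) * U ‖y‖ := by
        rw [← Real.rpow_add_one (P.Upos y).ne']; congr 1; ring
      rw [e5]
      have := mul_le_mul_of_nonneg_left (hf y hy) (P.Upos y).le
      linarith) x hx
  linarith

/-- constants -/
theorem odd_consts (h : Par N p β Λ) : ∃ s θ C : ℝ, 0 < s ∧ s < 1 ∧ 0 ≤ θ ∧ θ < 1 ∧ 0 < C ∧
    C * (2 * (s * (1 - s))) = p * Λ ∧ (∀ w, 0 ≤ w → w ≤ Λ → p * w ≤ θ * (w + 2 * s * N)) := by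
  have hN := h.N11
  have hΛ := h.Λpos
  have hb := h.βpos
  have h4 := h.β4
  have hs0 : 0 < 1 - (1 + β) / N := by
    rw [sub_pos, div_lt_one (by linarith)]; linarith
  have hs1 : 1 - (1 + β) / N < 1 := by
    have : 0 < (1 + β) / N := by apply div_pos <;> linarith
    linarith
  have hsN : (1 - (1 + β) / N) * N = N - 1 - β := by field_simp; ring
  set s := 1 - (1 + β) / N
  have hpos : 0 < Λ + 2 * s * N := by nlinarith
  have hp := h.ppos
  refine ⟨s, p * Λ / (Λ + 2 * s * N), p * Λ / (2 * (s * (1 - s))), hs0, hs1, by positivity, ?_, ?_, ?_, ?_⟩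
  · rw [div_lt_one hpos]; nlinarith [h.pΛ]
  · apply div_pos (by positivity); nlinarith
  · apply div_mul_cancel₀; have : 0 < s * (1 - s) := by nlinarith
    positivity
  · intro w hw0 hw
    rw [div_mul_eq_mul_div, le_div_iff₀ hpos]
    have : 0 < s * N := by nlinarith
    nlinarith [mul_nonneg (mul_nonneg hp.le this.le) (sub_nonneg.2 hw)]

theorem TT_odd (h : Par N p β Λ) (P : Prof N p β Λ U U1) {a : Euc N} {f : Euc N →ᵇ ℝ}
    (fa : ∀ x, f (Rf a x) = - f x) (x : Euc N) : TT h P f (Rf a x) = - TT h P f x := by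
  have h1 : pb (Rf a) f = -f := by ext y; simp [fa]
  have h2 := TT_pb h P (Rf a) f
  rw [h1, map_neg] at h2
  have := congrArg (fun g : Euc N →ᵇ ℝ => g x) h2
  simpa using this.symm

theorem TT_iter_odd (h : Par N p β Λ) (P : Prof N p β Λ U U1) {a : Euc N} {f : Euc N →ᵇ ℝ}
    (fa : ∀ x, f (Rf a x) = - f x) (n : ℕ) (x : Euc N) :
    ((TT h P)^[n] f) (Rf a x) = - ((TT h P)^[n] f) x := by
  induction n generalizing x with
  | zero => exact fa x
  | succ n ih => rw [Function.iterate_succ_apply']; exact TT_odd h P ih x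

theorem odd_everywhere {a b : Euc N} (hab : ⟪a, b⟫_ℝ = 0) {f : Euc N → ℝ} {M : ℝ} (hM : 0 ≤ M)
    (fa : ∀ x, f (Rf a x) = - f x) (fb : ∀ x, f (Rf b x) = - f x)
    (hQ : ∀ x ∈ QQ a b, |f x| ≤ M) (x : Euc N) : |f x| ≤ M := by
  have hba : ⟪b, a⟫_ℝ = 0 := by rw [real_inner_comm]; exact hab
  have z : ∀ c, (∀ x, f (Rf c x) = - f x) → ∀ x, ⟪x, c⟫_ℝ = 0 → |f x| ≤ M := by
    intro c hc x hx
    have := hc x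
    rw [Rf_fix hx] at this
    rw [show f x = 0 by linarith]; simpa using hM
  have h1 : ∀ x, 0 < ⟪x, a⟫_ℝ → |f x| ≤ M := by
    intro x hx
    rcases lt_trichotomy ⟪x, b⟫_ℝ 0 with hb | hb | hb
    · have := hQ (Rf b x) ⟨by rw [Rf_inner_orth hba]; exact hx, by rw [Rf_inner_self]; linarith⟩
      rwa [fb, abs_neg] at this
    · exact z b fb x hb
    · exact hQ x ⟨hx, hb⟩
  rcases lt_trichotomy ⟪x, a⟫_ℝ 0 with hb | hb | hb
  · have := h1 (Rf a x) (by rw [Rf_inner_self]; linarith)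
    rwa [fa, abs_neg] at this
  · exact z a fa x hb
  · exact h1 x hb

theorem odd_decay (h : Par N p β Λ) (P : Prof N p β Λ U U1) : ∃ θ C : ℝ, 0 ≤ θ ∧ θ < 1 ∧ 0 < C ∧
    ∀ a b : Euc N, ‖a‖ = 1 → ‖b‖ = 1 → ⟪a, b⟫_ℝ = 0 → ∀ f : Euc N →ᵇ ℝ, (∀ x, f (Rf a x) = - f x) →
      (∀ x, f (Rf b x) = - f x) → ∀ n x, |((TT h P)^[n + 1] f) x| ≤ C * θ ^ n * ‖f‖ := by
  obtain ⟨s, θ, C, hs0, hs1, hθ0, hθ1, hC0, hC, hw⟩ := odd_consts h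
  refine ⟨θ, C, hθ0, hθ1, hC0, fun a b ha hb hab f fa fb n => ?_⟩
  have hss : 0 < s * (1 - s) := by nlinarith
  have key : ∀ x ∈ QQ a b, |((TT h P)^[n + 1] f) x| ≤ C * θ ^ n * ‖f‖ * bs a b s x := by
    induction n with
    | zero =>
      intro x hx
      refine odd_TT h P ha hb hab hs0 hs1 fa fb (by positivity) (fun y hy => ?_) x hx
      obtain ⟨hr, b0, b1, b2⟩ := bs_facts ha hb hab hs0 hs1 hy
      obtain ⟨i1, i2⟩ := inv_sq_facts ha hb hab hy
      have hU := Real.rpow_pos_of_pos (P.Upos y) (p - 1)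
      have hwle := P.wle ‖y‖ hr.le
      have hN := h.N11
      have hf := bcf_bd f y
      have hup : U ‖y‖ ^ (p - 1) ≤ Λ / ‖y‖ ^ 2 := by
        rw [le_div_iff₀ (by positivity)]; linarith
      have hX := hy.1
      have hY := hy.2
      have j : 2 / ‖y‖ ^ 2 ≤ bs a b s y * (1 / ⟪y, a⟫_ℝ ^ 2 + 1 / ⟪y, b⟫_ℝ ^ 2) := by
        calc 2 / ‖y‖ ^ 2 = (⟪y, a⟫_ℝ * ⟪y, b⟫_ℝ / ‖y‖ ^ 2) * (2 / (⟪y, a⟫_ℝ * ⟪y, b⟫_ℝ)) := by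
              field_simp
          _ ≤ _ := mul_le_mul b2 i2 (by positivity) b0.le
      have k : 0 ≤ bs a b s y * (U ‖y‖ ^ (p - 1) + 2 * s * (N - 2 + 2 * s) / ‖y‖ ^ 2) := by
        have : 0 < (N:ℝ) - 2 + 2 * s := by linarith
        positivity
      calc p * U ‖y‖ ^ (p - 1) * |f y| ≤ p * (Λ / ‖y‖ ^ 2) * ‖f‖ := by
            have := h.ppos; have := h.Λpos; gcongr
        _ = C * ‖f‖ * (s * (1 - s) * (2 / ‖y‖ ^ 2)) := by
            rw [← mul_div_assoc, ← hC]; ring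
        _ ≤ C * ‖f‖ * (s * (1 - s) * (bs a b s y * (1 / ⟪y, a⟫_ℝ ^ 2 + 1 / ⟪y, b⟫_ℝ ^ 2))) := by
            gcongr
        _ ≤ C * ‖f‖ * (s * (1 - s) * (bs a b s y * (1 / ⟪y, a⟫_ℝ ^ 2 + 1 / ⟪y, b⟫_ℝ ^ 2)) +
            bs a b s y * (U ‖y‖ ^ (p - 1) + 2 * s * (N - 2 + 2 * s) / ‖y‖ ^ 2)) := by
            gcongr; linarith
        _ = _ := by ring
    | succ n ih =>
      intro x hx
      rw [Function.iterate_succ_apply']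
      refine odd_TT h P ha hb hab hs0 hs1 (TT_iter_odd h P fa _) (TT_iter_odd h P fb _)
        (by positivity) (fun y hy => ?_) x hx
      obtain ⟨hr, b0, b1, b2⟩ := bs_facts ha hb hab hs0 hs1 hy
      obtain ⟨i1, i2⟩ := inv_sq_facts ha hb hab hy
      have hU := Real.rpow_pos_of_pos (P.Upos y) (p - 1)
      have hwle := P.wle ‖y‖ hr.le
      have hp := h.ppos
      have hw' := hw _ (by positivity) hwle
      have hup : p * U ‖y‖ ^ (p - 1) ≤ θ * (U ‖y‖ ^ (p - 1) + 2 * s * (N - 2 + 2 * s) / ‖y‖ ^ 2 +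
          s * (1 - s) * (1 / ⟪y, a⟫_ℝ ^ 2 + 1 / ⟪y, b⟫_ℝ ^ 2)) := by
        calc p * U ‖y‖ ^ (p - 1) = p * (‖y‖ ^ 2 * U ‖y‖ ^ (p - 1)) / ‖y‖ ^ 2 := by field_simp
          _ ≤ θ * (‖y‖ ^ 2 * U ‖y‖ ^ (p - 1) + 2 * s * N) / ‖y‖ ^ 2 := by gcongr
          _ = θ * (U ‖y‖ ^ (p - 1) + 2 * s * (N - 2 + 2 * s) / ‖y‖ ^ 2 +
               s * (1 - s) * (4 / ‖y‖ ^ 2)) := by field_simp; ring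
          _ ≤ _ := by gcongr
      calc p * U ‖y‖ ^ (p - 1) * |((TT h P)^[n + 1] f) y| ≤
          (θ * (U ‖y‖ ^ (p - 1) + 2 * s * (N - 2 + 2 * s) / ‖y‖ ^ 2 +
          s * (1 - s) * (1 / ⟪y, a⟫_ℝ ^ 2 + 1 / ⟪y, b⟫_ℝ ^ 2))) * (C * θ ^ n * ‖f‖ * bs a b s y) :=
            mul_le_mul hup (ih y hy) (abs_nonneg _) (le_trans (by positivity) hup)
        _ = _ := by ring
  refine odd_everywhere hab (by positivity) (TT_iter_odd h P fa _) (TT_iter_odd h P fb _) fun x hx => ?_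
  refine (key x hx).trans (mul_le_of_le_one_right (by positivity) (bs_facts ha hb hab hs0 hs1 hx).2.2.1)

/-- odd-odd part, as a bounded function -/
def ob (a b : Euc N) (f : Euc N →ᵇ ℝ) : Euc N →ᵇ ℝ :=
  f - pb (Rf a) f - pb (Rf b) f + pb (Rf b) (pb (Rf a) f)

theorem ob_apply (a b : Euc N) (f : Euc N →ᵇ ℝ) (x : Euc N) : ob a b f x = oo a b f x := rfl

theorem TT_ob (h : Par N p β Λ) (P : Prof N p β Λ U U1) (a b : Euc N) (f : Euc N →ᵇ ℝ) :
    TT h P (ob a b f) = ob a b (TT h P f) := by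
  simp only [ob, map_add, map_sub, TT_pb]

theorem TT_iter_ob (h : Par N p β Λ) (P : Prof N p β Λ U U1) (a b : Euc N) (f : Euc N →ᵇ ℝ) (n : ℕ) :
    (TT h P)^[n] (ob a b f) = ob a b ((TT h P)^[n] f) := by
  induction n with
  | zero => rfl
  | succ n ih => rw [Function.iterate_succ_apply', Function.iterate_succ_apply', ih, TT_ob]

theorem ob_norm (a b : Euc N) (f : Euc N →ᵇ ℝ) : ‖ob a b f‖ ≤ 4 * ‖f‖ := by
  rw [BoundedContinuousFunction.norm_le (by positivity)]
  intro x
  rw [ob_apply, Real.norm_eq_abs]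
  have h1 := abs_le.1 (bcf_bd f x)
  have h2 := abs_le.1 (bcf_bd f (Rf a x))
  have h3 := abs_le.1 (bcf_bd f (Rf b x))
  have h4 := abs_le.1 (bcf_bd f (Rf a (Rf b x)))
  unfold oo
  rw [abs_le]; constructor <;> linarith

theorem Rf_smul (a : Euc N) {c : ℝ} (hc : c ≠ 0) (x : Euc N) : Rf (c • a) x = Rf a x := by
  rcases eq_or_ne a 0 with rfl | ha
  · simp
  have hn : ‖a‖ ≠ 0 := norm_ne_zero_iff.2 ha
  rw [Rf_apply, Rf_apply, norm_smul, smul_smul, inner_smul_left, Real.norm_eq_abs, mul_pow, sq_abs]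
  congr 2
  simp; field_simp

theorem Rf_zero (x : Euc N) : Rf 0 x = x := by rw [Rf_apply]; simp

theorem oo_decay (h : Par N p β Λ) (P : Prof N p β Λ U U1) : ∃ θ C : ℝ, 0 ≤ θ ∧ θ < 1 ∧ 0 < C ∧
    ∀ a b : Euc N, ⟪a, b⟫_ℝ = 0 → ∀ f : Euc N →ᵇ ℝ, ∀ n x,
      |oo a b ((TT h P)^[n + 1] f) x| ≤ C * θ ^ n * ‖f‖ := by
  obtain ⟨θ, C, h0, h1, hC, H⟩ := odd_decay h P
  refine ⟨θ, 4 * C, h0, h1, by positivity, fun a b hab f n x => ?_⟩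
  rcases eq_or_ne a 0 with rfl | ha
  · unfold oo; simp only [Rf_zero]; simp; positivity
  rcases eq_or_ne b 0 with rfl | hb
  · unfold oo; simp only [Rf_zero]; simp; positivity
  have na := norm_pos_iff.2 ha
  have nb := norm_pos_iff.2 hb
  have e : ∀ g : Euc N → ℝ, oo a b g x = oo (‖a‖⁻¹ • a) (‖b‖⁻¹ • b) g x := by
    intro g; unfold oo
    simp only [Rf_smul _ (inv_pos.2 na).ne', Rf_smul _ (inv_pos.2 nb).ne']
  have hab' : ⟪‖a‖⁻¹ • a, ‖b‖⁻¹ • b⟫_ℝ = 0 := by rw [inner_smul_left, inner_smul_right, hab]; simp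
  rw [e, ← ob_apply, ← TT_iter_ob]
  refine (H _ _ ?_ ?_ hab' _ (fun y => ?_) (fun y => ?_) n x).trans ?_
  · rw [norm_smul]; simp [na.ne']
  · rw [norm_smul]; simp [nb.ne']
  · simp only [ob_apply]; exact oo_odd_a hab' f y
  · simp only [ob_apply]; exact oo_odd_b hab' f y
  · have := mul_le_mul_of_nonneg_left (ob_norm (‖a‖⁻¹ • a) (‖b‖⁻¹ • b) f) (by positivity : 0 ≤ C * θ ^ n)
    linarith

end oddodd2

section hyers
variable {N : ℕ}

/-- all odd-odd parts are bounded by `D` -/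
def OB (D : ℝ) (f : Euc N → ℝ) : Prop := ∀ a b : Euc N, ⟪a, b⟫_ℝ = 0 → ∀ x, |oo a b f x| ≤ D

theorem Rf_conj (L : Euc N ≃ₗᵢ[ℝ] Euc N) (a x : Euc N) : L (Rf a x) = Rf (L a) (L x) := by
  rw [Rf_apply, Rf_apply, map_sub, map_smul, LinearIsometryEquiv.inner_map_map,
    LinearIsometryEquiv.norm_map]

theorem OB.isom {D : ℝ} {f : Euc N → ℝ} (h : OB D f) (L : Euc N ≃ₗᵢ[ℝ] Euc N) : OB D fun x => f (L x) := by
  intro a b hab x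
  have := h (L a) (L b) (by rw [LinearIsometryEquiv.inner_map_map]; exact hab) (L x)
  unfold oo at *
  rw [← Rf_conj L b x, ← Rf_conj L a x, ← Rf_conj L a (Rf b x)] at this
  exact this

theorem OB.half {D : ℝ} {f : Euc N → ℝ} (h : OB D f) (L : Euc N ≃ₗᵢ[ℝ] Euc N) :
    OB D fun x => (f x - f (L x)) / 2 := by
  intro a b hab x
  have h1 := abs_le.1 (h a b hab x)
  have h2 := abs_le.1 (h.isom L a b hab x)
  unfold oo at *
  rw [abs_le]; constructor <;> linarith

theorem Rf_sub {x y : Euc N} (h : ‖x‖ = ‖y‖) : Rf (x - y) x = y := Submodule.reflection_sub h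

theorem OB.even {D : ℝ} {f : Euc N → ℝ} (h : OB D f) {x y : Euc N} (hxy : ‖x‖ = ‖y‖) :
    |(f x + f (-x)) / 2 - (f y + f (-y)) / 2| ≤ D / 2 := by
  have hab : ⟪x - y, x - -y⟫_ℝ = 0 := by
    rw [sub_neg_eq_add, inner_sub_left, inner_add_right, inner_add_right, real_inner_self_eq_norm_sq,
      real_inner_self_eq_norm_sq, hxy, real_inner_comm x y]; ring
  have h1 := h _ _ hab x
  unfold oo at h1
  have e2 : Rf (x - -y) x = -y := Rf_sub (by rw [norm_neg]; exact hxy)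
  rw [e2, map_neg, Rf_sub hxy] at h1
  have e3 : Rf (x - y) y = x := by
    have := Rf_invol (x - y) x
    rwa [Rf_sub hxy] at this
  rw [e3] at h1
  rw [show (f x + f (-x)) / 2 - (f y + f (-y)) / 2 = (f x - f y - f (-y) + f (-x)) / 2 by ring,
    abs_div, abs_two]
  linarith

/-- odd part in direction `e` -/
def ge (e : Euc N) (g : Euc N → ℝ) (x : Euc N) : ℝ := (g x - g (Rf e x)) / 2

theorem OB.slice {D : ℝ} {g : Euc N → ℝ} (h : OB D g) {e x y : Euc N} (hxy : ‖x‖ = ‖y‖)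
    (he : ⟪x, e⟫_ℝ = ⟪y, e⟫_ℝ) : |ge e g x - ge e g y| ≤ D / 2 := by
  have hab : ⟪x - y, e⟫_ℝ = 0 := by rw [inner_sub_left, he, sub_self]
  have h1 := h _ _ hab x
  unfold oo at h1
  rw [Rf_comm hab, Rf_sub hxy] at h1
  unfold ge
  rw [show (g x - g (Rf e x)) / 2 - (g y - g (Rf e y)) / 2 = (g x - g y - g (Rf e x) + g (Rf e y)) / 2 by ring,
    abs_div, abs_two]
  linarith

theorem exists_orth (hN : 3 ≤ N) (e y : Euc N) : ∃ k : Euc N, ‖k‖ = 1 ∧ ⟪k, e⟫_ℝ = 0 ∧ ⟪k, y⟫_ℝ = 0 := by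
  have hlt : Module.finrank ℝ (Submodule.span ℝ ({e, y} : Set (Euc N))) < Module.finrank ℝ (Euc N) := by
    have h1 : Module.finrank ℝ (Submodule.span ℝ ({e, y} : Set (Euc N))) ≤ 2 := by
      have := finrank_span_finset_le_card (R := ℝ) ({e, y} : Finset (Euc N))
      rw [Finset.coe_pair] at this
      exact this.trans Finset.card_le_two
    rw [finrank_Euc]; omega
  have hne : (Submodule.span ℝ ({e, y} : Set (Euc N)))ᗮ ≠ ⊥ := by
    intro hb
    rw [Submodule.orthogonal_eq_bot_iff] at hb
    rw [hb, finrank_top] at hlt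
    exact lt_irrefl _ hlt
  obtain ⟨k, hk, hk0⟩ := Submodule.exists_mem_ne_zero_of_ne_bot hne
  have hn := norm_pos_iff.2 hk0
  rw [Submodule.mem_orthogonal'] at hk
  refine ⟨‖k‖⁻¹ • k, ?_, ?_, ?_⟩
  · rw [norm_smul]; simp [hn.ne']
  · rw [inner_smul_left, hk e (Submodule.subset_span (by simp))]; simp
  · rw [inner_smul_left, hk y (Submodule.subset_span (by simp))]; simp

theorem OB.rect (hN : 3 ≤ N) {D : ℝ} {g : Euc N → ℝ} (h : OB D g) (hodd : ∀ x, g (-x) = - g x)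
    {e : Euc N} (he : ‖e‖ = 1) {r : ℝ} {y z : Euc N} (hr : 0 ≤ r) (hy : ‖y‖ = r) (hz : ‖z‖ = r)
    (hyz : 2 * ⟪z, e⟫_ℝ = r + ⟪y, e⟫_ℝ) : |g (r • e) + ge e g y - 2 * ge e g z| ≤ 2 * D := by
  obtain ⟨k0, hk1, hke, hky⟩ := exists_orth hN e y
  set m := (2:ℝ)⁻¹ • (r • e + y) with hm
  set j := (2:ℝ)⁻¹ • (r • e - y) with hj
  set k := ‖j‖ • k0 with hk
  have hkn : ‖k‖ = ‖j‖ := by rw [hk, norm_smul, hk1]; simp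
  have hre : ‖r • e‖ = r := by rw [norm_smul, he, Real.norm_of_nonneg hr, mul_one]
  have hmj : ⟪m, j⟫_ℝ = 0 := by
    rw [hm, hj, inner_smul_left, inner_smul_right, inner_add_left, inner_sub_right, inner_sub_right,
      real_inner_self_eq_norm_sq, real_inner_self_eq_norm_sq, hre, hy, real_inner_comm (r • e) y]; ring
  have hek : ⟪e, k⟫_ℝ = 0 := by rw [hk, inner_smul_right, real_inner_comm, hke, mul_zero]
  have hyk : ⟪y, k⟫_ℝ = 0 := by rw [hk, inner_smul_right, real_inner_comm, hky, mul_zero]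
  have hmk : ⟪m, k⟫_ℝ = 0 := by
    rw [hm, inner_smul_left, inner_add_left, inner_smul_left, hek, hyk]; simp
  have hp : m + j = r • e := by rw [hm, hj, ← smul_add]; simp [smul_smul, ← two_smul ℝ]
  have hq : m - j = y := by rw [hm, hj, ← smul_sub]; simp [smul_smul, ← two_smul ℝ]
  have hab : ⟪j - k, j - -k⟫_ℝ = 0 := by
    rw [sub_neg_eq_add, inner_sub_left, inner_add_right, inner_add_right, real_inner_self_eq_norm_sq,
      real_inner_self_eq_norm_sq, hkn, real_inner_comm j k]; ring
  have h1 := h.half (Rf e) _ _ hab (m + j)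
  change |oo (j - k) (j - -k) (ge e g) (m + j)| ≤ D at h1
  unfold oo at h1
  have fa : Rf (j - k) m = m := Rf_fix (by rw [inner_sub_right, hmj, hmk, sub_self])
  have fb : Rf (j - -k) m = m := Rf_fix (by rw [sub_neg_eq_add, inner_add_right, hmj, hmk, add_zero])
  have ga : Rf (j - k) j = k := Rf_sub hkn.symm
  have gb : Rf (j - -k) j = -k := Rf_sub (by rw [norm_neg, hkn])
  have gk : Rf (j - k) k = j := by
    have := Rf_invol (j - k) j
    rwa [ga] at this
  rw [map_add, map_add, fa, fb, ga, gb, map_add, map_neg, fa, gk, hp, ← sub_eq_add_neg, ← sub_eq_add_neg, hq] at h1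
  have e1 : ge e g (r • e) = g (r • e) := by
    unfold ge
    have : Rf e (r • e) = -(r • e) := by
      rw [Rf_apply, inner_smul_right, real_inner_self_eq_norm_sq, he, two_mul, add_smul]; simp
    rw [this, hodd]; ring
  have nrm : ∀ v : Euc N, ⟪m, v⟫_ℝ = 0 → ‖m + v‖ ^ 2 = ‖m‖ ^ 2 + ‖v‖ ^ 2 := by
    intro v hv
    rw [norm_add_sq_real, hv]; ring
  have hmr : ‖m‖ ^ 2 + ‖j‖ ^ 2 = r ^ 2 := by rw [← nrm j hmj, hp, hre]
  have n1 : ‖m + k‖ = ‖z‖ := by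
    rw [hz, ← sq_eq_sq₀ (norm_nonneg _) hr, nrm k hmk, hkn, hmr]
  have n2 : ‖m - k‖ = ‖z‖ := by
    rw [hz, ← sq_eq_sq₀ (norm_nonneg _) hr, sub_eq_add_neg, nrm (-k) (by rw [inner_neg_right, hmk, neg_zero]),
      norm_neg, hkn, hmr]
  have hme : 2 * ⟪m, e⟫_ℝ = r + ⟪y, e⟫_ℝ := by
    rw [hm, inner_smul_left, inner_add_left, inner_smul_left, real_inner_self_eq_norm_sq, he]; simp
  have hke' : ⟪k, e⟫_ℝ = 0 := by rw [real_inner_comm]; exact hek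
  have s1 := abs_le.1 (h.slice (e := e) n1 (by rw [inner_add_left, hke']; linarith))
  have s2 := abs_le.1 (h.slice (e := e) n2 (by rw [inner_sub_left, hke']; linarith))
  rw [e1] at h1
  rw [abs_le] at h1 ⊢
  constructor <;> linarith

theorem OB.axis (hN : 3 ≤ N) {D : ℝ} {g : Euc N → ℝ} (h : OB D g) (hodd : ∀ x, g (-x) = - g x)
    {M : ℝ} (hM : ∀ x, |g x| ≤ M) {e : Euc N} (he : ‖e‖ = 1) (z : Euc N) :
    |ge e g z - g (‖z‖ • e) * (⟪z, e⟫_ℝ / ‖z‖)| ≤ 2 * D := by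
  rcases eq_or_ne z 0 with rfl | hz0
  · have hD : 0 ≤ D := (abs_nonneg _).trans (h 0 0 (by simp) 0)
    unfold ge; simp [hD]
  obtain ⟨r, hrz⟩ : ∃ r, r = ‖z‖ := ⟨_, rfl⟩
  have hr : 0 < r := hrz ▸ norm_pos_iff.2 hz0
  have key : ∀ n : ℕ, ∀ z : Euc N, ‖z‖ = r → |ge e g z - g (r • e) * (⟪z, e⟫_ℝ / r)| ≤ 2 * D + 2 * M / 2 ^ n := by
    intro n
    induction n with
    | zero =>
      intro z hz
      have hD : 0 ≤ D := (abs_nonneg _).trans (h 0 0 (by simp) 0)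
      have h1 : |ge e g z| ≤ M := by
        have a1 := abs_le.1 (hM z)
        have a2 := abs_le.1 (hM (Rf e z))
        unfold ge; rw [abs_le]; constructor <;> linarith
      have h2 : |g (r • e) * (⟪z, e⟫_ℝ / r)| ≤ M := by
        rw [abs_mul]
        have : |⟪z, e⟫_ℝ / r| ≤ 1 := by
          rw [abs_div, abs_of_pos hr, div_le_one hr]
          have := abs_real_inner_le_norm z e
          rwa [he, mul_one, hz] at this
        calc _ ≤ M * 1 := mul_le_mul (hM _) this (abs_nonneg _) ((abs_nonneg _).trans (hM 0))
          _ = M := mul_one M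
      rw [abs_le] at h1 h2 ⊢
      constructor <;> simp <;> linarith
    | succ n ih =>
      have pos : ∀ z : Euc N, ‖z‖ = r → 0 ≤ ⟪z, e⟫_ℝ →
          |ge e g z - g (r • e) * (⟪z, e⟫_ℝ / r)| ≤ 2 * D + 2 * M / 2 ^ (n + 1) := by
        intro z hz hze
        obtain ⟨k, hk1, hke, -⟩ := exists_orth hN e e
        have hzle : ⟪z, e⟫_ℝ ≤ r := by
          have := (le_abs_self _).trans (abs_real_inner_le_norm z e)
          rwa [he, mul_one, hz] at this
        set t := 2 * ⟪z, e⟫_ℝ - r with ht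
        have htr : 0 ≤ r ^ 2 - t ^ 2 := by nlinarith
        set y := t • e + Real.sqrt (r ^ 2 - t ^ 2) • k with hy
        have hye : ⟪y, e⟫_ℝ = t := by
          rw [hy, inner_add_left, inner_smul_left, inner_smul_left, hke, real_inner_self_eq_norm_sq, he]; simp
        have hyn : ‖y‖ = r := by
          rw [← sq_eq_sq₀ (norm_nonneg _) hr.le, hy, norm_add_sq_real, inner_smul_left, inner_smul_right,
            real_inner_comm, hke, norm_smul, norm_smul, he, hk1, mul_one, mul_one, Real.norm_eq_abs, Real.norm_eq_abs,
            sq_abs, sq_abs, Real.sq_sqrt htr]; simp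
        have h1 := abs_le.1 (h.rect hN hodd he hr.le hyn hz (by rw [hye]; linarith))
        have h2 := abs_le.1 (ih y hyn)
        rw [hye] at h2
        have e1 : g (r • e) * (t / r) = 2 * (g (r • e) * (⟪z, e⟫_ℝ / r)) - g (r • e) := by
          rw [ht]; field_simp
        rw [e1] at h2
        have e2 : 2 * M / 2 ^ (n + 1) = (2 * M / 2 ^ n) / 2 := by rw [pow_succ]; field_simp
        rw [e2, abs_le]
        constructor <;> linarith
      intro z hz
      rcases le_total 0 ⟪z, e⟫_ℝ with h0 | h0
      · exact pos z hz h0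
      · have := pos (Rf e z) (by rw [LinearIsometryEquiv.norm_map]; exact hz) (by rw [Rf_inner_self]; linarith)
        rw [Rf_inner_self] at this
        have e1 : ge e g (Rf e z) - g (r • e) * (-⟪z, e⟫_ℝ / r) = -(ge e g z - g (r • e) * (⟪z, e⟫_ℝ / r)) := by
          unfold ge; rw [Rf_invol]; ring
        rwa [e1, abs_neg] at this
  rw [← hrz]
  have ht : Tendsto (fun n : ℕ => 2 * D + 2 * M / 2 ^ n) atTop (𝓝 (2 * D + 0)) :=
    tendsto_const_nhds.add (tendsto_const_nhds.div_atTop (tendsto_pow_atTop_atTop_of_one_lt (by norm_num)))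
  rw [add_zero] at ht
  exact ge_of_tendsto' ht fun n => key n z hrz.symm

/-- flip of the first `k` coordinates -/
def flipc (k : ℕ) (z : Euc N) : Euc N := WithLp.toLp 2 fun j : Fin N => if j.val < k then - z j else z j

theorem flipc_norm (k : ℕ) (z : Euc N) : ‖flipc k z‖ = ‖z‖ := by
  rw [← sq_eq_sq₀ (norm_nonneg _) (norm_nonneg _), ← sum_sq_eq, ← sum_sq_eq]
  refine Finset.sum_congr rfl fun i _ => ?_
  simp only [flipc]
  split_ifs <;> ring

theorem inner_ee (z : Euc N) (i : Fin N) : ⟪z, (ee i : Euc N)⟫_ℝ = z i := by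
  rw [real_inner_comm]
  simp [EuclideanSpace.inner_single_left]

theorem ee_norm (i : Fin N) : ‖(ee i : Euc N)‖ = 1 := by simp

theorem flipc_succ (i : Fin N) (z : Euc N) : Rf (ee i) (flipc i.val z) = flipc (i.val + 1) z := by
  rw [Rf_apply, real_inner_comm, inner_ee, ee_norm]
  ext j
  have hi : flipc (i.val) z i = z i := by simp [flipc]
  rw [hi]
  by_cases hj : j = i
  · subst hj; simp [flipc]; ring
  · have hne : j.val ≠ i.val := fun hh => hj (Fin.ext hh)
    have : (j < i) ↔ (j ≤ i) := by rw [Fin.lt_def, Fin.le_def]; omega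
    simp [flipc, hj, this]

theorem hyers_ulam (hN : 3 ≤ N) {D : ℝ} {f : Euc N → ℝ} (h : OB D f) {M : ℝ} (hM : ∀ x, |f x| ≤ M)
    (i0 : Fin N) (z : Euc N) :
    |f z - ((f (‖z‖ • ee i0) + f (-(‖z‖ • ee i0))) / 2 +
      ∑ i : Fin N, (f (‖z‖ • ee i) - f (-(‖z‖ • ee i))) / 2 * (z i / ‖z‖))| ≤ (2 * N + 1) * D := by
  have hD : 0 ≤ D := (abs_nonneg _).trans (h 0 0 (by simp) 0)
  set g : Euc N → ℝ := fun x => (f x - f (-x)) / 2 with hg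
  have gOB : OB D g := h.half (LinearIsometryEquiv.neg ℝ)
  have godd : ∀ x, g (-x) = - g x := fun x => by simp only [hg, neg_neg]; ring
  have gM : ∀ x, |g x| ≤ M := fun x => by
    have h1 := abs_le.1 (hM x)
    have h2 := abs_le.1 (hM (-x))
    simp only [hg]; rw [abs_le]; constructor <;> linarith
  have hev := h.even (x := z) (y := ‖z‖ • ee i0) (by rw [norm_smul, ee_norm]; simp)
  have hsum : ∑ i : Fin N, ge (ee i) g (flipc i.val z) = g z := by
    have e1 : ∀ i : Fin N, ge (ee i) g (flipc i.val z) =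
        (fun k : ℕ => g (flipc k z) / 2 - g (flipc (k + 1) z) / 2) i.val := by
      intro i
      simp only [ge, flipc_succ]; ring
    rw [Finset.sum_congr rfl fun i _ => e1 i, Fin.sum_univ_eq_sum_range
      (fun k : ℕ => g (flipc k z) / 2 - g (flipc (k + 1) z) / 2) N,
      Finset.sum_range_sub' (fun k => g (flipc k z) / 2)]
    have e2 : flipc 0 z = z := by ext j; simp [flipc]
    have e3 : flipc N z = -z := by ext j; simp [flipc]
    rw [e2, e3, godd]; ring
  have hod : |g z - ∑ i : Fin N, g (‖z‖ • ee i) * (z i / ‖z‖)| ≤ N * (2 * D) := by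
    rw [← hsum, ← Finset.sum_sub_distrib]
    refine (Finset.abs_sum_le_sum_abs _ _).trans ?_
    calc _ ≤ ∑ i : Fin N, 2 * D := Finset.sum_le_sum fun i _ => by
          have := gOB.axis hN godd gM (ee_norm i) (flipc i.val z)
          rw [flipc_norm, inner_ee] at this
          rwa [show flipc i.val z i = z i by simp [flipc]] at this
      _ = _ := by simp
  have e : f z = (f z + f (-z)) / 2 + g z := by simp only [hg]; ring
  rw [e]
  rw [abs_le] at hev hod ⊢
  simp only [hg] at hod ⊢
  constructor <;> linarith

end hyers

section modes
variable {N : ℕ} {p β Λ : ℝ} {U U1 : ℝ → ℝ}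

theorem cmp_deriv {f g f' g' : ℝ → ℝ} (cf : ContinuousOn f (Set.Ici 0)) (cg : ContinuousOn g (Set.Ici 0))
    (df : ∀ r, 0 < r → HasDerivAt f (f' r) r) (dg : ∀ r, 0 < r → HasDerivAt g (g' r) r)
    (h : ∀ r, 0 < r → |f' r| ≤ g' r) {r : ℝ} (hr : 0 ≤ r) : |f r - f 0| ≤ g r - g 0 := by
  have mono : ∀ F F' : ℝ → ℝ, ContinuousOn F (Set.Ici 0) → (∀ r, 0 < r → HasDerivAt F (F' r) r) →
      (∀ r, 0 < r → 0 ≤ F' r) → F 0 ≤ F r := by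
    intro F F' cF dF hF
    have := monotoneOn_of_deriv_nonneg (convex_Ici 0) cF
      (fun s hs => by rw [interior_Ici] at hs; exact (dF s hs).differentiableAt.differentiableWithinAt)
      (fun s hs => by rw [interior_Ici] at hs; rw [(dF s hs).deriv]; exact hF s hs)
    exact this Set.self_mem_Ici hr hr
  have h1 := mono (fun s => g s - f s) (fun s => g' s - f' s) (cg.sub cf) (fun s hs => (dg s hs).sub (df s hs))
    (fun s hs => by have := (abs_le.1 (h s hs)).2; linarith)
  have h2 := mono (fun s => g s + f s) (fun s => g' s + f' s) (cg.add cf) (fun s hs => (dg s hs).add (df s hs))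
    (fun s hs => by have := (abs_le.1 (h s hs)).1; linarith)
  rw [abs_le]; constructor <;> linarith

theorem dpow_nat (k : ℕ) {r : ℝ} (hr : 0 < r) : HasDerivAt (fun r : ℝ => r ^ k) (k * (r ^ k / r)) r := by
  refine (hasDerivAt_pow k r).congr_deriv ?_
  cases k with
  | zero => simp
  | succ k => rw [Nat.add_sub_cancel, pow_succ]; field_simp

theorem AvI_deriv (N : ℕ) (hN : 1 ≤ N) {H : ℝ → ℝ} (hH : Continuous H) {r : ℝ} (hr : 0 < r) :
    HasDerivAt (AvI N H) ((H r - N * AvI N H r) / r) r := by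
  have h1 := (AvI_hasDerivAt N hN hH r).div (dpow_nat N hr) (by positivity)
  have h2 : (AvI N H) =ᶠ[𝓝 r] ((fun s => s ^ N * AvI N H s) / fun r => r ^ N) := by
    filter_upwards [lt_mem_nhds hr] with s hs
    simp only [Pi.div_apply]; field_simp
  refine (h1.congr_of_eventuallyEq h2).congr_deriv ?_
  have : r ^ N = r ^ (N - 1) * r := by rw [← pow_succ]; congr 1; omega
  rw [this]
  field_simp

theorem AvI_cmp (N : ℕ) (hN : 1 ≤ N) {F H : ℝ → ℝ} (hF : Continuous F) (hH : Continuous H)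
    (h : ∀ s, 0 ≤ s → |F s| ≤ H s) {r : ℝ} (hr : 0 < r) : |AvI N F r| ≤ AvI N H r := by
  have h1 := cmp_deriv (f := fun s => s ^ N * AvI N F s) (g := fun s => s ^ N * AvI N H s)
    (((continuous_pow N).mul (AvI_continuous N hF)).continuousOn)
    (((continuous_pow N).mul (AvI_continuous N hH)).continuousOn)
    (fun s _ => AvI_hasDerivAt N hN hF s) (fun s _ => AvI_hasDerivAt N hN hH s)
    (fun s hs => by rw [abs_mul, abs_of_nonneg (by positivity)]; gcongr; exact h s hs.le) hr.le
  have hN0 : N ≠ 0 := by omega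
  simp only [zero_pow hN0, zero_mul, sub_zero] at h1
  rw [abs_mul, abs_of_pos (by positivity)] at h1
  exact le_of_mul_le_mul_left h1 (by positivity)

theorem Prof.Uc (P : Prof N p β Λ U U1) {t : ℝ} (ht : 0 ≤ t) : Continuous fun s => U s ^ t :=
  P.cont.rpow_const fun _ => Or.inr ht

theorem Prof.dUp (P : Prof N p β Λ U U1) (t : ℝ) {r : ℝ} (hr : 0 < r) :
    HasDerivAt (fun s => U s ^ t) (t * U r ^ (t - 1) * U1 r) r := by
  refine ((P.d1 r hr).rpow_const (Or.inl (P.pos r hr.le).ne')).congr_deriv ?_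
  ring

theorem Prof.Up1 (P : Prof N p β Λ U U1) {r : ℝ} (hr : 0 ≤ r) : U r ^ p = U r ^ (p - 1) * U r := by
  rw [← Real.rpow_add_one (P.pos r hr).ne']; congr 1; ring

/-- reduction of the linear problem to a PDE off the origin -/
theorem lin_of_pde (h : Par N p β Λ) (P : Prof N p β Λ U U1) {q ψ : Euc N → ℝ} (hq : Continuous q)
    (hψ : Continuous ψ) {M C : ℝ} (hM : ∀ x, |q x| ≤ M) (hC : ∀ x, |ψ x| ≤ C * U ‖x‖)
    (hHL : ∀ x, x ≠ 0 → ∃ g H, HL ψ x g H ∧ ∑ i, H i = -(p * U ‖x‖ ^ (p - 1) * (ψ x + U ‖x‖ * q x))) :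
    ∃ f : Euc N →ᵇ ℝ, ‖f‖ ≤ M + C ∧ ∀ x, f x - TT h P f x = q x := by
  have hc : Continuous fun x => q x + ψ x / U ‖x‖ := hq.add (hψ.div P.Ucont fun x => (P.Upos x).ne')
  have hb : ∀ x, ‖q x + ψ x / U ‖x‖‖ ≤ M + C := fun x => by
    refine (norm_add_le _ _).trans (add_le_add (hM x) ?_)
    rw [Real.norm_eq_abs, abs_div, abs_of_pos (P.Upos x), div_le_iff₀ (P.Upos x)]
    exact hC x
  refine ⟨BoundedContinuousFunction.ofNormedAddCommGroup _ hc (M + C) hb,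
    BoundedContinuousFunction.norm_ofNormedAddCommGroup_le _ ((norm_nonneg _).trans (hb 0)) _, fun x => ?_⟩
  rw [TT_apply]
  simp only [BoundedContinuousFunction.coe_ofNormedAddCommGroup]
  have hAdm : Adm (β + 2) fun y => p * U ‖y‖ ^ p * (q y + ψ y / U ‖y‖) := by
    simpa [mul_assoc] using (P.adm h hc hb).const_mul p
  have hC0 : 0 ≤ C := by
    have := (abs_nonneg _).trans (hC 0)
    exact nonneg_of_mul_nonneg_left this (P.Upos 0)
  have hr := rep h.N4 h.βpos h.bN hψ (fun δ hδ => by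
    obtain ⟨R, hR⟩ := P.U_decay h (δ / (C + 1)) (by positivity)
    refine ⟨R, fun x hx => (hC x).trans ?_⟩
    have := hR x hx
    rw [abs_of_pos (P.Upos x), le_div_iff₀ (by positivity)] at this
    nlinarith [P.Upos x]) hAdm (fun x hx => by
      obtain ⟨g, H, h1, h2⟩ := hHL x hx
      refine ⟨g, H, h1, ?_⟩
      rw [h2, P.Up1 (norm_nonneg x)]
      have := P.Upos x
      field_simp
      ring) x
  rw [← hr]
  have := P.Upos x
  field_simp
  ring

theorem mode0 (h : Par N p β Λ) (P : Prof N p β Λ U U1) {G : ℝ → ℝ} (hG : Continuous G) {M : ℝ}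
    (hM : ∀ r, |G r| ≤ M) : ∃ f : Euc N →ᵇ ℝ, ‖f‖ ≤ (1 + p / (p - 1)) * M ∧
      ∀ x, f x - TT h P f x = G ‖x‖ := by
  have hN1 : 1 ≤ N := by have := h.hN; omega
  have hp1 := h.hp
  have hp := h.ppos
  have hM0 : 0 ≤ M := (abs_nonneg _).trans (hM 0)
  set Z : ℝ → ℝ := fun r => β * U r + r * U1 r with hZd
  set Z1 : ℝ → ℝ := fun r => (β + 2 - N) * U1 r - r * U r ^ p with hZ1d
  have hZc : Continuous Z := by have := P.cont; have := P.cont1; fun_prop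
  have hUp := P.Uc hp.le
  have hZ1c : Continuous Z1 := by have := P.cont; have := P.cont1; fun_prop
  have hZ0 : ∀ r, 0 ≤ r → 0 < Z r := P.Z
  have dZ : ∀ r, 0 < r → HasDerivAt Z (Z1 r) r := fun r hr => core_dZ hr (P.d1 r hr) (P.d2 r hr)
  have dZ1 : ∀ r, 0 < r → HasDerivAt Z1 (-(N - 1) / r * Z1 r - p * U r ^ (p - 1) * Z r) r := by
    intro r hr
    refine (((P.d2 r hr).const_mul (β + 2 - N)).sub ((hasDerivAt_id r).mul (P.dUp p hr))).congr_deriv ?_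
    simp only [hZ1d, hZd, id]
    rw [P.Up1 hr.le]
    have hb : p * β = β + 2 := by linarith [h.βp]
    rw [mul_add, show p * U r ^ (p - 1) * (β * U r) = (p * β) * (U r ^ (p - 1) * U r) by ring, hb]
    field_simp
    ring
  set F : ℝ → ℝ := fun s => p * U s ^ p * G s * Z s with hFd
  have hFc : Continuous F := by fun_prop
  set H : ℝ → ℝ := fun s => U s ^ p * Z s with hHd
  have hHc : Continuous H := by fun_prop
  have wron : ∀ r, 0 < r → U1 r * Z r - U r * Z1 r = (p - 1) * r * AvI N H r := by
    intro r hr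
    have := cmp_deriv (f := fun s => s ^ (N - 1) * (U1 s * Z s - U s * Z1 s) - (p - 1) * (s ^ N * AvI N H s))
      (f' := fun _ => 0) (g := fun _ => 0) (g' := fun _ => 0)
      (by
        have := AvI_continuous N hHc
        have := P.cont; have := P.cont1
        apply Continuous.continuousOn; fun_prop) continuousOn_const
      (fun s hs => by
        refine (((dpow_nat (N - 1) hs).mul (((P.d2 s hs).mul (dZ s hs)).sub ((P.d1 s hs).mul (dZ1 s hs)))).sub
          ((AvI_hasDerivAt N hN1 hHc s).const_mul (p - 1))).congr_deriv ?_
        rw [Nat.cast_sub hN1]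
        simp only [hHd, Pi.sub_apply, Pi.mul_apply]
        rw [P.Up1 hs.le]
        push_cast
        field_simp
        ring) (fun s _ => hasDerivAt_const _ _) (fun s _ => by simp) hr.le
    have hN0 : N ≠ 0 := by omega
    have hN10 : N - 1 ≠ 0 := by have := h.hN; omega
    simp only [sub_self, zero_pow hN0, zero_pow hN10, zero_mul, mul_zero, sub_zero] at this
    have h0 := abs_nonpos_iff.1 this
    have e : r ^ N = r ^ (N - 1) * r := by rw [← pow_succ]; congr 1; omega
    rw [e] at h0
    have h2 : r ^ (N - 1) * (U1 r * Z r - U r * Z1 r - (p - 1) * r * AvI N H r) = 0 := by linarith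
    rcases mul_eq_zero.1 h2 with h3 | h3
    · exact absurd h3 (by positivity)
    · linarith
  have Abd : ∀ r, 0 < r → |AvI N F r| ≤ p * M * AvI N H r := by
    intro r hr
    have := AvI_cmp N hN1 hFc (H := fun s => p * M * H s) (by fun_prop) (fun s hs => by
      have hz := hZ0 s hs
      have hu := Real.rpow_pos_of_pos (P.pos s hs) p
      simp only [hFd, hHd]
      rw [abs_mul, abs_of_pos hz, abs_mul, abs_of_pos (by positivity : 0 < p * U s ^ p)]
      calc p * U s ^ p * |G s| * Z s ≤ p * U s ^ p * M * Z s := by gcongr; exact hM s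
        _ = _ := by ring) hr
    refine this.trans (le_of_eq ?_)
    unfold AvI
    rw [← intervalIntegral.integral_const_mul]
    congr 1; ext θ; ring
  set φ : ℝ → ℝ := fun s => |s| * AvI N F |s| / Z |s| ^ 2 with hφd
  have hφc : Continuous φ := by
    have h1 := (AvI_continuous N hFc).comp continuous_abs
    have h2 := hZc.comp continuous_abs
    exact (continuous_abs.mul h1).div (h2.pow 2) fun s => (pow_pos (hZ0 _ (abs_nonneg s)) 2).ne'
  set Φ : ℝ → ℝ := fun r => ∫ s in (0:ℝ)..r, φ s with hΦd
  have dΦ : ∀ r, HasDerivAt Φ (φ r) r := fun r => (hφc.integral_hasStrictDerivAt 0 r).hasDerivAt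
  have hφ : ∀ r, 0 < r → φ r = r * AvI N F r / Z r ^ 2 := fun r hr => by simp only [hφd, abs_of_pos hr]
  have hΦc : Continuous Φ := continuous_iff_continuousAt.2 fun r => (dΦ r).continuousAt
  have Φbd : ∀ r, 0 ≤ r → |Φ r| ≤ p / (p - 1) * M * (U r / Z r) := by
    intro r hr
    have := cmp_deriv (f := Φ) (g := fun s => p / (p - 1) * M * (U s / Z s)) hΦc.continuousOn
      (continuousOn_const.mul (P.cont.continuousOn.div hZc.continuousOn fun s hs => (hZ0 s hs).ne'))
      (fun s _ => dΦ s) (fun s hs => ((P.d1 s hs).div (dZ s hs) (hZ0 s hs.le).ne').const_mul _)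
      (fun s hs => by
        have hz := hZ0 s hs.le
        rw [hφ s hs, wron s hs, abs_div, abs_mul, abs_of_pos hs, abs_of_pos (by positivity : 0 < Z s ^ 2)]
        have hp2 : 0 < p - 1 := by linarith
        calc s * |AvI N F s| / Z s ^ 2 ≤ s * (p * M * AvI N H s) / Z s ^ 2 := by
              gcongr; exact Abd s hs
          _ = _ := by field_simp) hr
    have e0 : Φ 0 = 0 := by simp [hΦd]
    rw [e0, sub_zero] at this
    refine this.trans (sub_le_self _ ?_)
    have hp2 : 0 < p - 1 := by linarith
    have := hZ0 0 le_rfl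
    have := P.pos 0 le_rfl
    positivity
  refine (lin_of_pde h P (q := fun x => G ‖x‖) (ψ := fun x => -(Z ‖x‖ * Φ ‖x‖)) (M := M) (C := p / (p - 1) * M)
    (hG.comp continuous_norm) ((hZc.mul hΦc).comp continuous_norm).neg (fun x => hM _) (fun x => ?_) (fun x hx => ?_)).imp
    fun f hf => ⟨hf.1.trans (le_of_eq (by ring)), hf.2⟩
  · have hz := hZ0 ‖x‖ (norm_nonneg x)
    rw [abs_neg, abs_mul, abs_of_pos hz]
    calc Z ‖x‖ * |Φ ‖x‖| ≤ Z ‖x‖ * (p / (p - 1) * M * (U ‖x‖ / Z ‖x‖)) := by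
          gcongr; exact Φbd _ (norm_nonneg x)
      _ = _ := by field_simp
  · have hr := norm_pos_iff.2 hx
    have d1 : ∀ r, 0 < r → HasDerivAt (fun r => -(Z r * Φ r)) (-(Z1 r * Φ r + r * AvI N F r / Z r)) r := by
      intro r hr
      refine ((dZ r hr).mul (dΦ r)).neg.congr_deriv ?_
      have hz := hZ0 r hr.le
      rw [hφ r hr]; field_simp
    have d2 := (((dZ1 _ hr).mul (dΦ ‖x‖)).add
      (((hasDerivAt_id ‖x‖).mul (AvI_deriv N hN1 hFc hr)).div (dZ _ hr) (hZ0 _ hr.le).ne')).neg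
    refine ⟨_, _, HL_radial hx d1 d2, ?_⟩
    rw [sum_radial hx]
    have hz := hZ0 _ hr.le
    rw [hφ _ hr]
    simp only [Pi.mul_apply, id]
    have eF : F ‖x‖ = p * U ‖x‖ ^ (p - 1) * U ‖x‖ * G ‖x‖ * Z ‖x‖ := by
      simp only [hFd]; rw [P.Up1 hr.le]; ring
    rw [eF]
    field_simp
    ring

theorem mode1 (h : Par N p β Λ) (P : Prof N p β Λ U U1) : ∃ C, 0 ≤ C ∧ ∀ (i : Fin N) (b : ℝ → ℝ) (M : ℝ),
    Continuous b → b 0 = 0 → (∀ r, |b r| ≤ M) → ∃ f : Euc N →ᵇ ℝ, ‖f‖ ≤ C * M ∧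
      ∀ x, f x - TT h P f x = b ‖x‖ * (x i / ‖x‖) := by
  have hN1 : 1 ≤ N := by have := h.hN; omega
  have hN11 := h.N11
  have hβ4 := h.β4
  have hβ := h.βpos
  have hp1 := h.hp
  have hp := h.ppos
  obtain ⟨c, hc0, hcd⟩ : ∃ c : ℝ, 0 < c ∧ c * (N - 2 - β) = N - 3 - 2 * β :=
    ⟨(N - 3 - 2 * β) / (N - 2 - β), by apply div_pos <;> linarith, by
      apply div_mul_cancel₀; apply ne_of_gt; linarith⟩
  refine ⟨1 + p / c * β, by positivity, fun i b M hb hb0 hM => ?_⟩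
  have hM0 : 0 ≤ M := (abs_nonneg _).trans (hM 0)
  have hUp := P.Uc hp.le
  set J0 : ℝ → ℝ := AvI N (fun s => U s ^ p) with hJ0
  have hJ0c : Continuous J0 := AvI_continuous N hUp
  -- `-U1 = r J0`
  have hYJ : ∀ r, 0 < r → -U1 r = r * J0 r := by
    intro r hr
    have := cmp_deriv (f := fun s => s ^ (N - 1) * U1 s + s ^ N * J0 s)
      (f' := fun _ => 0) (g := fun _ => 0) (g' := fun _ => 0)
      (by
        have := P.cont1
        apply Continuous.continuousOn; fun_prop) continuousOn_const
      (fun s hs => by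
        refine (((dpow_nat (N - 1) hs).mul (P.d2 s hs)).add (AvI_hasDerivAt N hN1 hUp s)).congr_deriv ?_
        rw [Nat.cast_sub hN1]
        push_cast
        field_simp
        ring) (fun s _ => hasDerivAt_const _ _) (fun s _ => by simp) hr.le
    have hN0 : N ≠ 0 := by omega
    have hN10 : N - 1 ≠ 0 := by have := h.hN; omega
    simp only [sub_self, zero_pow hN0, zero_pow hN10, zero_mul, sub_zero, add_zero] at this
    have h0 := abs_nonpos_iff.1 this
    have e : r ^ N = r ^ (N - 1) * r := by rw [← pow_succ]; congr 1; omega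
    rw [e] at h0
    have h2 : r ^ (N - 1) * (U1 r + r * J0 r) = 0 := by linarith
    rcases mul_eq_zero.1 h2 with h3 | h3
    · exact absurd h3 (by positivity)
    · linarith
  have hJpos : ∀ r, 0 ≤ r → 0 < J0 r := by
    intro r hr
    rcases hr.eq_or_lt with rfl | hr
    · simp only [hJ0, AvI, mul_zero, P.U0, Real.one_rpow, mul_one, integral_pow]
      rw [one_pow, zero_pow (Nat.succ_ne_zero _)]
      positivity
    · have h1 := hYJ r hr
      have h2 := P.neg1 r hr
      have h3 : 0 < r * J0 r := by linarith
      exact (mul_pos_iff_of_pos_left hr).1 h3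
  have dJ : ∀ r, 0 < r → HasDerivAt J0 ((U r ^ p - N * J0 r) / r) r := fun r hr => AvI_deriv N hN1 hUp hr
  set H : ℝ → ℝ := fun s => p * U s ^ p * b s * J0 s with hHd
  have hHc : Continuous H := by fun_prop
  set A1 : ℝ → ℝ := AvI (N + 1) H with hA1
  have hA1c : Continuous A1 := AvI_continuous (N + 1) hHc
  have dA1 : ∀ r, 0 < r → HasDerivAt A1 ((H r - (N + 1) * A1 r) / r) r := fun r hr => by
    have := AvI_deriv (N + 1) (by omega) hHc hr
    push_cast at this; exact this
  set φ : ℝ → ℝ := fun s => A1 |s| / J0 |s| ^ 2 with hφd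
  have hφc : Continuous φ := (hA1c.comp continuous_abs).div ((hJ0c.comp continuous_abs).pow 2)
    fun s => (pow_pos (hJpos _ (abs_nonneg s)) 2).ne'
  set Φ : ℝ → ℝ := fun r => ∫ s in (0:ℝ)..r, φ s with hΦd
  have dΦ : ∀ r, HasDerivAt Φ (φ r) r := fun r => (hφc.integral_hasStrictDerivAt 0 r).hasDerivAt
  have hφ : ∀ r, 0 < r → φ r = A1 r / J0 r ^ 2 := fun r hr => by simp only [hφd, abs_of_pos hr]
  have hΦc : Continuous Φ := continuous_iff_continuousAt.2 fun r => (dΦ r).continuousAt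
  have Abd : ∀ r, 0 < r → |A1 r| ≤ p / c * M * J0 r ^ 2 := by
    intro r hr
    have := cmp_deriv (f := fun s => s ^ (N + 1) * A1 s) (g := fun s => p / c * M * (s ^ (N + 1) * J0 s ^ 2))
      (by apply Continuous.continuousOn; fun_prop) (by apply Continuous.continuousOn; fun_prop)
      (fun s _ => AvI_hasDerivAt (N + 1) (by omega) hHc s)
      (fun s hs => (((dpow_nat (N + 1) hs).mul ((dJ s hs).pow 2)).const_mul (p / c * M)))
      (fun s hs => by
        have hj := hJpos s hs.le
        have hu := Real.rpow_pos_of_pos (P.pos s hs.le) p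
        have hPJ := P.J s hs.le
        rw [hYJ s hs] at hPJ
        have hPJ2 : J0 s * (N - 2 - β) ≤ U s ^ p := by
          have : s * (J0 s * (N - 2 - β)) ≤ s * U s ^ p := by linarith
          exact le_of_mul_le_mul_left this hs
        have k : c * U s ^ p ≤ 2 * U s ^ p - (N - 1) * J0 s := by
          have hd : 0 < (N:ℝ) - 2 - β := by linarith
          have e : (2 - c) * (N - 2 - β) = N - 1 := by linarith
          have h2c : 0 < 2 - c := by
            by_contra hcon
            push Not at hcon
            nlinarith
          have := mul_le_mul_of_nonneg_left hPJ2 h2c.le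
          have e2 : (2 - c) * (J0 s * (N - 2 - β)) = ((2 - c) * (N - 2 - β)) * J0 s := by ring
          rw [e2, e] at this
          linarith
        simp only [Nat.add_sub_cancel, hHd]
        rw [abs_mul, abs_of_pos (by positivity : 0 < s ^ N), abs_mul, abs_of_pos hj, abs_mul,
          abs_of_pos (by positivity : 0 < p * U s ^ p)]
        calc s ^ N * (p * U s ^ p * |b s| * J0 s) ≤ s ^ N * (p * U s ^ p * M * J0 s) := by
              gcongr; exact hM s
          _ = p / c * M * (s ^ N * J0 s * (c * U s ^ p)) := by field_simp
          _ ≤ p / c * M * (s ^ N * J0 s * (2 * U s ^ p - (N - 1) * J0 s)) := by gcongr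
          _ = _ := by
            simp only [Pi.pow_apply]
            push_cast
            rw [pow_succ]
            field_simp
            ring) hr.le
    simp only [zero_pow (Nat.succ_ne_zero N), zero_mul, mul_zero, sub_zero] at this
    rw [abs_mul, abs_of_pos (by positivity)] at this
    have h2 : r ^ (N + 1) * |A1 r| ≤ r ^ (N + 1) * (p / c * M * J0 r ^ 2) := by linarith
    exact le_of_mul_le_mul_left h2 (by positivity)
  have Φbd : ∀ r, 0 ≤ r → |Φ r| ≤ p / c * M * r := by
    intro r hr
    have := cmp_deriv (f := Φ) (g := fun s => p / c * M * s) hΦc.continuousOn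
      (continuousOn_const.mul continuousOn_id)
      (fun s _ => dΦ s) (fun s hs => (hasDerivAt_id s).const_mul _)
      (fun s hs => by
        have hj := hJpos s hs.le
        rw [hφ s hs, abs_div, abs_of_pos (by positivity : 0 < J0 s ^ 2), div_le_iff₀ (by positivity), mul_one]
        exact Abd s hs) hr
    have e0 : Φ 0 = 0 := by simp [hΦd]
    simpa [e0] using this
  have hqc : Continuous fun x : Euc N => b ‖x‖ * (x i / ‖x‖) := by
    rw [continuous_iff_continuousAt]
    intro x
    rcases eq_or_ne x 0 with rfl | hx
    · have ht : Tendsto (fun x : Euc N => |b ‖x‖|) (𝓝 0) (𝓝 0) := by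
        have := ((hb.comp continuous_norm).abs).tendsto (0 : Euc N)
        simpa [hb0] using this
      unfold ContinuousAt
      simp only [norm_zero, hb0, zero_mul]
      refine squeeze_zero_norm (fun x => ?_) ht
      rw [norm_mul, Real.norm_eq_abs]
      refine mul_le_of_le_one_right (abs_nonneg _) ?_
      rw [norm_div, norm_norm]
      exact div_le_one_of_le₀ (abs_coord_le x i) (norm_nonneg _)
    · have hci : ContinuousAt (fun x : Euc N => x i) x := by fun_prop
      exact ((hb.comp continuous_norm).continuousAt).mul
        (hci.div continuous_norm.continuousAt (norm_ne_zero_iff.2 hx))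
  refine (lin_of_pde h P (q := fun x => b ‖x‖ * (x i / ‖x‖)) (ψ := fun x => -(J0 ‖x‖ * Φ ‖x‖) * ⟪x, ee i⟫_ℝ) (M := M)
    (C := p / c * M * β) hqc ?_ (fun x => ?_) (fun x => ?_) (fun x hx => ?_)).imp
    fun f hf => ⟨hf.1.trans (le_of_eq (by ring)), hf.2⟩
  · have : Continuous fun x : Euc N => ⟪x, ee i⟫_ℝ := by fun_prop
    exact ((hJ0c.mul hΦc).comp continuous_norm).neg.mul this
  · rw [abs_mul]
    calc |b ‖x‖| * |x i / ‖x‖| ≤ M * 1 := by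
          refine mul_le_mul (hM _) ?_ (abs_nonneg _) hM0
          rw [abs_div, abs_norm]
          exact div_le_one_of_le₀ (abs_coord_le x i) (norm_nonneg _)
      _ = M := mul_one M
  · rcases eq_or_ne x 0 with rfl | hx
    · have := P.Upos (0 : Euc N)
      simp only [inner_zero_left, mul_zero, abs_zero]; positivity
    have hr := norm_pos_iff.2 hx
    have hj := hJpos _ hr.le
    rw [abs_mul, abs_neg, abs_mul, abs_of_pos hj, inner_ee]
    have hZ := P.Z _ hr.le
    have hY := hYJ _ hr
    calc J0 ‖x‖ * |Φ ‖x‖| * |x i| ≤ J0 ‖x‖ * (p / c * M * ‖x‖) * ‖x‖ := by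
          gcongr
          · exact Φbd _ hr.le
          · exact abs_coord_le x i
      _ = p / c * M * (‖x‖ * (‖x‖ * J0 ‖x‖)) := by ring
      _ ≤ p / c * M * (β * U ‖x‖) := by
          rw [← hY]
          exact mul_le_mul_of_nonneg_left (by linarith) (by positivity)
      _ = _ := by ring
  · have hr := norm_pos_iff.2 hx
    have hj := hJpos _ hr.le
    have d1 : ∀ r, 0 < r → HasDerivAt (fun r => -(J0 r * Φ r))
        (-((U r ^ p - N * J0 r) / r * Φ r + A1 r / J0 r)) r := by
      intro r hr
      refine ((dJ r hr).mul (dΦ r)).neg.congr_deriv ?_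
      have hz := hJpos r hr.le
      rw [hφ r hr]; field_simp
    have d2 := ((((((P.dUp p hr).sub ((dJ _ hr).const_mul (N:ℝ))).div (hasDerivAt_id ‖x‖) hr.ne').mul (dΦ ‖x‖)).add
      ((dA1 _ hr).div (dJ _ hr) hj.ne'))).neg
    have hHL := (HL_radial hx d1 d2).mul (HL_inner (ee i) x)
    refine ⟨_, _, hHL, ?_⟩
    have hs := sum_radial hx
    have hd : ∀ (d : ℝ), ∑ j, 2 * (d * (x j / ‖x‖) * (ee i : Euc N) j) = 2 * d * (x i / ‖x‖) := by
      intro d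
      rw [Finset.sum_eq_single i]
      · simp; ring
      · intro j _ hj; simp [hj]
      · simp
    simp only [Finset.sum_add_distrib, ← Finset.sum_mul, mul_zero, Finset.sum_const_zero, add_zero, hd] 
    simp only [← Finset.sum_add_distrib]
    rw [hs, hφ _ hr, inner_ee]
    simp only [Pi.mul_apply, Pi.sub_apply, Pi.div_apply, id]
    have eH : H ‖x‖ = p * U ‖x‖ ^ (p - 1) * U ‖x‖ * b ‖x‖ * J0 ‖x‖ := by
      simp only [hHd]; rw [P.Up1 hr.le]
      ring
    have eY : U1 ‖x‖ = -(‖x‖ * J0 ‖x‖) := by linarith [hYJ _ hr]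
    rw [eH, eY, P.Up1 hr.le]
    field_simp
    ring

end modes

section surj

theorem surj_of_approx {X : Type*} [NormedAddCommGroup X] [NormedSpace ℝ X] [CompleteSpace X]
    (S : X →L[ℝ] X) {C : ℝ} (hS : ∀ g, ∃ f, ‖f‖ ≤ C * ‖g‖ ∧ ‖g - S f‖ ≤ 1 / 2 * ‖g‖) :
    Function.Surjective S := by
  intro g
  choose φ h1 h2 using hS
  set r : X → X := fun g => g - S (φ g) with hr
  have hrn : ∀ n, ‖r^[n] g‖ ≤ (1 / 2) ^ n * ‖g‖ := by
    intro n
    induction n with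
    | zero => simp
    | succ n ih =>
      rw [Function.iterate_succ_apply', pow_succ]
      refine (h2 _).trans ?_
      linarith
  have hC : 0 ≤ C * ‖g‖ := (norm_nonneg _).trans (h1 g)
  have hs : Summable fun n => φ (r^[n] g) := by
    rcases eq_or_ne g 0 with rfl | hg
    · have hz : ∀ n, r^[n] (0 : X) = 0 := fun n => by
        have := hrn n
        simpa using this
      have : φ 0 = 0 := by simpa using h1 0
      simp only [hz, this]
      exact summable_zero
    have hC0 : 0 ≤ C := by
      have := norm_pos_iff.2 hg
      exact nonneg_of_mul_nonneg_left hC this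
    refine Summable.of_norm_bounded (g := fun n => C * ((1 / 2) ^ n * ‖g‖)) ?_ (fun n => ?_)
    · exact ((summable_geometric_of_lt_one (by norm_num) (by norm_num)).mul_right _).mul_left _
    · exact (h1 _).trans (mul_le_mul_of_nonneg_left (hrn n) hC0)
  refine ⟨∑' n, φ (r^[n] g), ?_⟩
  have hh := (hs.hasSum.mapL S).tendsto_sum_nat
  have hpart : ∀ n, ∑ k ∈ Finset.range n, S (φ (r^[k] g)) = g - r^[n] g := by
    intro n
    induction n with
    | zero => simp
    | succ n ih =>
      rw [Finset.sum_range_succ, ih, Function.iterate_succ_apply']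
      simp only [hr]; abel
  simp only [hpart] at hh
  have hz : Tendsto (fun n => r^[n] g) atTop (𝓝 0) := by
    refine squeeze_zero_norm hrn ?_
    have := (tendsto_pow_atTop_nhds_zero_of_lt_one (r := (1/2:ℝ)) (by norm_num) (by norm_num)).mul_const ‖g‖
    simpa using this
  have h3 : Tendsto (fun n => g - r^[n] g) atTop (𝓝 g) := by simpa using tendsto_const_nhds.sub hz
  exact tendsto_nhds_unique hh h3

variable {N : ℕ} {p β Λ : ℝ} {U U1 : ℝ → ℝ}

theorem iter_norm {X : Type*} [NormedAddCommGroup X] [NormedSpace ℝ X] (T : X →L[ℝ] X) (g : X) (n : ℕ) :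
    ‖T^[n] g‖ ≤ ‖T‖ ^ n * ‖g‖ := by
  induction n with
  | zero => simp
  | succ n ih =>
    rw [Function.iterate_succ_apply', pow_succ']
    refine (T.le_opNorm _).trans ?_
    rw [mul_assoc]
    exact mul_le_mul_of_nonneg_left ih (norm_nonneg _)

theorem one_sub_T_approx (h : Par N p β Λ) (P : Prof N p β Λ U U1) :
    ∃ C : ℝ, ∀ g : Euc N →ᵇ ℝ, ∃ f, ‖f‖ ≤ C * ‖g‖ ∧ ‖g - (f - TT h P f)‖ ≤ 1 / 2 * ‖g‖ := by
  obtain ⟨θ, C, hθ0, hθ1, hC, hd⟩ := oo_decay h P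
  obtain ⟨C1, hC1, hm1⟩ := mode1 h P
  obtain ⟨M, hM⟩ : ∃ M : ℕ, (2 * N + 1) * (C * θ ^ M) ≤ 1 / 2 := by
    have := (tendsto_pow_atTop_nhds_zero_of_lt_one hθ0 hθ1).const_mul ((2 * N + 1) * C)
    rw [mul_zero] at this
    obtain ⟨M, hM⟩ := (this.eventually (gt_mem_nhds (by norm_num : (0:ℝ) < 1 / 2))).exists
    exact ⟨M, by rw [← mul_assoc]; exact hM.le⟩
  set T := TT h P with hT
  refine ⟨∑ n ∈ Finset.range (M + 1), ‖T‖ ^ n + ((1 + p / (p - 1)) * ‖T‖ ^ (M + 1) + N * (C1 * ‖T‖ ^ (M + 1))),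
    fun g => ?_⟩
  set w := T^[M + 1] g with hw
  have hwn : ‖w‖ ≤ ‖T‖ ^ (M + 1) * ‖g‖ := iter_norm T g (M + 1)
  have i0 : Fin N := ⟨0, by have := h.hN; omega⟩
  have hwx : ∀ x, |w x| ≤ ‖w‖ := fun x => by simpa using w.norm_coe_le_norm x
  have hOB : OB (C * θ ^ M * ‖g‖) (w : Euc N → ℝ) := fun a b hab x => hd a b hab g M x
  have hHU := hyers_ulam h.N3 hOB hwx i0
  obtain ⟨f0, hf0, hf0e⟩ := mode0 h P (G := fun r => (w (r • ee i0) + w (-(r • ee i0))) / 2) (M := ‖w‖)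
    (by fun_prop) (fun r => by
      have h1 := abs_le.1 (hwx (r • ee i0))
      have h2 := abs_le.1 (hwx (-(r • ee i0)))
      rw [abs_le]; constructor <;> linarith)
  have hfi : ∀ i, ∃ f : Euc N →ᵇ ℝ, ‖f‖ ≤ C1 * ‖w‖ ∧
      ∀ x, f x - T f x = (w (‖x‖ • ee i) - w (-(‖x‖ • ee i))) / 2 * (x i / ‖x‖) := fun i =>
    hm1 i (fun r => (w (r • ee i) - w (-(r • ee i))) / 2) ‖w‖ (by fun_prop) (by simp) (fun r => by
      have h1 := abs_le.1 (hwx (r • ee i))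
      have h2 := abs_le.1 (hwx (-(r • ee i)))
      rw [abs_le]; constructor <;> linarith)
  choose fi hfi1 hfi2 using hfi
  refine ⟨∑ n ∈ Finset.range (M + 1), T^[n] g + (f0 + ∑ i, fi i), ?_, ?_⟩
  · have hp1 : 0 < p - 1 := by linarith [h.hp]
    have hp := h.ppos
    calc ‖∑ n ∈ Finset.range (M + 1), T^[n] g + (f0 + ∑ i, fi i)‖
        ≤ ∑ n ∈ Finset.range (M + 1), ‖T‖ ^ n * ‖g‖ + ((1 + p / (p - 1)) * ‖w‖ + ∑ i : Fin N, C1 * ‖w‖) := by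
          refine (norm_add_le _ _).trans (add_le_add ?_ ((norm_add_le _ _).trans (add_le_add hf0 ?_)))
          · exact norm_sum_le_of_le _ fun n _ => iter_norm T g n
          · exact norm_sum_le_of_le _ fun i _ => hfi1 i
      _ ≤ ∑ n ∈ Finset.range (M + 1), ‖T‖ ^ n * ‖g‖ + ((1 + p / (p - 1)) * (‖T‖ ^ (M + 1) * ‖g‖) +
          ∑ i : Fin N, C1 * (‖T‖ ^ (M + 1) * ‖g‖)) := by gcongr
      _ = _ := by
          rw [← Finset.sum_mul]
          simp only [Finset.sum_const, Finset.card_univ, Fintype.card_fin, nsmul_eq_mul]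
          ring
  · have hS : ∀ n, ∑ k ∈ Finset.range n, T^[k] g - T (∑ k ∈ Finset.range n, T^[k] g) = g - T^[n] g := by
      intro n
      induction n with
      | zero => simp
      | succ n ih =>
        rw [Finset.sum_range_succ, map_add, Function.iterate_succ_apply', add_sub_add_comm, ih]
        abel
    have e : g - (∑ n ∈ Finset.range (M + 1), T^[n] g + (f0 + ∑ i, fi i) -
        T (∑ n ∈ Finset.range (M + 1), T^[n] g + (f0 + ∑ i, fi i))) =
        w - ((f0 - T f0) + ∑ i, (fi i - T (fi i))) := by
      rw [map_add, add_sub_add_comm, hS, map_add, map_sum, Finset.sum_sub_distrib, ← hw]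
      abel
    rw [e, BoundedContinuousFunction.norm_le (by positivity)]
    intro x
    have h1 := hHU x
    have h2 := hf0e x
    have e2 : (w - ((f0 - T f0) + ∑ i, (fi i - T (fi i)))) x =
        w x - ((f0 x - T f0 x) + ∑ i, (fi i x - T (fi i) x)) := by
      simp
    rw [e2, Real.norm_eq_abs]
    simp only [hfi2]
    rw [← hT] at h2
    rw [h2]
    refine h1.trans ?_
    calc (2 * N + 1) * (C * θ ^ M * ‖g‖) = (2 * N + 1) * (C * θ ^ M) * ‖g‖ := by ring
      _ ≤ _ := by gcongr

theorem one_sub_T_surj (h : Par N p β Λ) (P : Prof N p β Λ U U1) :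
    Function.Surjective (ContinuousLinearMap.id ℝ (Euc N →ᵇ ℝ) - TT h P) := by
  obtain ⟨C, hC⟩ := one_sub_T_approx h P
  exact surj_of_approx _ (C := C) fun g => by
    obtain ⟨f, h1, h2⟩ := hC g
    exact ⟨f, h1, by simpa using h2⟩

end surj

section fixedpt

variable {N : ℕ} {p β Λ : ℝ} {U U1 : ℝ → ℝ}

theorem near_int (hN : 3 ≤ N) {ρ : ℝ} (hρ : 0 < ρ) :
    Integrable (fun z : Euc N => (Metric.ball 0 ρ).indicator (fun z : Euc N => ‖z‖ ^ (-((N:ℝ) - 1))) z) ∧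
    ∫ z : Euc N, (Metric.ball 0 ρ).indicator (fun z : Euc N => ‖z‖ ^ (-((N:ℝ) - 1))) z =
      N * volume.real (Metric.ball (0 : Euc N) 1) * ρ := by
  have : Nontrivial (Euc N) := Euc_nontrivial (by omega)
  constructor
  · have h1 : IntegrableOn (fun z : Euc N => ‖z‖ ^ (-((N:ℝ) - 1))) (Metric.ball 0 ρ) := by
      apply integrableOn_ball_of_norm_le_rpow (C := 1) (α := (N:ℝ) - 1) (by rw [finrank_Euc]; omega)
        (by rw [finrank_Euc]; linarith)
      · exact Eventually.of_forall fun z => by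
          rw [one_mul, Real.norm_eq_abs, abs_of_nonneg (by positivity)]
      · exact (by fun_prop : Measurable fun z : Euc N => ‖z‖ ^ (-((N:ℝ) - 1))).aestronglyMeasurable
    exact h1.integrable_indicator measurableSet_ball
  · have e : (fun z : Euc N => (Metric.ball 0 ρ).indicator (fun z : Euc N => ‖z‖ ^ (-((N:ℝ) - 1))) z) =
        fun z : Euc N => (fun r : ℝ => (Set.Iio ρ).indicator (fun r : ℝ => r ^ (-((N:ℝ) - 1))) r) ‖z‖ := by
      ext z
      simp [Set.indicator]
    rw [e, integral_fun_norm_addHaar, finrank_Euc]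
    have e2 : ∀ y ∈ Set.Ioi (0:ℝ), y ^ (N - 1) • (Set.Iio ρ).indicator (fun r : ℝ => r ^ (-((N:ℝ) - 1))) y =
        (Set.Iio ρ).indicator (fun _ => (1:ℝ)) y := by
      intro y hy
      by_cases hyρ : y ∈ Set.Iio ρ
      · rw [Set.indicator_of_mem hyρ, Set.indicator_of_mem hyρ, smul_eq_mul, ← Real.rpow_natCast,
          ← Real.rpow_add hy, Nat.cast_sub (by omega)]
        simp
      · rw [Set.indicator_of_notMem hyρ, Set.indicator_of_notMem hyρ, smul_zero]
    rw [setIntegral_congr_fun measurableSet_Ioi e2, setIntegral_indicator measurableSet_Iio]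
    simp [Set.Ioi_inter_Iio, hρ.le, mul_assoc]

theorem dker_pt (hN : 3 ≤ N) (hβ : 0 < β) (i : Fin N) (x z : Euc N) :
    |dGam N i z| * (1 + ‖x - z‖) ^ (-(β + 1)) ≤ ((N:ℝ) - 2) * (3 * (Gam N z * (1 + ‖x - z‖) ^ (-(β + 2))) +
      (3 / 4 * (1 + ‖x‖)) ^ (-(β + 1)) *
        (Metric.ball 0 ((1 + ‖x‖) / 2)).indicator (fun z : Euc N => ‖z‖ ^ (-((N:ℝ) - 1))) z) := by
  have hN' : (3:ℝ) ≤ N := by exact_mod_cast hN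
  have hN2 : (0:ℝ) ≤ (N:ℝ) - 2 := by linarith
  set t := ‖x - z‖ with ht
  have ht0 : 0 ≤ t := norm_nonneg _
  have hi : 0 ≤ (Metric.ball 0 ((1 + ‖x‖) / 2)).indicator (fun z : Euc N => ‖z‖ ^ (-((N:ℝ) - 1))) z :=
    Set.indicator_nonneg (fun z _ => by positivity) z
  have hg : 0 ≤ Gam N z := by unfold Gam; positivity
  refine (mul_le_mul_of_nonneg_right (dGam_le hN i z) (by positivity)).trans ?_
  rw [mul_assoc]
  refine mul_le_mul_of_nonneg_left ?_ hN2
  have htri : ‖x‖ ≤ t + ‖z‖ := by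
    have := norm_add_le (x - z) z
    simpa using this
  have htri2 : t ≤ ‖x‖ + ‖z‖ := norm_sub_le x z
  by_cases hz : (1 + t) / 3 ≤ ‖z‖
  · have hz0 : 0 < ‖z‖ := lt_of_lt_of_le (by positivity) hz
    have h1 : ‖z‖ ^ (-((N:ℝ) - 1)) * (1 + t) ^ (-(β + 1)) ≤ 3 * (Gam N z * (1 + t) ^ (-(β + 2))) := by
      unfold Gam
      rw [show -((N:ℝ) - 1) = -((N:ℝ) - 2) - 1 by ring, Real.rpow_sub_one hz0.ne',
        show -(β + 2) = -(β + 1) - 1 by ring, Real.rpow_sub_one (by positivity : (1 + t) ≠ 0)]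
      have : 1 / ‖z‖ ≤ 3 / (1 + t) := by
        rw [div_le_div_iff₀ hz0 (by positivity)]; linarith
      calc ‖z‖ ^ (-((N:ℝ) - 2)) / ‖z‖ * (1 + t) ^ (-(β + 1))
          = ‖z‖ ^ (-((N:ℝ) - 2)) * (1 + t) ^ (-(β + 1)) * (1 / ‖z‖) := by ring
        _ ≤ ‖z‖ ^ (-((N:ℝ) - 2)) * (1 + t) ^ (-(β + 1)) * (3 / (1 + t)) := by gcongr
        _ = _ := by ring
    have : 0 ≤ (3 / 4 * (1 + ‖x‖)) ^ (-(β + 1)) *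
        (Metric.ball 0 ((1 + ‖x‖) / 2)).indicator (fun z : Euc N => ‖z‖ ^ (-((N:ℝ) - 1))) z := by positivity
    linarith
  · push Not at hz
    have hm : z ∈ Metric.ball (0 : Euc N) ((1 + ‖x‖) / 2) := by
      rw [mem_ball_zero_iff]; linarith
    rw [Set.indicator_of_mem hm]
    have : (1 + t) ^ (-(β + 1)) ≤ (3 / 4 * (1 + ‖x‖)) ^ (-(β + 1)) :=
      Real.rpow_le_rpow_of_nonpos (by positivity) (by linarith) (by linarith)
    have h2 := mul_le_mul_of_nonneg_left this (by positivity : 0 ≤ ‖z‖ ^ (-((N:ℝ) - 1)))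
    have h3 : 0 ≤ 3 * (Gam N z * (1 + t) ^ (-(β + 2))) := by positivity
    linarith

theorem dker_bound (h : Par N p β Λ) (P : Prof N p β Λ U U1) : ∃ C, 0 ≤ C ∧
    ∀ (i : Fin N) (g : Euc N → ℝ) (D : ℝ), Continuous g → (∀ y, |g y| ≤ D * (1 + ‖y‖) ^ (-(β + 1))) →
      ∀ x, |cv (dGam N i) g x| ≤ C * D * U ‖x‖ := by
  have hN := h.N3
  have hN' : (3:ℝ) ≤ N := by exact_mod_cast hN
  have hβ := h.βpos
  have hp := h.ppos
  have hκ := kap_pos hN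
  obtain ⟨c, hc, hlow⟩ := P.low
  set V := (N:ℝ) * volume.real (Metric.ball (0 : Euc N) 1) with hV
  have hV0 : 0 ≤ V := by positivity
  have hN2 : (0:ℝ) ≤ (N:ℝ) - 2 := by linarith
  refine ⟨((N:ℝ) - 2) * (3 * (kap N * (c ^ p)⁻¹) + (3 / 4 : ℝ) ^ (-(β + 1)) * V / 2 * c⁻¹), by positivity,
    fun i g D hg hD x => ?_⟩
  have hD0 : 0 ≤ D := by simpa using (abs_nonneg _).trans (hD 0)
  obtain ⟨n1, n2⟩ := near_int hN (ρ := (1 + ‖x‖) / 2) (by positivity)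
  have hA := Adm.pow (N := N) (β + 2)
  have hAi := hA.int hN (by linarith) x
  have hUA : Adm (N := N) (β + 2) fun y => U ‖y‖ ^ p := by
    simpa using P.adm h (f := fun _ => 1) continuous_const (M := 1) (by simp)
  have hK : ∫ z, Gam N z * (1 + ‖x - z‖) ^ (-(β + 2)) ≤ kap N * (c ^ p)⁻¹ * U ‖x‖ := by
    have h1 := Kop_mono hN (by linarith) hA (hUA.const_mul (c ^ p)⁻¹) (fun y => by
      rw [le_inv_mul_iff₀ (by positivity)]
      have := Real.rpow_le_rpow (by positivity) (hlow ‖y‖ (norm_nonneg _)) hp.le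
      rw [Real.mul_rpow hc.le (by positivity), ← Real.rpow_mul (by positivity)] at this
      rw [← h.βp, ← neg_mul]
      exact this) x
    rw [Kop_const_mul, P.KU h] at h1
    unfold Kop cv at h1
    rw [inv_mul_le_iff₀ hκ] at h1
    linarith
  have hb : |cv (dGam N i) g x| ≤ ∫ z, D * (((N:ℝ) - 2) * (3 * (Gam N z * (1 + ‖x - z‖) ^ (-(β + 2))) +
      (3 / 4 * (1 + ‖x‖)) ^ (-(β + 1)) *
        (Metric.ball 0 ((1 + ‖x‖) / 2)).indicator (fun z : Euc N => ‖z‖ ^ (-((N:ℝ) - 1))) z)) := by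
    unfold cv
    rw [← Real.norm_eq_abs]
    refine norm_integral_le_of_norm_le ?_ (Eventually.of_forall fun z => ?_)
    · exact (((hAi.const_mul 3).add (n1.const_mul _)).const_mul _).const_mul _
    · rw [norm_mul, Real.norm_eq_abs, Real.norm_eq_abs]
      have := dker_pt hN hβ i x z
      calc |dGam N i z| * |g (x - z)| ≤ |dGam N i z| * (D * (1 + ‖x - z‖) ^ (-(β + 1))) := by
            gcongr; exact hD _
        _ = D * (|dGam N i z| * (1 + ‖x - z‖) ^ (-(β + 1))) := by ring
        _ ≤ _ := mul_le_mul_of_nonneg_left this hD0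
  rw [integral_const_mul, integral_const_mul, integral_add (hAi.const_mul 3) (n1.const_mul _),
    integral_const_mul, integral_const_mul, n2, ← hV] at hb
  refine hb.trans ?_
  have hU : (1 + ‖x‖) ^ (-β) ≤ c⁻¹ * U ‖x‖ := by
    rw [le_inv_mul_iff₀ hc]; exact hlow _ (norm_nonneg _)
  have e1 : (3 / 4 * (1 + ‖x‖)) ^ (-(β + 1)) * (V * ((1 + ‖x‖) / 2)) =
      (3 / 4 : ℝ) ^ (-(β + 1)) * V / 2 * (1 + ‖x‖) ^ (-β) := by
    rw [Real.mul_rpow (by norm_num) (by positivity), show -(β + 1) = -β - 1 by ring,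
      Real.rpow_sub_one (by positivity : (1 + ‖x‖) ≠ 0)]
    have : (1 + ‖x‖) ≠ 0 := by positivity
    field_simp
  rw [e1]
  calc D * (((N:ℝ) - 2) * (3 * (∫ z, Gam N z * (1 + ‖x - z‖) ^ (-(β + 2))) +
        (3 / 4 : ℝ) ^ (-(β + 1)) * V / 2 * (1 + ‖x‖) ^ (-β)))
      ≤ D * (((N:ℝ) - 2) * (3 * (kap N * (c ^ p)⁻¹ * U ‖x‖) +
        (3 / 4 : ℝ) ^ (-(β + 1)) * V / 2 * (c⁻¹ * U ‖x‖))) := by gcongr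
    _ = _ := by ring

/-- the drift operator -/
def Bop (a : Euc N → Euc N) (w : Euc N → ℝ) (x : Euc N) : ℝ :=
  (kap N)⁻¹ * ∑ i, cv (dGam N i) (fun y => a y i * w y) x

theorem drift_bd (h : Par N p β Λ) (P : Prof N p β Λ U U1) : ∃ C, 0 < C ∧ ∀ (a : Euc N → Euc N) (Cs : ℝ),
    (∀ x, ‖a x‖ ≤ Cs / (‖x‖ + 1)) → ∀ (v : Euc N → ℝ) (M : ℝ), (∀ x, |v x| ≤ M) →
      ∀ i y, |a y i * (U ‖y‖ * v y)| ≤ C * (Cs * M) * (1 + ‖y‖) ^ (-(β + 1)) := by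
  obtain ⟨c, hc, hup⟩ := P.up
  refine ⟨c, hc, fun a Cs ha v M hM i y => ?_⟩
  have hCs : 0 ≤ Cs := by simpa using (norm_nonneg _).trans (ha 0)
  have hM0 : 0 ≤ M := (abs_nonneg _).trans (hM 0)
  have hy : 0 < 1 + ‖y‖ := by positivity
  rw [abs_mul, abs_mul, abs_of_pos (P.Upos y)]
  have h1 : |a y i| ≤ Cs / (1 + ‖y‖) := by
    have := (abs_coord_le (a y) i).trans (ha y)
    rwa [add_comm] at this
  have hU0 := (P.Upos y).le
  calc |a y i| * (U ‖y‖ * |v y|) ≤ Cs / (1 + ‖y‖) * (c * (1 + ‖y‖) ^ (-β) * M) := by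
        gcongr
        · exact hup _ (norm_nonneg _)
        · exact hM y
    _ = _ := by
        rw [show -(β + 1) = -β - 1 by ring, Real.rpow_sub_one hy.ne']
        field_simp

theorem exists_B (h : Par N p β Λ) (P : Prof N p β Λ U U1) : ∃ C0, 0 < C0 ∧ ∀ (a : Euc N → Euc N) (Cs : ℝ),
    Continuous a → (∀ x, ‖a x‖ ≤ Cs / (‖x‖ + 1)) → ∃ B : (Euc N →ᵇ ℝ) →L[ℝ] (Euc N →ᵇ ℝ),
      (∀ v x, B v x = (U ‖x‖)⁻¹ * Bop a (fun y => U ‖y‖ * v y) x) ∧ ‖B‖ ≤ C0 * Cs := by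
  obtain ⟨C1, hC1, hd⟩ := dker_bound h P
  obtain ⟨C2, hC2, hdb⟩ := drift_bd h P
  have hN := h.N3
  have hκ := kap_pos hN
  have hβ := h.βpos
  refine ⟨(kap N)⁻¹ * (N * (C1 * C2)) + 1, by positivity, fun a Cs ha haC => ?_⟩
  have hCs : 0 ≤ Cs := by simpa using (norm_nonneg _).trans (haC 0)
  have hc : ∀ (v : Euc N →ᵇ ℝ) (i : Fin N), Continuous fun y => a y i * (U ‖y‖ * v y) := fun v i => by
    have c1 : Continuous fun y => a y i := by fun_prop
    exact c1.mul (P.Ucont.mul v.continuous)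
  have hK : ∀ (v : Euc N →ᵇ ℝ) (i : Fin N), KerHyp (dGam N i) (fun y => a y i * (U ‖y‖ * v y)) (N - 1) (β + 1)
      (N - 2) (C2 * (Cs * ‖v‖)) := fun v i =>
    KerHyp.dgam hN i (by linarith) (hc v i).measurable (hdb a Cs haC v ‖v‖ (bcf_bd v) i)
  have hcont : ∀ v : Euc N →ᵇ ℝ, Continuous fun x => (U ‖x‖)⁻¹ * Bop a (fun y => U ‖y‖ * v y) x := fun v => by
    refine (P.Ucont.inv₀ fun x => (P.Upos x).ne').mul (continuous_const.mul ?_)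
    exact continuous_finsetSum _ fun i _ => (hK v i).continuous (hc v i)
  have hbd : ∀ (v : Euc N →ᵇ ℝ) x, ‖(U ‖x‖)⁻¹ * Bop a (fun y => U ‖y‖ * v y) x‖ ≤
      ((kap N)⁻¹ * (N * (C1 * C2)) * Cs) * ‖v‖ := fun v x => by
    rw [Real.norm_eq_abs, abs_mul, abs_of_pos (inv_pos.2 (P.Upos x)), inv_mul_le_iff₀ (P.Upos x)]
    unfold Bop
    rw [abs_mul, abs_of_pos (inv_pos.2 hκ), inv_mul_le_iff₀ hκ]
    calc |∑ i, cv (dGam N i) (fun y => a y i * (U ‖y‖ * v y)) x|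
        ≤ ∑ i : Fin N, C1 * (C2 * (Cs * ‖v‖)) * U ‖x‖ := by
          refine (Finset.abs_sum_le_sum_abs _ _).trans (Finset.sum_le_sum fun i _ => ?_)
          exact hd i _ _ (hc v i) (hdb a Cs haC v ‖v‖ (bcf_bd v) i) x
      _ = _ := by
          simp only [Finset.sum_const, Finset.card_univ, Fintype.card_fin, nsmul_eq_mul]
          field_simp
  refine ⟨LinearMap.mkContinuous
    { toFun := fun v => BoundedContinuousFunction.ofNormedAddCommGroup _ (hcont v) _ (hbd v)
      map_add' := fun f g => by
        ext x
        simp only [BoundedContinuousFunction.coe_ofNormedAddCommGroup, BoundedContinuousFunction.coe_add, Pi.add_apply]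
        unfold Bop
        rw [← mul_add, ← mul_add, ← Finset.sum_add_distrib]
        refine congrArg _ (congrArg _ (Finset.sum_congr rfl fun i _ => ?_))
        unfold cv
        rw [← integral_add ((hK f i).integrable x) ((hK g i).integrable x)]
        congr 1; ext z; ring
      map_smul' := fun c f => by
        ext x
        simp only [BoundedContinuousFunction.coe_ofNormedAddCommGroup, BoundedContinuousFunction.coe_smul, smul_eq_mul,
          RingHom.id_apply]
        unfold Bop
        rw [mul_left_comm c, mul_left_comm c, Finset.mul_sum _ _ c]
        refine congrArg _ (congrArg _ (Finset.sum_congr rfl fun i _ => ?_))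
        unfold cv
        rw [← integral_const_mul]
        congr 1; ext z; ring } ((kap N)⁻¹ * (N * (C1 * C2)) * Cs) (fun f =>
      BoundedContinuousFunction.norm_ofNormedAddCommGroup_le _ (by positivity) (hbd f)), fun v x => rfl, ?_⟩
  refine (LinearMap.mkContinuous_norm_le _ (by positivity) _).trans ?_
  gcongr
  linarith

end fixedpt

section fixedpt2

variable {N : ℕ} {p β Λ : ℝ} {U U1 : ℝ → ℝ}

/-- truncated power -/
def tp (p t : ℝ) : ℝ := (max (1 / 2) (min t (3 / 2))) ^ p

theorem tp_cont (p : ℝ) : Continuous (tp p) := by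
  unfold tp
  refine Continuous.rpow_const (by fun_prop) fun t => Or.inl ?_
  have : (0:ℝ) < max (1 / 2) (min t (3 / 2)) := lt_of_lt_of_le (by norm_num) (le_max_left _ _)
  exact this.ne'

theorem tp_bd {p : ℝ} (hp : 0 < p) (t : ℝ) : ‖tp p t‖ ≤ 2 ^ p := by
  unfold tp
  have h0 : (0:ℝ) < max (1 / 2) (min t (3 / 2)) := lt_of_lt_of_le (by norm_num) (le_max_left _ _)
  rw [Real.norm_eq_abs, abs_of_pos (by positivity)]
  refine Real.rpow_le_rpow h0.le ?_ hp.le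
  exact max_le (by norm_num) ((min_le_right _ _).trans (by norm_num))

theorem tp_eq {p t : ℝ} (h1 : 1 / 2 ≤ t) (h2 : t ≤ 3 / 2) : tp p t = t ^ p := by
  unfold tp; rw [min_eq_left h2, max_eq_right h1]

theorem tp_approx {p : ℝ} (hp : 1 < p) {η : ℝ} (hη : 0 < η) : ∃ δ, 0 < δ ∧ δ ≤ 1 / 2 ∧
    ∀ s t, |s - 1| ≤ δ → |t - 1| ≤ δ → |tp p s - tp p t - p * (s - t)| ≤ η * |s - t| := by
  have hc : Tendsto (fun t : ℝ => p * t ^ (p - 1) - p) (𝓝 1) (𝓝 0) := by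
    have : ContinuousAt (fun t : ℝ => p * t ^ (p - 1) - p) 1 := by
      refine ContinuousAt.sub (continuousAt_const.mul ?_) continuousAt_const
      exact Real.continuousAt_rpow_const _ _ (Or.inl one_ne_zero)
    simpa [ContinuousAt] using this
  obtain ⟨δ, hδ, hb⟩ := Metric.tendsto_nhds_nhds.1 hc η hη
  refine ⟨min (δ / 2) (1 / 2), by positivity, min_le_right _ _, fun s t hs ht => ?_⟩
  have e1 : min (δ / 2) (1 / 2) ≤ δ / 2 := min_le_left _ _
  have e2 : min (δ / 2) (1 / 2) ≤ (1:ℝ) / 2 := min_le_right _ _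
  set m := min (δ / 2) (1 / 2) with hm
  have hs' := abs_le.1 hs
  have ht' := abs_le.1 ht
  rw [tp_eq (by linarith) (by linarith), tp_eq (by linarith) (by linarith)]
  have := (convex_Icc (1 - m) (1 + m)).norm_image_sub_le_of_norm_hasDerivWithin_le
    (f := fun x : ℝ => x ^ p - p * x) (f' := fun x => p * x ^ (p - 1) - p) (C := η)
    (fun z hz => by
      refine HasDerivAt.hasDerivWithinAt ?_
      refine ((Real.hasDerivAt_rpow_const (Or.inr hp.le)).sub ((hasDerivAt_id z).const_mul p)).congr_deriv ?_
      simp) (fun z hz => by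
      have := hb (x := z) (by
        rw [Real.dist_eq, abs_lt]
        constructor <;> linarith [hz.1, hz.2])
      rw [dist_zero_right] at this
      exact this.le) (x := t) (y := s) ⟨by linarith, by linarith⟩ ⟨by linarith, by linarith⟩
  rw [Real.norm_eq_abs, Real.norm_eq_abs] at this
  refine le_trans (le_of_eq ?_) this
  congr 1; ring

/-- superposition with the truncated power -/
def tpc (hp : 0 < p) (v : Euc N →ᵇ ℝ) : Euc N →ᵇ ℝ :=
  BoundedContinuousFunction.ofNormedAddCommGroup (fun x => tp p (v x)) ((tp_cont p).comp v.continuous) (2 ^ p)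
    fun x => tp_bd hp _

theorem exists_fixed (h : Par N p β Λ) (P : Prof N p β Λ U U1) {δ0 : ℝ} (hδ0 : 0 < δ0) :
    ∃ Cs, 0 < Cs ∧ ∀ a : Euc N → Euc N, Continuous a → (∀ x, ‖a x‖ ≤ Cs / (‖x‖ + 1)) →
      ∃ v : Euc N →ᵇ ℝ, (∀ x, |v x - 1| ≤ δ0) ∧ (∀ x, 1 / 2 ≤ v x) ∧
        ∀ x, U ‖x‖ * v x = Kop (fun y => (U ‖y‖ * v y) ^ p) x - Bop a (fun y => U ‖y‖ * v y) x := by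
  obtain ⟨C0, hC0, hB⟩ := exists_B h P
  have hp := h.ppos
  have hsurj : (ContinuousLinearMap.id ℝ (Euc N →ᵇ ℝ) - TT h P).range = ⊤ :=
    LinearMap.range_eq_top.2 (one_sub_T_surj h P)
  set Ri := ContinuousLinearMap.nonlinearRightInverseOfSurjective _ hsurj with hRi
  have hR : 0 < Ri.nnnorm := ContinuousLinearMap.nonlinearRightInverseOfSurjective_nnnorm_pos _ hsurj
  set l : ℝ := (Ri.nnnorm : ℝ)⁻¹ with hl
  have hl0 : 0 < l := by rw [hl]; exact inv_pos.2 (by exact_mod_cast hR)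
  obtain ⟨δ1, hδ1, hδ12, hap⟩ := tp_approx h.hp (η := l / 4) (by positivity)
  set δ := min δ0 δ1 with hδ
  have hδp : 0 < δ := lt_min hδ0 hδ1
  refine ⟨min (l / 4) (l / 2 * δ) / C0, by positivity, fun a ha haC => ?_⟩
  obtain ⟨B, hBa, hBn⟩ := hB a _ ha haC
  rw [mul_div_cancel₀ _ hC0.ne'] at hBn
  have hB1 : ‖B‖ ≤ l / 4 := hBn.trans (min_le_left _ _)
  have hB2 : ‖B‖ ≤ l / 2 * δ := hBn.trans (min_le_right _ _)
  set F : (Euc N →ᵇ ℝ) → (Euc N →ᵇ ℝ) := fun v => v - KK h P (tpc hp v) + B v with hF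
  set one : Euc N →ᵇ ℝ := BoundedContinuousFunction.const _ 1 with hone
  have hball : ∀ v ∈ Metric.closedBall one δ, ∀ x, |v x - 1| ≤ δ := fun v hv x => by
    have := (BoundedContinuousFunction.dist_coe_le_dist (f := v) (g := one) x).trans (Metric.mem_closedBall.1 hv)
    simpa [hone, Real.dist_eq] using this
  have hlin : ApproximatesLinearOn F (ContinuousLinearMap.id ℝ (Euc N →ᵇ ℝ) - TT h P)
      (Metric.closedBall one δ) ⟨l / 2, by positivity⟩ := by
    intro v hv w hw
    have e : F v - F w - (ContinuousLinearMap.id ℝ (Euc N →ᵇ ℝ) - TT h P) (v - w) =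
        -(KK h P (tpc hp v - tpc hp w - p • (v - w))) + B (v - w) := by
      have : TT h P (v - w) = KK h P (p • (v - w)) := by rw [map_smul]; rfl
      rw [sub_apply, ContinuousLinearMap.id_apply, this, map_sub (KK h P) (tpc hp v - tpc hp w),
        map_sub (KK h P) (tpc hp v), map_sub B]
      simp only [hF]
      abel
    rw [e]
    have h1 : ‖tpc hp v - tpc hp w - p • (v - w)‖ ≤ l / 4 * ‖v - w‖ := by
      rw [BoundedContinuousFunction.norm_le (by positivity)]
      intro x
      have := hap (v x) (w x) ((hball v hv x).trans (min_le_right _ _)) ((hball w hw x).trans (min_le_right _ _))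
      have h2 := bcf_bd (v - w) x
      exact this.trans (mul_le_mul_of_nonneg_left h2 (by positivity))
    calc ‖-(KK h P (tpc hp v - tpc hp w - p • (v - w))) + B (v - w)‖
        ≤ l / 4 * ‖v - w‖ + l / 4 * ‖v - w‖ := by
          refine (norm_add_le _ _).trans (add_le_add ?_ ?_)
          · rw [norm_neg]; exact (KK_le h P _).trans h1
          · exact (B.le_opNorm _).trans (mul_le_mul_of_nonneg_right hB1 (norm_nonneg _))
      _ = l / 2 * ‖v - w‖ := by ring
  have hso := hlin.surjOn_closedBall_of_nonlinearRightInverse Ri hδp.le (b := one) (le_refl _)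
  have hF1 : F one = B one := by
    have : KK h P (tpc hp one) = one := by
      ext x
      have e : ∀ y : Euc N, tpc hp one y = 1 := fun y => by
        show tp p 1 = 1
        rw [tp_eq (by norm_num) (by norm_num), Real.one_rpow]
      rw [KK_apply]
      simp only [e, mul_one, P.KU h]
      exact inv_mul_cancel₀ (P.Upos x).ne'
    simp only [hF, this, sub_self, zero_add]
  have hone1 : ‖one‖ ≤ 1 := by
    rw [BoundedContinuousFunction.norm_le zero_le_one]
    intro x; simp [hone]
  have hmem : (0 : Euc N →ᵇ ℝ) ∈ Metric.closedBall (F one) ((l - (⟨l / 2, by positivity⟩ : NNReal)) * δ) := by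
    rw [Metric.mem_closedBall, dist_zero_left, hF1]
    have := (B.le_opNorm one).trans (mul_le_mul hB2 hone1 (norm_nonneg _) (by positivity))
    refine this.trans (le_of_eq ?_)
    show _ = (l - l / 2) * δ
    ring
  obtain ⟨v, hv, hv0⟩ := hso hmem
  have hvb := hball v hv
  have hv1 : ∀ x, 1 / 2 ≤ v x ∧ v x ≤ 3 / 2 := fun x => by
    have h1 := abs_le.1 ((hvb x).trans (min_le_right _ _))
    constructor <;> linarith
  refine ⟨v, fun x => (hvb x).trans (min_le_left _ _), fun x => (hv1 x).1, fun x => ?_⟩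
  have h0 : v x - KK h P (tpc hp v) x + B v x = 0 := by
    have := congrArg (fun f : Euc N →ᵇ ℝ => f x) hv0
    simpa [hF] using this
  rw [KK_apply, hBa] at h0
  have e : (fun y => U ‖y‖ ^ p * tpc hp v y) = fun y => (U ‖y‖ * v y) ^ p := by
    ext y
    show U ‖y‖ ^ p * tp p (v y) = _
    rw [tp_eq (hv1 y).1 (hv1 y).2, Real.mul_rpow (P.Upos y).le (by linarith [(hv1 y).1])]
  rw [e] at h0
  have hU := (P.Upos x).ne'
  have : v x = (U ‖x‖)⁻¹ * (Kop (fun y => (U ‖y‖ * v y) ^ p) x - Bop a (fun y => U ‖y‖ * v y) x) := by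
    linarith
  rw [this, mul_inv_cancel_left₀ hU]

end fixedpt2

section dualsec
variable {N : ℕ}

theorem cs_radius {φ : Euc N → ℝ} (hs : HasCompactSupport φ) :
    ∃ R, 0 ≤ R ∧ ∀ x, φ x ≠ 0 → ‖x‖ ≤ R := by
  obtain ⟨R, hR⟩ := hs.isBounded.exists_norm_le
  exact ⟨max R 0, le_max_right _ _, fun x hx => (hR x (subset_tsupport _ hx)).trans (le_max_left _ _)⟩

theorem dual {k g φ : Euc N → ℝ} {s τ C D : ℝ} (h : KerHyp k g s τ C D) (hc : Continuous φ)
    (hs : HasCompactSupport φ) :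
    ∫ x, cv k g x * φ x = ∫ y, g y * cv (fun z => k (-z)) φ y := by
  obtain ⟨R, hR0, hR⟩ := cs_radius hs
  have hφi : Integrable φ := hc.integrable_of_hasCompactSupport hs
  have hm : Measurable fun q : Euc N × Euc N => k q.2 * g (q.1 - q.2) * φ q.1 :=
    ((h.km.comp measurable_snd).mul (h.gm.comp (measurable_fst.sub measurable_snd))).mul
      (hc.measurable.comp measurable_fst)
  have hC : Integrable fun q : Euc N × Euc N => k q.2 * g (q.1 - q.2) * φ q.1 := by
    have hd := (integrable_dom (N := N) h.hN h.s0 h.sN h.τ0 h.sτ).const_mul (C * D * (1 + R) ^ τ)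
    refine (hφi.norm.mul_prod hd).mono' hm.aestronglyMeasurable (Eventually.of_forall fun q => ?_)
    rw [norm_mul, mul_comm]
    by_cases hq : φ q.1 = 0
    · simp [hq]
    · exact mul_le_mul_of_nonneg_left (h.dom q.1 q.2 (hR _ hq)) (norm_nonneg _)
  have hS : MeasurePreserving (fun q : Euc N × Euc N => (q.1, q.1 - q.2))
      ((volume : Measure (Euc N)).prod volume) ((volume : Measure (Euc N)).prod volume) := by
    have h1 := measurePreserving_prod_sub (volume : Measure (Euc N)) (volume : Measure (Euc N))
    have h2 := (MeasurePreserving.id (volume : Measure (Euc N))).prod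
      (Measure.measurePreserving_neg (volume : Measure (Euc N)))
    have h3 := h2.comp h1
    convert h3 using 1
    ext q : 1
    simp
  have hI : Integrable (Function.uncurry fun x y : Euc N => k (x - y) * g y * φ x)
      ((volume : Measure (Euc N)).prod volume) := by
    have := hS.integrable_comp_of_integrable (g := fun q : Euc N × Euc N => k q.2 * g (q.1 - q.2) * φ q.1) hC
    refine this.congr (Eventually.of_forall fun q => ?_)
    simp [Function.uncurry]
  calc ∫ x, cv k g x * φ x = ∫ x, ∫ y, k (x - y) * g y * φ x := by
        refine integral_congr_ae (Eventually.of_forall fun x => ?_)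
        simp only [cv]
        rw [integral_mul_const, ← integral_sub_left_eq_self (fun z => k z * g (x - z)) volume x]
        simp
    _ = ∫ y, ∫ x, k (x - y) * g y * φ x := integral_integral_swap hI
    _ = _ := by
        refine integral_congr_ae (Eventually.of_forall fun y => ?_)
        simp only [cv]
        rw [← integral_const_mul, ← integral_sub_left_eq_self (fun x => k (x - y) * g y * φ x) volume y]
        refine integral_congr_ae (Eventually.of_forall fun z => ?_)
        simp only
        rw [show y - z - y = -z by abel]; ring

theorem Gam_neg (z : Euc N) : Gam N (-z) = Gam N z := by simp [Gam]
theorem dGam_neg (i : Fin N) (z : Euc N) : dGam N i (-z) = -dGam N i z := by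
  unfold dGam; simp

theorem dGam_locInt (hN : 3 ≤ N) (i : Fin N) : LocallyIntegrable (dGam N i) :=
  locInt_of_le (by omega) (by linarith) (dGam_meas i) (dGam_le hN i)

theorem dGam_lap (hN : 3 ≤ N) {ψ : Euc N → ℝ} (hψ : TF ψ) (i : Fin N) (x : Euc N) :
    cv (dGam N i) (lap ψ) x = -(kap N * fderiv ℝ ψ x (ee i)) := by
  rw [dnewton hN hψ.lap, ← cv_fderiv (Gam_locInt hN) hψ.lap]
  have : cv (Gam N) (lap ψ) = fun x => (-kap N) * ψ x := by
    funext y; rw [newton hN hψ]; ring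
  rw [this, fderiv_const_mul (hψ.sm.differentiable (by simp)).differentiableAt]
  simp

/-- weak form of `Δ w = -f + div g` -/
def WEq (w f : Euc N → ℝ) (g : Fin N → Euc N → ℝ) : Prop :=
  ∀ ψ : Euc N → ℝ, TF ψ → ∫ x, w x * lap ψ x = -(∫ x, f x * ψ x) - ∑ i, ∫ x, g i x * fderiv ℝ ψ x (ee i)

theorem weak_of_rep (hN : 3 ≤ N) {w f : Euc N → ℝ} {g : Fin N → Euc N → ℝ} {τ σ : ℝ} (hτ : 2 < τ) (hσ : 1 < σ)
    (hf : Adm τ f) (hg : ∀ i, Adm σ (g i))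
    (hw : ∀ x, w x = (kap N)⁻¹ * (cv (Gam N) f x - ∑ i, cv (dGam N i) (g i) x)) : WEq w f g := by
  intro ψ hψ
  have hk := (kap_pos hN).ne'
  obtain ⟨D, hD⟩ := hf.bd
  choose D' hD' using fun i => (hg i).bd
  have K := KerHyp.gam hN hτ hf.cont.measurable hD
  have K' := fun i => KerHyp.dgam hN i hσ (hg i).cont.measurable (hD' i)
  have i1 : Integrable fun x => cv (Gam N) f x * lap ψ x :=
    ((K.continuous hf.cont).mul hψ.lap.cont).integrable_of_hasCompactSupport hψ.lap.cs.mul_left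
  have i2 : ∀ i, Integrable fun x => cv (dGam N i) (g i) x * lap ψ x := fun i =>
    (((K' i).continuous (hg i).cont).mul hψ.lap.cont).integrable_of_hasCompactSupport hψ.lap.cs.mul_left
  have e0 : ∀ x, w x * lap ψ x = (kap N)⁻¹ * (cv (Gam N) f x * lap ψ x - ∑ i, cv (dGam N i) (g i) x * lap ψ x) := by
    intro x; rw [hw, ← Finset.sum_mul]; ring
  have e1 : ∫ x, cv (Gam N) f x * lap ψ x = -kap N * ∫ x, f x * ψ x := by
    rw [dual K hψ.lap.cont hψ.lap.cs, ← integral_const_mul]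
    refine integral_congr_ae (Eventually.of_forall fun y => ?_)
    simp only [Gam_neg]
    have := newton hN hψ y
    rw [show cv (fun z => Gam N z) (lap ψ) y = _ from this]; ring
  have e2 : ∀ i, ∫ x, cv (dGam N i) (g i) x * lap ψ x = kap N * ∫ x, g i x * fderiv ℝ ψ x (ee i) := by
    intro i
    rw [dual (K' i) hψ.lap.cont hψ.lap.cs, ← integral_const_mul]
    refine integral_congr_ae (Eventually.of_forall fun y => ?_)
    simp only [dGam_neg]
    have h1 : cv (fun z => -dGam N i z) (lap ψ) y = - cv (dGam N i) (lap ψ) y := by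
      unfold cv; simp only [neg_mul, integral_neg]
    rw [h1, dGam_lap hN hψ]; ring
  simp only [e0]
  rw [integral_const_mul, integral_sub i1 (integrable_finsetSum _ fun i _ => i2 i), integral_finsetSum _ fun i _ => i2 i,
    e1, Finset.sum_congr rfl fun i _ => e2 i, ← Finset.mul_sum]
  field_simp

theorem eq_of_test {f g : Euc N → ℝ} (hf : Continuous f) (hg : Continuous g)
    (h : ∀ φ, TF φ → ∫ x, f x * φ x = ∫ x, g x * φ x) : f = g := by
  have : f =ᵐ[volume] g := by
    apply ae_eq_of_integral_contDiff_smul_eq hf.locallyIntegrable hg.locallyIntegrable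
    intro φ hφ hc
    have := h φ ⟨hφ, hc⟩
    simpa only [smul_eq_mul, mul_comm] using this
  exact (hf.ae_eq_iff_eq volume hg).1 this

end dualsec

section locrep
variable {N : ℕ}

theorem TF.mul_smooth {φ ψ : Euc N → ℝ} (h : TF φ) (h' : ContDiff ℝ (⊤ : ℕ∞) ψ) :
    TF (fun x => φ x * ψ x) := ⟨h.sm.mul h', h.cs.mul_right⟩

theorem lap_mul {η v : Euc N → ℝ} (hη : ContDiff ℝ 2 η) (hv : ContDiff ℝ 2 v) (x : Euc N) :
    lap (fun y => η y * v y) x = lap η x * v x + 2 * ∑ i, fderiv ℝ η x (ee i) * fderiv ℝ v x (ee i)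
      + η x * lap v x := by
  rw [((HL_of_contDiff hη x).mul (HL_of_contDiff hv x)).lap_eq (hη.mul hv)]
  rw [Finset.sum_add_distrib, Finset.sum_add_distrib, ← Finset.mul_sum, ← Finset.sum_mul, ← Finset.mul_sum]
  rfl

theorem fderiv_mul_ee {η v : Euc N → ℝ} (hη : ContDiff ℝ 1 η) (hv : ContDiff ℝ 1 v) (x e : Euc N) :
    fderiv ℝ (fun y => η y * v y) x e = fderiv ℝ η x e * v x + η x * fderiv ℝ v x e := by
  have := fderiv_mul (hη.differentiable one_ne_zero x) (hv.differentiable one_ne_zero x)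
  change fderiv ℝ (η * v) x e = _
  rw [this]; simp; ring

theorem Kop_fderiv (hN : 3 ≤ N) {φ : Euc N → ℝ} (hφ : TF φ) (i : Fin N) (x : Euc N) :
    fderiv ℝ (Kop φ) x (ee i) = (kap N)⁻¹ * cv (dGam N i) φ x := by
  change fderiv ℝ (fun y => (kap N)⁻¹ * cv (Gam N) φ y) x (ee i) = _
  rw [fderiv_const_mul ((cv_smooth (Gam_locInt hN) hφ).differentiable (by simp)).differentiableAt,
    dnewton hN hφ, ← cv_fderiv (Gam_locInt hN) hφ]
  simp

set_option maxHeartbeats 1000000 in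
/-- localised representation -/
theorem WEq.rep (hN : 3 ≤ N) {w f : Euc N → ℝ} {g : Fin N → Euc N → ℝ} (h : WEq w f g)
    (hw : Continuous w) (hf : Continuous f) (hg : ∀ i, Continuous (g i)) {η : Euc N → ℝ} (hη : TF η) :
    (fun x => w x * η x) = fun x => (kap N)⁻¹ *
      (cv (Gam N) (fun y => w y * lap η y + f y * η y + ∑ i, g i y * fderiv ℝ η y (ee i)) x
        - ∑ i, cv (dGam N i) (fun y => 2 * (w y * fderiv ℝ η y (ee i)) + g i y * η y) x) := by
  set F : Euc N → ℝ := fun y => w y * lap η y + f y * η y + ∑ i, g i y * fderiv ℝ η y (ee i) with hF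
  set G : Fin N → Euc N → ℝ := fun i y => 2 * (w y * fderiv ℝ η y (ee i)) + g i y * η y with hG
  have ηi : ∀ i, TF fun y => fderiv ℝ η y (ee i) := fun i => hη.pd _
  have Fc : Continuous F := ((hw.mul hη.lap.cont).add (hf.mul hη.cont)).add
    (continuous_finsetSum _ fun i _ => (hg i).mul (ηi i).cont)
  have Gc : ∀ i, Continuous (G i) := fun i =>
    (continuous_const.mul (hw.mul (ηi i).cont)).add ((hg i).mul hη.cont)
  have Fs : HasCompactSupport F := by
    have h1 : HasCompactSupport fun y => ∑ i, g i y * fderiv ℝ η y (ee i) := by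
      refine HasCompactSupport.intro hη.cs.isCompact fun x hx => ?_
      refine Finset.sum_eq_zero fun i _ => ?_
      have : fderiv ℝ η x (ee i) = 0 := by
        have := image_eq_zero_of_notMem_tsupport (f := fun y => fderiv ℝ η y (ee i))
          (fun hh => hx (tsupport_fderiv_apply_subset ℝ _ hh))
        exact this
      rw [this, mul_zero]
    exact ((hη.lap.cs.mul_left (f := w)).add (hη.cs.mul_left (f := f))).add h1
  have Gs : ∀ i, HasCompactSupport (G i) := fun i =>
    (((ηi i).cs.mul_left (f := w)).mul_left (f := fun _ => (2:ℝ))).add (hη.cs.mul_left (f := g i))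
  obtain ⟨D, -, hD⟩ := cs_bound Fc Fs 3
  choose D' _ hD' using fun i => cs_bound (Gc i) (Gs i) 3
  have K := KerHyp.gam hN (by norm_num) Fc.measurable hD
  have K' := fun i => KerHyp.dgam hN i (by norm_num) (Gc i).measurable (hD' i)
  have c1 := K.continuous Fc
  have c2 := fun i => (K' i).continuous (Gc i)
  refine eq_of_test (hw.mul hη.cont) (continuous_const.mul (c1.sub (continuous_finsetSum _ fun i _ => c2 i))) ?_
  intro φ hφ
  have hKs := Kop_smooth hN hφ
  have hK1 : ContDiff ℝ 1 (Kop φ) := hKs.of_le (by simp)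
  have hη1 : ContDiff ℝ 1 η := hη.sm.of_le (by simp)
  have Kc : Continuous (Kop φ) := hKs.continuous
  have Kdc : ∀ i, Continuous fun x => fderiv ℝ (Kop φ) x (ee i) := fun i =>
    (hK1.continuous_fderiv one_ne_zero).clm_apply continuous_const
  have hψ : TF fun x => η x * Kop φ x := hη.mul_smooth hKs
  have hW := h _ hψ
  have ic : ∀ {q : Euc N → ℝ}, Continuous q → HasCompactSupport q → Integrable q := fun a b =>
    a.integrable_of_hasCompactSupport b
  have j1 : Integrable fun x => F x * Kop φ x := ic (Fc.mul Kc) Fs.mul_right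
  have j2 : ∀ i, Integrable fun x => G i x * fderiv ℝ (Kop φ) x (ee i) := fun i =>
    ic ((Gc i).mul (Kdc i)) (Gs i).mul_right
  have j3 : Integrable fun x => w x * lap (fun y => η y * Kop φ y) x :=
    ic (hw.mul hψ.lap.cont) hψ.lap.cs.mul_left
  have j4 : Integrable fun x => f x * (η x * Kop φ x) := ic (hf.mul hψ.cont) hψ.cs.mul_left
  have j5 : ∀ i, Integrable fun x => g i x * fderiv ℝ (fun y => η y * Kop φ y) x (ee i) := fun i =>
    ic ((hg i).mul (hψ.pd _).cont) (hψ.pd _).cs.mul_left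
  have main : ∫ x, w x * η x * φ x = (∫ x, F x * Kop φ x) + ∑ i, ∫ x, G i x * fderiv ℝ (Kop φ) x (ee i) := by
    have e : ∀ x, w x * η x * φ x = (F x * Kop φ x + ∑ i, G i x * fderiv ℝ (Kop φ) x (ee i))
        - (w x * lap (fun y => η y * Kop φ y) x + (f x * (η x * Kop φ x) +
          ∑ i, g i x * fderiv ℝ (fun y => η y * Kop φ y) x (ee i))) := by
      intro x
      have e1 := lap_mul (hη.sm.of_le two_le_sm) (hKs.of_le two_le_sm) x
      rw [e1, Kop_lap hN hφ, hF]
      simp only [fderiv_mul_ee hη1 hK1]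
      have e2 : ∑ i, G i x * fderiv ℝ (Kop φ) x (ee i) =
          2 * w x * (∑ i, fderiv ℝ η x (ee i) * fderiv ℝ (Kop φ) x (ee i)) +
            η x * ∑ i, g i x * fderiv ℝ (Kop φ) x (ee i) := by
        rw [Finset.mul_sum, Finset.mul_sum, ← Finset.sum_add_distrib]
        refine Finset.sum_congr rfl fun i _ => ?_
        rw [hG]; ring
      have e3 : ∑ i, g i x * (fderiv ℝ η x (ee i) * Kop φ x + η x * fderiv ℝ (Kop φ) x (ee i)) =
          (∑ i, g i x * fderiv ℝ η x (ee i)) * Kop φ x + η x * ∑ i, g i x * fderiv ℝ (Kop φ) x (ee i) := by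
        rw [Finset.sum_mul, Finset.mul_sum, ← Finset.sum_add_distrib]
        refine Finset.sum_congr rfl fun i _ => ?_
        ring
      rw [e2, e3]; ring
    simp only [e]
    have j6 : Integrable fun x => ∑ i, G i x * fderiv ℝ (Kop φ) x (ee i) := integrable_finsetSum _ fun i _ => j2 i
    have j7 : Integrable fun x => ∑ i, g i x * fderiv ℝ (fun y => η y * Kop φ y) x (ee i) :=
      integrable_finsetSum _ fun i _ => j5 i
    have j8 : Integrable fun x => F x * Kop φ x + ∑ i, G i x * fderiv ℝ (Kop φ) x (ee i) := j1.add j6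
    have j9 : Integrable fun x => f x * (η x * Kop φ x) +
          ∑ i, g i x * fderiv ℝ (fun y => η y * Kop φ y) x (ee i) := j4.add j7
    have j10 : Integrable fun x => w x * lap (fun y => η y * Kop φ y) x + (f x * (η x * Kop φ x) +
          ∑ i, g i x * fderiv ℝ (fun y => η y * Kop φ y) x (ee i)) := j3.add j9
    rw [integral_sub j8 j10, integral_add j1 j6, integral_add j3 j9, integral_add j4 j7,
      integral_finsetSum _ fun i _ => j2 i, integral_finsetSum _ fun i _ => j5 i, hW]
    ring
  have d1 : ∫ x, F x * Kop φ x = (kap N)⁻¹ * ∫ x, cv (Gam N) F x * φ x := by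
    rw [dual K hφ.cont hφ.cs, ← integral_const_mul]
    refine integral_congr_ae (Eventually.of_forall fun y => ?_)
    simp only [Gam_neg]
    unfold Kop; ring_nf
  have d2 : ∀ i, ∫ x, G i x * fderiv ℝ (Kop φ) x (ee i) = -((kap N)⁻¹ * ∫ x, cv (dGam N i) (G i) x * φ x) := by
    intro i
    rw [dual (K' i) hφ.cont hφ.cs, ← integral_const_mul, ← integral_neg]
    refine integral_congr_ae (Eventually.of_forall fun y => ?_)
    simp only [dGam_neg]
    have h1 : cv (fun z => -dGam N i z) φ y = - cv (dGam N i) φ y := by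
      unfold cv; simp only [neg_mul, integral_neg]
    rw [h1, Kop_fderiv hN hφ]; ring
  have i1 : Integrable fun x => cv (Gam N) F x * φ x := ic (c1.mul hφ.cont) hφ.cs.mul_left
  have i2 : ∀ i, Integrable fun x => cv (dGam N i) (G i) x * φ x := fun i =>
    ic ((c2 i).mul hφ.cont) hφ.cs.mul_left
  rw [main, d1, Finset.sum_congr rfl fun i _ => d2 i, Finset.sum_neg_distrib, ← Finset.mul_sum]
  have e0 : ∀ x, (kap N)⁻¹ * (cv (Gam N) F x - ∑ i, cv (dGam N i) (G i) x) * φ x =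
      (kap N)⁻¹ * (cv (Gam N) F x * φ x - ∑ i, cv (dGam N i) (G i) x * φ x) := by
    intro x; rw [← Finset.sum_mul]; ring
  rw [integral_congr_ae (Eventually.of_forall e0), integral_const_mul, integral_sub i1 (integrable_finsetSum _ fun i _ => i2 i), integral_finsetSum _ fun i _ => i2 i]
  ring

theorem WEq.pd {w f : Euc N → ℝ} {g : Fin N → Euc N → ℝ} (h : WEq w f g)
    (hw : ContDiff ℝ 1 w) (hf : ContDiff ℝ 1 f) (hg : ∀ i, ContDiff ℝ 1 (g i)) (v : Euc N) :
    WEq (fun x => fderiv ℝ w x v) (fun x => fderiv ℝ f x v) (fun i x => fderiv ℝ (g i) x v) := by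
  intro ψ hψ
  have sw : ∀ (φ : Euc N → ℝ), TF φ → ∀ x e e', fderiv ℝ (fun y => fderiv ℝ φ y e) x e' =
      fderiv ℝ (fun y => fderiv ℝ φ y e') x e := by
    intro φ hφ x e e'
    have hd : DifferentiableAt ℝ (fderiv ℝ φ) x :=
      ((hφ.sm.fderiv_right (m := (⊤ : ℕ∞)) (by simp)).differentiable (by simp)).differentiableAt
    rw [fderiv_clm_apply hd (differentiableAt_const _), fderiv_clm_apply hd (differentiableAt_const _)]
    have := (hφ.sm.contDiffAt (x := x)).isSymmSndFDerivAt (by simpa using two_le_sm)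
    have := this e' e
    simpa using this
  have hl : ∀ x, lap (fun y => fderiv ℝ ψ y v) x = fderiv ℝ (lap ψ) x v := by
    intro x
    have : lap ψ = fun y => ∑ i, fderiv ℝ (fun y => fderiv ℝ ψ y (ee i)) y (ee i) := rfl
    rw [this, fderiv_fun_sum fun i _ =>
      ((((hψ.pd (ee i)).pd (ee i)).sm.differentiable (by simp)).differentiableAt)]
    simp only [lap, sum_apply]
    refine Finset.sum_congr rfl fun i _ => ?_
    have e1 : (fun y => fderiv ℝ (fun y => fderiv ℝ ψ y v) y (EuclideanSpace.single i 1)) =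
      fun y => fderiv ℝ (fun y => fderiv ℝ ψ y (ee i)) y v := funext fun y => sw ψ hψ y _ _
    rw [e1, sw _ (hψ.pd (ee i))]
  have c1 : ∀ {q : Euc N → ℝ}, TF q → ContDiff ℝ 1 q := fun hq => hq.sm.of_le (by simp)
  have hW := h _ (hψ.pd v)
  have a1 := ibp1 hw (c1 hψ.lap) hψ.lap.cs v
  have a2 := ibp1 hf (c1 hψ) hψ.cs v
  have a3 := fun i => ibp1 (hg i) (c1 (hψ.pd (ee i))) (hψ.pd (ee i)).cs v
  simp only [hl] at hW
  rw [a1, a2] at hW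
  have a4 : ∑ i, ∫ x, g i x * fderiv ℝ (fun y => fderiv ℝ ψ y v) x (ee i) =
      - ∑ i, ∫ x, fderiv ℝ (g i) x v * fderiv ℝ ψ x (ee i) := by
    rw [← Finset.sum_neg_distrib]
    refine Finset.sum_congr rfl fun i _ => ?_
    rw [← a3 i]
    refine integral_congr_ae (Eventually.of_forall fun y => ?_)
    simp only [sw ψ hψ y v (ee i)]
  rw [a4] at hW
  linarith

end locrep

section kreg
variable {N : ℕ}

theorem clm_expand (T : Euc N →L[ℝ] ℝ) :
    T = ∑ i, T (ee i) • (EuclideanSpace.proj i : Euc N →L[ℝ] ℝ) := by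
  refine ContinuousLinearMap.ext fun v => ?_
  have hv : v = ∑ i, v i • ee i := by
    ext j
    simp [Finset.sum_apply, Pi.single_apply]
  conv_lhs => rw [hv]
  rw [map_sum]
  simp [sum_apply, mul_comm]

theorem clm_norm_le (T : Euc N →L[ℝ] ℝ) {M : ℝ} (h : ∀ i, |T (ee i)| ≤ M) :
    ‖T‖ ≤ M * ∑ i : Fin N, ‖(EuclideanSpace.proj i : Euc N →L[ℝ] ℝ)‖ := by
  rw [clm_expand T, Finset.mul_sum]
  refine (norm_sum_le _ _).trans (Finset.sum_le_sum fun i _ => ?_)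
  rw [norm_smul]
  exact mul_le_mul_of_nonneg_right (h i) (norm_nonneg _)

theorem c1_of_partials {f : Euc N → ℝ} (hd : Differentiable ℝ f)
    (hc : ∀ i, Continuous fun x => fderiv ℝ f x (ee i)) : ContDiff ℝ 1 f := by
  rw [contDiff_one_iff_fderiv]
  refine ⟨hd, ?_⟩
  have : fderiv ℝ f = fun x => ∑ i, fderiv ℝ f x (ee i) • (EuclideanSpace.proj i : Euc N →L[ℝ] ℝ) :=
    funext fun x => clm_expand _
  rw [this]
  exact continuous_finsetSum _ fun i _ => (hc i).smul continuous_const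

theorem c1_of_approx {φ : ℕ → Euc N → ℝ} {f : Euc N → ℝ} (h1 : ∀ n, ContDiff ℝ 1 (φ n))
    (h2 : ∀ x, Tendsto (fun n => φ n x) atTop (𝓝 (f x)))
    (h3 : ∀ R : ℝ, ∃ (G : Fin N → Euc N → ℝ) (e : ℕ → ℝ), Tendsto e atTop (𝓝 0) ∧
      ∀ i n x, ‖x‖ ≤ R → |fderiv ℝ (φ n) x (ee i) - G i x| ≤ e n) : ContDiff ℝ 1 f := by
  have key : ∀ R : ℝ, ∃ L : Euc N → Euc N →L[ℝ] ℝ,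
      TendstoUniformlyOn (fun n => fderiv ℝ (φ n)) L atTop (Metric.ball 0 R) := by
    intro R
    obtain ⟨G, e, he, hG⟩ := h3 R
    refine ⟨fun x => ∑ i, G i x • (EuclideanSpace.proj i : Euc N →L[ℝ] ℝ), ?_⟩
    rw [Metric.tendstoUniformlyOn_iff]
    intro ε hε
    have := he.mul_const (∑ i : Fin N, ‖(EuclideanSpace.proj i : Euc N →L[ℝ] ℝ)‖)
    rw [zero_mul] at this
    filter_upwards [this.eventually (gt_mem_nhds hε)] with n hn x hx
    rw [dist_comm, dist_eq_norm]
    refine lt_of_le_of_lt (clm_norm_le _ (M := e n) fun i => ?_) hn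
    have := hG i n x (by simpa using (Metric.mem_ball.1 hx).le)
    simpa [sum_apply, PiLp.single_apply, Pi.single_apply] using this
  have hD : ∀ R, ∀ L : Euc N → Euc N →L[ℝ] ℝ,
      TendstoUniformlyOn (fun n => fderiv ℝ (φ n)) L atTop (Metric.ball 0 R) →
      ∀ x ∈ Metric.ball (0 : Euc N) R, HasFDerivAt f (L x) x := by
    intro R L hL x hx
    exact hasFDerivAt_of_tendstoUniformlyOn Metric.isOpen_ball hL
      (fun n y _ => ((h1 n).differentiable one_ne_zero y).hasFDerivAt) (fun y _ => h2 y) hx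
  rw [contDiff_one_iff_fderiv]
  have hm : ∀ x : Euc N, x ∈ Metric.ball (0 : Euc N) (‖x‖ + 1) := fun x => by simp
  constructor
  · intro x
    obtain ⟨L, hL⟩ := key (‖x‖ + 1)
    exact (hD _ L hL x (hm x)).differentiableAt
  · rw [continuous_iff_continuousAt]
    intro x
    obtain ⟨L, hL⟩ := key (‖x‖ + 1)
    have hLc : ContinuousOn L (Metric.ball 0 (‖x‖ + 1)) :=
      hL.continuousOn (Frequently.of_forall fun n => ((h1 n).continuous_fderiv one_ne_zero).continuousOn)
    have hnb : Metric.ball (0 : Euc N) (‖x‖ + 1) ∈ 𝓝 x := Metric.isOpen_ball.mem_nhds (hm x)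
    refine (hLc.continuousAt hnb).congr ?_
    filter_upwards [hnb] with y hy
    exact (hD _ L hL y hy).fderiv.symm

theorem reg1 (hN : 1 ≤ N) {k F : Euc N → ℝ} (hk : ContDiff ℝ 1 k) {C1 : ℝ}
    (h1 : ∀ i z, |fderiv ℝ k z (ee i)| ≤ C1) (hF : Continuous F) (hs : HasCompactSupport F) :
    ContDiff ℝ 1 (cv k F) ∧ ∀ i x, fderiv ℝ (cv k F) x (ee i) = cv (fun z => fderiv ℝ k z (ee i)) F x := by
  have hFi : Integrable F := hF.integrable_of_hasCompactSupport hs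
  have eq : ∀ (q : Euc N → ℝ) x, cv q F x = ∫ y, q (x - y) * F y := by
    intro q x
    unfold cv
    rw [← integral_sub_left_eq_self (fun z => q z * F (x - z)) volume x]
    simp
  set M := C1 * ∑ i : Fin N, ‖(EuclideanSpace.proj i : Euc N →L[ℝ] ℝ)‖ with hM
  have kc : Continuous k := hk.continuous
  have dkc : Continuous (fderiv ℝ k) := hk.continuous_fderiv one_ne_zero
  have ii : ∀ x, Integrable fun y => k (x - y) * F y := fun x =>
    ((kc.comp (continuous_const.sub continuous_id)).mul hF).integrable_of_hasCompactSupport hs.mul_left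
  have ii' : ∀ x, Continuous fun y => F y • fderiv ℝ k (x - y) := fun x =>
    hF.smul (dkc.comp (continuous_const.sub continuous_id))
  have hd : ∀ x, HasFDerivAt (cv k F) (∫ y, F y • fderiv ℝ k (x - y)) x := by
    intro x
    have : cv k F = fun x => ∫ y, k (x - y) * F y := funext (eq k)
    rw [this]
    refine hasFDerivAt_integral_of_dominated_of_fderiv_le (s := Set.univ) (F' := fun x y => F y • fderiv ℝ k (x - y)) (bound := fun y => ‖F y‖ * M) univ_mem
      (Eventually.of_forall fun x => (ii x).aestronglyMeasurable) (ii x) (ii' x).aestronglyMeasurable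
      (Eventually.of_forall fun y x _ => ?_) (hFi.norm.mul_const _) (Eventually.of_forall fun y x _ => ?_)
    · rw [norm_smul]
      exact mul_le_mul_of_nonneg_left (clm_norm_le _ fun i => h1 i _) (norm_nonneg _)
    · have h := ((hk.differentiable one_ne_zero (x - y)).hasFDerivAt.comp x
        ((hasFDerivAt_id x).sub_const y)).mul_const (F y)
      have e : (fderiv ℝ k (x - y)).comp (ContinuousLinearMap.id ℝ (Euc N)) = fderiv ℝ k (x - y) := by ext; simp
      rw [e] at h
      exact h
  have hp : ∀ i x, fderiv ℝ (cv k F) x (ee i) = cv (fun z => fderiv ℝ k z (ee i)) F x := by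
    intro i x
    rw [(hd x).fderiv, eq, ContinuousLinearMap.integral_apply]
    · simp [mul_comm]
    · exact (ii' x).integrable_of_hasCompactSupport hs.smul_right
  refine ⟨c1_of_partials (fun x => (hd x).differentiableAt) fun i => ?_, hp⟩
  simp only [hp]
  obtain ⟨D, -, hD⟩ := cs_bound hF hs (N + 1)
  have K : KerHyp (fun z => fderiv ℝ k z (ee i)) F 0 (N + 1) C1 D :=
    ⟨hN, le_rfl, by exact_mod_cast hN, by positivity, by linarith, (dkc.clm_apply continuous_const).measurable,
      fun z => by simpa using h1 i z, hF.measurable, hD⟩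
  exact K.continuous hF

/-- error lemma -/
theorem ker_err (hN : 1 ≤ N) {K : ℕ → Euc N → ℝ} {K0 : Euc N → ℝ} {s t C : ℝ} (hs : t ≤ s) (hst : s - t < N)
    (hm : ∀ n, Measurable (K n)) (hm0 : Measurable K0)
    (hb : ∀ n z, z ≠ 0 → |K n z| ≤ C * ‖z‖ ^ (-s)) (hb0 : ∀ z, z ≠ 0 → |K0 z| ≤ C * ‖z‖ ^ (-s))
    (hl : ∀ z, z ≠ 0 → Tendsto (fun n => K n z) atTop (𝓝 (K0 z))) :
    ∃ e : ℕ → ℝ, Tendsto e atTop (𝓝 0) ∧ ∀ n (W : Euc N → ℝ) (A : ℝ), Measurable W →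
      (∀ z, |W z| ≤ A * (‖z‖ ^ t * (1 + ‖z‖) ^ (-((N:ℝ) + 1)))) →
      |(∫ z, K n z * W z) - ∫ z, K0 z * W z| ≤ A * e n := by
  set m : Euc N → ℝ := fun z => ‖z‖ ^ t * (1 + ‖z‖) ^ (-((N:ℝ) + 1)) with hmd
  have hmm : Measurable m := by rw [hmd]; fun_prop
  have hm0' : ∀ z, 0 ≤ m z := fun z => by rw [hmd]; positivity
  have hdom := (integrable_dom (N := N) hN (s := s - t) (τ := (N:ℝ) + 1) (by linarith) hst (by positivity)
    (by linarith))
  have hpt : ∀ z : Euc N, z ≠ 0 → ‖z‖ ^ (-s) * m z = ‖z‖ ^ (-(s - t)) * (1 + ‖z‖) ^ (-((N:ℝ) + 1)) := by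
    intro z hz
    rw [hmd]; simp only
    rw [← mul_assoc, ← Real.rpow_add (norm_pos_iff.2 hz)]
    congr 2; ring
  have hbm : ∀ (Q : Euc N → ℝ) (c : ℝ), (∀ z, z ≠ 0 → |Q z| ≤ c * ‖z‖ ^ (-s)) → ∀ z, z ≠ 0 →
      |Q z| * m z ≤ c * (‖z‖ ^ (-(s - t)) * (1 + ‖z‖) ^ (-((N:ℝ) + 1))) := by
    intro Q c hQ z hz
    rw [← hpt z hz, ← mul_assoc c]
    exact mul_le_mul_of_nonneg_right (hQ z hz) (hm0' z)
  have hIntg : ∀ (Q : Euc N → ℝ) (c : ℝ), Measurable Q → (∀ z, z ≠ 0 → |Q z| ≤ c * ‖z‖ ^ (-s)) →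
      ∀ (W : Euc N → ℝ) (A : ℝ), Measurable W → (∀ z, |W z| ≤ A * m z) → Integrable fun z => Q z * W z := by
    intro Q c hQ hQb W A hW hWb
    refine (hdom.const_mul (|A| * c)).mono' (hQ.mul hW).aestronglyMeasurable ?_
    filter_upwards [ae_ne0 hN] with z hz
    rw [norm_mul, Real.norm_eq_abs, Real.norm_eq_abs]
    calc |Q z| * |W z| ≤ |Q z| * (|A| * m z) := by
          refine mul_le_mul_of_nonneg_left ((hWb z).trans ?_) (abs_nonneg _)
          exact mul_le_mul_of_nonneg_right (le_abs_self _) (hm0' z)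
      _ = |A| * (|Q z| * m z) := by ring
      _ ≤ |A| * (c * (‖z‖ ^ (-(s - t)) * (1 + ‖z‖) ^ (-((N:ℝ) + 1)))) :=
          mul_le_mul_of_nonneg_left (hbm Q c hQb z hz) (abs_nonneg _)
      _ = _ := by ring
  have hdb : ∀ n z, z ≠ 0 → |K n z - K0 z| ≤ (2 * C) * ‖z‖ ^ (-s) := by
    intro n z hz
    have := abs_sub (K n z) (K0 z)
    have := hb n z hz; have := hb0 z hz
    linarith
  refine ⟨fun n => ∫ z, |K n z - K0 z| * m z, ?_, ?_⟩
  · have : (0:ℝ) = ∫ _ : Euc N, (0:ℝ) := by simp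
    rw [this]
    refine tendsto_integral_of_dominated_convergence
      (fun z => (2 * C) * (‖z‖ ^ (-(s - t)) * (1 + ‖z‖) ^ (-((N:ℝ) + 1))))
      (fun n => (((hm n).sub hm0).abs.mul hmm).aestronglyMeasurable) (hdom.const_mul _) ?_ ?_
    · intro n
      filter_upwards [ae_ne0 hN] with z hz
      rw [Real.norm_of_nonneg (mul_nonneg (abs_nonneg _) (hm0' z))]
      exact hbm (fun z => K n z - K0 z) _ (hdb n) z hz
    · filter_upwards [ae_ne0 hN] with z hz
      have h1 := (((hl z hz).sub_const (K0 z)).abs).mul_const (m z)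
      simpa using h1
  · intro n W A hW hWb
    rw [← integral_sub (hIntg _ _ (hm n) (hb n) W A hW hWb) (hIntg _ _ hm0 hb0 W A hW hWb), ← integral_const_mul,
      ← Real.norm_eq_abs]
    refine norm_integral_le_of_norm_le ?_ (Eventually.of_forall fun z => ?_)
    · have h1 := hIntg (fun z => |K n z - K0 z|) (2 * C) ((hm n).sub hm0).abs (fun z hz => by
        rw [abs_abs]; exact hdb n z hz) m 1 hmm (fun z => by rw [abs_of_nonneg (hm0' z), one_mul])
      exact h1.const_mul A
    · rw [← sub_mul, norm_mul, Real.norm_eq_abs, Real.norm_eq_abs]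
      calc |K n z - K0 z| * |W z| ≤ |K n z - K0 z| * (A * m z) :=
            mul_le_mul_of_nonneg_left (hWb z) (abs_nonneg _)
        _ = _ := by ring

end kreg

section kspec
variable {N : ℕ}

/-- second derivatives of the regularised kernel -/
def ddGamE (N : ℕ) (ε : ℝ) (i j : Fin N) (z : Euc N) : ℝ :=
  -((N:ℝ) - 2) * ((if i = j then 1 else 0) * (ε ^ 2 + ‖z‖ ^ 2) ^ (-((N:ℝ) / 2))
    - N * (z i * z j) * (ε ^ 2 + ‖z‖ ^ 2) ^ (-(((N:ℝ) + 2) / 2)))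

/-- second derivatives of the kernel -/
def ddGam (N : ℕ) (i j : Fin N) (z : Euc N) : ℝ :=
  -((N:ℝ) - 2) * ((if i = j then 1 else 0) * ‖z‖ ^ (-(N:ℝ))
    - N * (z i * z j) * ‖z‖ ^ (-((N:ℝ) + 2)))

theorem fderiv_dGamE {ε : ℝ} (hε : 0 < ε) (i j : Fin N) (z : Euc N) :
    fderiv ℝ (dGamE N ε i) z (ee j) = ddGamE N ε i j z := by
  have h1 := HL_inner (ee i) z
  have e : (fun y : Euc N => ⟪y, ee i⟫_ℝ) = fun y => y i := funext fun y => inner_ee y i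
  rw [e] at h1
  have h2 := (h1.mul (reg_HL (t := -((N:ℝ) / 2)) hε.ne' z)).const_mul (-((N:ℝ) - 2))
  have h3 : HL (dGamE N ε i) z _ _ := h2
  rw [h3.fderiv_eq (dGamE_contDiff hε i)]
  unfold ddGamE
  rw [show -(((N:ℝ) + 2) / 2) = -((N:ℝ) / 2) - 1 by ring]
  have : (ee i : Euc N) j = if i = j then 1 else 0 := by
    simp [PiLp.single_apply, eq_comm]
  rw [this]
  ring

theorem ddGamE_le (hN : 3 ≤ N) {ε : ℝ} (hε : 0 < ε) (i j : Fin N) (z : Euc N) :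
    |ddGamE N ε i j z| ≤ (N:ℝ) ^ 2 * (ε ^ 2 + ‖z‖ ^ 2) ^ (-((N:ℝ) / 2)) := by
  have hN' : (3:ℝ) ≤ N := by exact_mod_cast hN
  set q := ε ^ 2 + ‖z‖ ^ 2 with hq
  have hq0 : 0 < q := by positivity
  have e : q ^ (-(((N:ℝ) + 2) / 2)) = q ^ (-((N:ℝ) / 2)) / q := by
    rw [show -(((N:ℝ) + 2) / 2) = -((N:ℝ) / 2) - 1 by ring, Real.rpow_sub_one hq0.ne']
  unfold ddGamE
  rw [← hq, e, abs_mul, abs_neg, abs_of_nonneg (by linarith : (0:ℝ) ≤ N - 2)]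
  set Q := q ^ (-((N:ℝ) / 2)) with hQ
  have hQ0 : 0 ≤ Q := by positivity
  have h1 : |z i * z j| ≤ q := by
    rw [abs_mul]
    have := mul_le_mul (abs_coord_le z i) (abs_coord_le z j) (abs_nonneg _) (norm_nonneg _)
    nlinarith [sq_nonneg ε]
  have h2 : |(if i = j then (1:ℝ) else 0) * Q| ≤ Q := by
    split_ifs <;> simp [abs_of_nonneg hQ0, hQ0]
  have h3 : |(N:ℝ) * (z i * z j) * (Q / q)| ≤ N * Q := by
    rw [abs_mul, abs_mul, abs_of_nonneg (by positivity : 0 ≤ Q / q), abs_of_nonneg (by positivity : (0:ℝ) ≤ N)]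
    calc (N:ℝ) * |z i * z j| * (Q / q) ≤ N * q * (Q / q) := by gcongr
      _ = _ := by field_simp
  calc ((N:ℝ) - 2) * |(if i = j then (1:ℝ) else 0) * Q - N * (z i * z j) * (Q / q)|
      ≤ ((N:ℝ) - 2) * (Q + N * Q) := by
        refine mul_le_mul_of_nonneg_left ((abs_sub _ _).trans (add_le_add h2 h3)) (by linarith)
    _ ≤ (N:ℝ) ^ 2 * Q := by nlinarith

theorem ddGamE_tendsto (i j : Fin N) (z : Euc N) (hz : z ≠ 0) :
    Tendsto (fun ε => ddGamE N ε i j z) (𝓝 0) (𝓝 (ddGam N i j z)) :=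
  (((reg_tendsto (t := (N:ℝ)) z hz).const_mul _).sub
    ((reg_tendsto (t := (N:ℝ) + 2) z hz).const_mul _)).const_mul _

theorem ddGam_meas (i j : Fin N) : Measurable (ddGam N i j) := by
  unfold ddGam
  have h : ∀ i : Fin N, Measurable fun z : Euc N => z i := fun i => by fun_prop
  have h1 := h i
  have h2 := h j
  fun_prop

/-- the sequence of parameters -/
def eps (n : ℕ) : ℝ := 1 / ((n:ℝ) + 1)
theorem eps_pos (n : ℕ) : 0 < eps n := by unfold eps; positivity
theorem eps_tendsto : Tendsto eps atTop (𝓝 0) := tendsto_one_div_add_atTop_nhds_zero_nat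
theorem eps_tendsto' : Tendsto eps atTop (𝓝[>] 0) :=
  tendsto_nhdsWithin_iff.2 ⟨eps_tendsto, Eventually.of_forall fun n => eps_pos n⟩

theorem ddGamE_le2 (hN : 3 ≤ N) {ε : ℝ} (hε : 0 < ε) (i j : Fin N) (z : Euc N) (hz : z ≠ 0) :
    |ddGamE N ε i j z| ≤ (N:ℝ) ^ 2 * ‖z‖ ^ (-(N:ℝ)) :=
  (ddGamE_le hN hε i j z).trans (mul_le_mul_of_nonneg_left (reg_le (by positivity) z hz) (by positivity))

theorem ddGam_le (hN : 3 ≤ N) (i j : Fin N) (z : Euc N) (hz : z ≠ 0) :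
    |ddGam N i j z| ≤ (N:ℝ) ^ 2 * ‖z‖ ^ (-(N:ℝ)) :=
  le_of_tendsto ((ddGamE_tendsto i j z hz).comp eps_tendsto).abs
    (Eventually.of_forall fun n => ddGamE_le2 hN (eps_pos n) i j z hz)

theorem reg_glob {ε t : ℝ} (hε : 0 < ε) (ht : 0 ≤ t) (z : Euc N) :
    (ε ^ 2 + ‖z‖ ^ 2) ^ (-(t / 2)) ≤ ε ^ (-t) := by
  rw [← sq_rpow_half hε.le]
  apply Real.rpow_le_rpow_of_nonpos (by positivity) (by nlinarith [sq_nonneg ‖z‖]) (by linarith)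

theorem reg_half {ε : ℝ} (hN : 3 ≤ N) (hε : 0 < ε) (z : Euc N) (hz : z ≠ 0) :
    (ε ^ 2 + ‖z‖ ^ 2) ^ (-((N:ℝ) / 2)) ≤ ε ^ (-(1/2 : ℝ)) * ‖z‖ ^ (-((N:ℝ) - 1/2)) := by
  have hN' : (3:ℝ) ≤ N := by exact_mod_cast hN
  rw [show -((N:ℝ) / 2) = -((1/2 : ℝ) / 2) + -(((N:ℝ) - 1/2) / 2) by ring, Real.rpow_add (by positivity)]
  have h1 := reg_glob hε (by norm_num : (0:ℝ) ≤ 1/2) z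
  have h2 := reg_le (ε := ε) (by linarith : (0:ℝ) ≤ (N:ℝ) - 1/2) z hz
  exact mul_le_mul h1 h2 (by positivity) (by positivity)

theorem dGamE_glob (hN : 3 ≤ N) {ε : ℝ} (hε : 0 < ε) (i : Fin N) (z : Euc N) :
    |dGamE N ε i z| ≤ ((N:ℝ) - 2) * ε ^ (-((N:ℝ) - 1)) := by
  have hN' : (3:ℝ) ≤ N := by exact_mod_cast hN
  have h0 : 0 ≤ (N:ℝ) - 2 := by linarith
  unfold dGamE
  rw [abs_mul, abs_neg, abs_of_nonneg h0, abs_mul]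
  refine mul_le_mul_of_nonneg_left ?_ h0
  have hq : 0 < ε ^ 2 + ‖z‖ ^ 2 := by positivity
  have h1 : |z i| ≤ (ε ^ 2 + ‖z‖ ^ 2) ^ (1 / 2 : ℝ) := by
    refine (abs_coord_le z i).trans ?_
    rw [← Real.sqrt_eq_rpow]
    apply Real.le_sqrt_of_sq_le
    nlinarith [sq_nonneg ε]
  rw [abs_of_nonneg (by positivity : 0 ≤ (ε ^ 2 + ‖z‖ ^ 2) ^ (-((N:ℝ) / 2)))]
  calc |z i| * (ε ^ 2 + ‖z‖ ^ 2) ^ (-((N:ℝ) / 2))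
      ≤ (ε ^ 2 + ‖z‖ ^ 2) ^ (1 / 2 : ℝ) * (ε ^ 2 + ‖z‖ ^ 2) ^ (-((N:ℝ) / 2)) := by gcongr
    _ = (ε ^ 2 + ‖z‖ ^ 2) ^ (-(((N:ℝ) - 1) / 2)) := by
        rw [← Real.rpow_add hq]; congr 1; ring
    _ ≤ _ := reg_glob hε (by linarith) z

theorem dGamE_err (hN : 3 ≤ N) {ε : ℝ} (hε : 0 < ε) (i : Fin N) (z : Euc N) (hz : z ≠ 0) :
    |dGamE N ε i z - dGam N i z| ≤ (N:ℝ) ^ 2 * ε ^ (1/2 : ℝ) * ‖z‖ ^ (-((N:ℝ) - 1/2)) := by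
  have hN' : (3:ℝ) ≤ N := by exact_mod_cast hN
  have hn := norm_pos_iff.2 hz
  set x := ε / ‖z‖ with hx
  have hx0 : 0 < x := by positivity
  have e1 : (ε ^ 2 + ‖z‖ ^ 2) ^ (-((N:ℝ) / 2)) = ‖z‖ ^ (-(N:ℝ)) * (1 + x ^ 2) ^ (-((N:ℝ) / 2)) := by
    rw [← sq_rpow_half hn.le, ← Real.mul_rpow (by positivity) (by positivity)]
    congr 1
    rw [hx]; field_simp
    ring
  set y := (1 + x ^ 2) ^ (-((N:ℝ) / 2)) with hy
  have hy1 : y ≤ 1 := Real.rpow_le_one_of_one_le_of_nonpos (by nlinarith) (by linarith)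
  have hy0 : 0 ≤ y := by positivity
  have hy2 : 1 - N / 2 * x ^ 2 ≤ y := by
    have h1 : (1 + x ^ 2) ≤ Real.exp (x ^ 2) := by linarith [Real.add_one_le_exp (x ^ 2)]
    have h2 : Real.exp (x ^ 2) ^ (-((N:ℝ) / 2)) ≤ y :=
      Real.rpow_le_rpow_of_nonpos (by positivity) h1 (by linarith)
    rw [← Real.exp_mul] at h2
    linarith [Real.add_one_le_exp (x ^ 2 * -((N:ℝ) / 2))]
  have hy3 : 1 - y ≤ N * x ^ (1/2 : ℝ) := by
    rcases le_total 1 x with h | h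
    · have := Real.one_le_rpow h (by norm_num : (0:ℝ) ≤ 1/2)
      nlinarith
    · have : x ^ 2 ≤ x ^ (1/2 : ℝ) := by
        rw [← Real.rpow_natCast]
        exact Real.rpow_le_rpow_of_exponent_ge hx0 h (by norm_num)
      have := Real.rpow_nonneg hx0.le (1/2)
      nlinarith
  have e2 : dGamE N ε i z - dGam N i z = ((N:ℝ) - 2) * (z i * (‖z‖ ^ (-(N:ℝ)) * (1 - y))) := by
    unfold dGamE dGam; rw [e1]; ring
  rw [e2, abs_mul, abs_mul, abs_of_nonneg (by linarith : (0:ℝ) ≤ N - 2),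
    abs_of_nonneg (mul_nonneg (by positivity) (by linarith) : 0 ≤ ‖z‖ ^ (-(N:ℝ)) * (1 - y))]
  have hi := abs_coord_le z i
  have h0 : (0:ℝ) ≤ N - 2 := by linarith
  have h1y : 0 ≤ 1 - y := by linarith
  calc ((N:ℝ) - 2) * (|z i| * (‖z‖ ^ (-(N:ℝ)) * (1 - y)))
      ≤ (N:ℝ) * (‖z‖ * (‖z‖ ^ (-(N:ℝ)) * (N * x ^ (1/2 : ℝ)))) := by
        gcongr; linarith
    _ = (N:ℝ) ^ 2 * ε ^ (1/2 : ℝ) * (‖z‖ ^ (1:ℝ) * ‖z‖ ^ (-(N:ℝ)) * ‖z‖ ^ (-(1/2 : ℝ))) := by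
        rw [hx, Real.div_rpow hε.le hn.le, Real.rpow_neg hn.le (1/2), Real.rpow_one]; ring
    _ = _ := by
        rw [← Real.rpow_add hn, ← Real.rpow_add hn]
        congr 2; ring

end kspec

section kfin
variable {N : ℕ}

theorem c1_of_approx' {φ : ℕ → Euc N → ℝ} {f : Euc N → ℝ} (h1 : ∀ n, ContDiff ℝ 1 (φ n))
    (h2 : ∀ x, Tendsto (fun n => φ n x) atTop (𝓝 (f x)))
    (h3 : ∀ R : ℝ, ∀ i : Fin N, ∃ (G : Euc N → ℝ) (e : ℕ → ℝ), Tendsto e atTop (𝓝 0) ∧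
      ∀ n x, ‖x‖ ≤ R → |fderiv ℝ (φ n) x (ee i) - G x| ≤ e n) : ContDiff ℝ 1 f := by
  refine c1_of_approx h1 h2 fun R => ?_
  choose G e he hG using h3 R
  refine ⟨G, fun n => ∑ i, |e i n|, ?_, fun i n x hx => (hG i n x hx).trans ?_⟩
  · have := tendsto_finsetSum (Finset.univ : Finset (Fin N)) fun i _ => (he i).abs
    simpa using this
  · exact (le_abs_self _).trans (Finset.single_le_sum (f := fun i => |e i n|) (fun i _ => abs_nonneg _)
      (Finset.mem_univ i))

theorem dGamE_reg (hN : 3 ≤ N) {F : Euc N → ℝ} (hF : Continuous F) (hs : HasCompactSupport F) {ε : ℝ}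
    (hε : 0 < ε) (i : Fin N) :
    ContDiff ℝ 1 (cv (dGamE N ε i) F) ∧ ∀ j x, fderiv ℝ (cv (dGamE N ε i) F) x (ee j) =
      cv (ddGamE N ε i j) F x := by
  have h := reg1 (by omega) (dGamE_contDiff hε i) (C1 := (N:ℝ) ^ 2 * ε ^ (-(N:ℝ))) (fun j z => by
    rw [fderiv_dGamE hε]
    exact (ddGamE_le hN hε i j z).trans (mul_le_mul_of_nonneg_left (reg_glob hε (by positivity) z) (by positivity)))
    hF hs
  refine ⟨h.1, fun j x => ?_⟩
  rw [h.2 j x]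
  simp only [fderiv_dGamE hε]

theorem cvGam_c1 (hN : 3 ≤ N) {F : Euc N → ℝ} (hF : Continuous F) (hs : HasCompactSupport F) :
    ContDiff ℝ 1 (cv (Gam N) F) := by
  have hN' : (3:ℝ) ≤ N := by exact_mod_cast hN
  obtain ⟨D, hD0, hD⟩ := cs_bound hF hs (N + 1)
  have hreg := fun n => reg1 (by omega) (GamE_contDiff (N := N) (n := 1) (eps_pos n))
    (C1 := ((N:ℝ) - 2) * eps n ^ (-((N:ℝ) - 1)))
    (fun j z => by rw [fderiv_GamE (eps_pos n).ne']; exact dGamE_glob hN (eps_pos n) j z) hF hs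
  have K := KerHyp.gam hN (by linarith) hF.measurable hD
  refine c1_of_approx' (fun n => (hreg n).1) (fun x => ?_) fun R i => ?_
  · exact cv_tendsto K x (Eventually.of_forall fun n => (GamE_contDiff (n := 1) (eps_pos n)).continuous.measurable)
      (Eventually.of_forall fun n z hz => GamE_le hN z hz) (fun z hz => (GamE_tendsto z hz).comp eps_tendsto')
  · obtain ⟨e, he, hW⟩ := ker_err (N := N) (by omega) (K := fun n => dGamE N (eps n) i) (K0 := dGam N i)
      (s := (N:ℝ) - 1) (t := 0) (C := (N:ℝ) - 2) (by linarith) (by linarith)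
      (fun n => (dGamE_contDiff (n := 1) (eps_pos n) i).continuous.measurable) (dGam_meas i)
      (fun n z hz => dGamE_le hN i z hz) (fun z _ => dGam_le hN i z)
      (fun z hz => (dGamE_tendsto i z hz).comp eps_tendsto')
    refine ⟨cv (dGam N i) F, fun n => (D * (1 + R) ^ ((N:ℝ) + 1)) * e n, by simpa using he.const_mul _, ?_⟩
    intro n x hx
    rw [(hreg n).2 i x]
    simp only [fderiv_GamE (eps_pos n).ne']
    refine hW n (fun z => F (x - z)) _ (hF.comp (continuous_const.sub continuous_id)).measurable fun z => ?_
    rw [Real.rpow_zero, one_mul, mul_assoc]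
    exact (hD _).trans (mul_le_mul_of_nonneg_left (shift_bound (by positivity) x z hx) hD0)

theorem cvdGam_holder (hN : 3 ≤ N) {F : Euc N → ℝ} (hF : Continuous F) (hs : HasCompactSupport F) (i : Fin N)
    (R : ℝ) : ∃ C, 0 ≤ C ∧ ∀ x y, ‖x‖ ≤ R → ‖y‖ ≤ R →
      |cv (dGam N i) F x - cv (dGam N i) F y| ≤ C * ‖x - y‖ ^ (1/2 : ℝ) := by
  have hN' : (3:ℝ) ≤ N := by exact_mod_cast hN
  obtain ⟨D, hD0, hD⟩ := cs_bound hF hs (N + 1)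
  rcases lt_or_ge R 0 with hR | hR
  · exact ⟨0, le_rfl, fun x y hx _ => absurd (hx.trans_lt hR) (by simp)⟩
  set A := D * (1 + R) ^ ((N:ℝ) + 1) with hA
  have hA0 : 0 ≤ A := by positivity
  have hdom := integrable_dom (N := N) (by omega) (s := (N:ℝ) - 1/2) (τ := (N:ℝ) + 1) (by linarith) (by linarith)
    (by linarith) (by linarith)
  set I := ∫ z : Euc N, ‖z‖ ^ (-((N:ℝ) - 1/2)) * (1 + ‖z‖) ^ (-((N:ℝ) + 1)) with hI
  have hI0 : 0 ≤ I := integral_nonneg fun z => by positivity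
  have hFb : ∀ x z, ‖x‖ ≤ R → |F (x - z)| ≤ A * (1 + ‖z‖) ^ (-((N:ℝ) + 1)) := by
    intro x z hx
    rw [hA, mul_assoc]
    exact (hD _).trans (mul_le_mul_of_nonneg_left (shift_bound (by positivity) x z hx) hD0)
  have bnd : ∀ (Q : Euc N → ℝ) (c : ℝ), (∀ z, z ≠ 0 → |Q z| ≤ c * ‖z‖ ^ (-((N:ℝ) - 1/2))) → ∀ x, ‖x‖ ≤ R →
      |∫ z, Q z * F (x - z)| ≤ c * A * I := by
    intro Q c hQ x hx
    rw [← Real.norm_eq_abs, hI, ← integral_const_mul]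
    refine norm_integral_le_of_norm_le (hdom.const_mul _) ?_
    filter_upwards [ae_ne0 (by omega)] with z hz
    rw [norm_mul, Real.norm_eq_abs, Real.norm_eq_abs]
    have := mul_le_mul (hQ z hz) (hFb x z hx) (abs_nonneg _) ((abs_nonneg _).trans (hQ z hz))
    linarith
  have K := KerHyp.dgam hN i (by linarith) hF.measurable hD
  have err : ∀ ε, 0 < ε → ∀ x, ‖x‖ ≤ R → |cv (dGamE N ε i) F x - cv (dGam N i) F x| ≤
      (N:ℝ) ^ 2 * ε ^ (1/2 : ℝ) * A * I := by
    intro ε hε x hx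
    have KE : KerHyp (dGamE N ε i) F 0 (N + 1) (((N:ℝ) - 2) * ε ^ (-((N:ℝ) - 1))) D :=
      ⟨by omega, le_rfl, by linarith, by linarith, by linarith,
        (dGamE_contDiff (n := 1) hε i).continuous.measurable, fun z => by simpa using dGamE_glob hN hε i z,
        hF.measurable, hD⟩
    unfold cv
    rw [← integral_sub (KE.integrable x) (K.integrable x)]
    have := bnd (fun z => dGamE N ε i z - dGam N i z) _ (fun z hz => dGamE_err hN hε i z hz) x hx
    simpa only [sub_mul] using this
  set S := ∑ j : Fin N, ‖(EuclideanSpace.proj j : Euc N →L[ℝ] ℝ)‖ with hS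
  have hS0 : 0 ≤ S := Finset.sum_nonneg fun _ _ => norm_nonneg _
  refine ⟨2 * ((N:ℝ) ^ 2 * A * I) + (N:ℝ) ^ 2 * A * I * S, by positivity, fun x y hx hy => ?_⟩
  rcases eq_or_ne x y with rfl | hxy
  · simp
  have hε : 0 < ‖x - y‖ := norm_pos_iff.2 (sub_ne_zero.2 hxy)
  set ε := ‖x - y‖ with hεd
  have hreg := dGamE_reg hN hF hs hε i
  have hder : ∀ w ∈ Metric.closedBall (0 : Euc N) R, ‖fderiv ℝ (cv (dGamE N ε i) F) w‖ ≤
      ((N:ℝ) ^ 2 * ε ^ (-(1/2) : ℝ) * A * I) * S := by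
    intro w hw
    refine clm_norm_le _ fun j => ?_
    rw [hreg.2 j w]
    refine bnd (ddGamE N ε i j) _ (fun z hz => ?_) w (by simpa using hw)
    rw [mul_assoc]
    exact (ddGamE_le hN hε i j z).trans (mul_le_mul_of_nonneg_left (reg_half hN hε z hz) (by positivity))
  have hmvt := (convex_closedBall (0 : Euc N) R).norm_image_sub_le_of_norm_fderiv_le
    (fun w _ => hreg.1.differentiable one_ne_zero w) hder (x := y) (y := x) (by simpa using hy) (by simpa using hx)
  rw [Real.norm_eq_abs, ← hεd] at hmvt
  have e1 : ε ^ (-(1/2) : ℝ) * ε = ε ^ (1/2 : ℝ) := by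
    nth_rewrite 2 [← Real.rpow_one ε]
    rw [← Real.rpow_add hε]; norm_num
  have h1 := err ε hε x hx
  have h2 := err ε hε y hy
  have h3 : ((N:ℝ) ^ 2 * ε ^ (-(1/2) : ℝ) * A * I) * S * ε = (N:ℝ) ^ 2 * A * I * S * ε ^ (1/2 : ℝ) := by
    rw [← e1]; ring
  rw [h3] at hmvt
  rw [abs_le] at *
  constructor <;> nlinarith [h1.1, h1.2, h2.1, h2.2, hmvt.1, hmvt.2]

theorem exists_cutoff (R : ℝ) : ∃ ζ : Euc N → ℝ, TF ζ ∧ ∀ w, ‖w‖ ≤ R → ζ w = 1 := by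
  let bmp : ContDiffBump (0 : Euc N) := ⟨|R| + 1, |R| + 2, by positivity, by linarith⟩
  refine ⟨fun w => bmp w, ⟨bmp.contDiff, bmp.hasCompactSupport⟩, fun w hw => ?_⟩
  refine bmp.one_of_mem_closedBall ?_
  have := le_abs_self R
  simp only [bmp, Metric.mem_closedBall, dist_zero_right]
  linarith

theorem cvdGam_c1 (hN : 3 ≤ N) {F : Euc N → ℝ} (hF : Continuous F) (hs : HasCompactSupport F) {H : ℝ}
    (hH : ∀ x y, |F x - F y| ≤ H * ‖x - y‖ ^ (1/2 : ℝ)) (i : Fin N) : ContDiff ℝ 1 (cv (dGam N i) F) := by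
  have hN' : (3:ℝ) ≤ N := by exact_mod_cast hN
  obtain ⟨D, hD0, hD⟩ := cs_bound hF hs (N + 1)
  obtain ⟨M, hM⟩ := hs.exists_bound_of_continuous hF
  have hM0 : 0 ≤ M := (norm_nonneg _).trans (hM 0)
  have K := KerHyp.dgam hN i (by linarith) hF.measurable hD
  have hreg := fun n => dGamE_reg hN hF hs (eps_pos n) i
  refine c1_of_approx' (fun n => (hreg n).1) (fun x => ?_) fun R j => ?_
  · exact cv_tendsto K x (Eventually.of_forall fun n => (dGamE_contDiff (n := 1) (eps_pos n) i).continuous.measurable)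
      (Eventually.of_forall fun n z hz => dGamE_le hN i z hz) (fun z hz => (dGamE_tendsto i z hz).comp eps_tendsto')
  rcases lt_or_ge R 0 with hR | hR
  · exact ⟨0, 0, tendsto_const_nhds, fun n x hx => absurd (hx.trans_lt hR) (by simp)⟩
  obtain ⟨ζ, hζ, hζ1⟩ := exists_cutoff (N := N) (R + 1)
  obtain ⟨Dz, hDz0, hDz⟩ := cs_bound hζ.cont hζ.cs (N + 1)
  obtain ⟨Dd, hDd0, hDd⟩ := cs_bound (hζ.pd (ee j)).cont (hζ.pd (ee j)).cs (N + 1)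
  obtain ⟨e1, he1, hW1⟩ := ker_err (N := N) (by omega) (K := fun n => ddGamE N (eps n) i j) (K0 := ddGam N i j)
      (s := (N:ℝ)) (t := 1/2) (C := (N:ℝ) ^ 2) (by linarith) (by linarith)
      (fun n => by
        have : ddGamE N (eps n) i j = fun z => fderiv ℝ (dGamE N (eps n) i) z (ee j) :=
          funext fun z => (fderiv_dGamE (eps_pos n) i j z).symm
        rw [this]
        exact (((dGamE_contDiff (n := 1) (eps_pos n) i).continuous_fderiv one_ne_zero).clm_apply
          continuous_const).measurable) (ddGam_meas i j)
      (fun n z hz => ddGamE_le2 hN (eps_pos n) i j z hz) (fun z hz => ddGam_le hN i j z hz)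
      (fun z hz => (ddGamE_tendsto i j z hz).comp eps_tendsto)
  obtain ⟨e2, he2, hW2⟩ := ker_err (N := N) (by omega) (K := fun n => dGamE N (eps n) i) (K0 := dGam N i)
      (s := (N:ℝ) - 1) (t := 0) (C := (N:ℝ) - 2) (by linarith) (by linarith)
      (fun n => (dGamE_contDiff (n := 1) (eps_pos n) i).continuous.measurable) (dGam_meas i)
      (fun n z hz => dGamE_le hN i z hz) (fun z _ => dGam_le hN i z)
      (fun z hz => (dGamE_tendsto i z hz).comp eps_tendsto')
  set A1 := H * 2 ^ ((N:ℝ) + 1) + (D + M * Dz) * (1 + R) ^ ((N:ℝ) + 1) with hA1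
  set A2 := Dd * (1 + R) ^ ((N:ℝ) + 1) with hA2
  have hH0 : 0 ≤ H := by
    have h := (abs_nonneg _).trans (hH (ee i) 0)
    simpa using h
  refine ⟨fun x => (∫ z, ddGam N i j z * (F (x - z) - F x * ζ (x - z))) +
      F x * cv (dGam N i) (fun y => fderiv ℝ ζ y (ee j)) x, fun n => A1 * e1 n + M * |A2 * e2 n|, ?_, ?_⟩
  · have := (he1.const_mul A1).add (((he2.const_mul A2).abs).const_mul M)
    simpa using this
  intro n x hx
  have hε := eps_pos n
  have cx : Continuous fun z : Euc N => x - z := continuous_const.sub continuous_id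
  have KF : ∀ (g : Euc N → ℝ) D, Continuous g → (∀ y, |g y| ≤ D * (1 + ‖y‖) ^ (-((N:ℝ) + 1))) →
      Integrable fun z => ddGamE N (eps n) i j z * g (x - z) := by
    intro g D hg hgb
    have : ddGamE N (eps n) i j = fun z => fderiv ℝ (dGamE N (eps n) i) z (ee j) :=
          funext fun z => (fderiv_dGamE (eps_pos n) i j z).symm
    have KE : KerHyp (ddGamE N (eps n) i j) g 0 (N + 1) ((N:ℝ) ^ 2 * eps n ^ (-(N:ℝ))) D :=
      ⟨by omega, le_rfl, by linarith, by linarith, by linarith, by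
        rw [this]
        exact (((dGamE_contDiff (n := 1) (eps_pos n) i).continuous_fderiv one_ne_zero).clm_apply
          continuous_const).measurable, fun z => by
          simpa using (ddGamE_le hN hε i j z).trans (mul_le_mul_of_nonneg_left
            (reg_glob hε (by positivity) z) (by positivity)),
        hg.measurable, hgb⟩
    exact KE.integrable x
  have esplit : cv (ddGamE N (eps n) i j) F x =
      (∫ z, ddGamE N (eps n) i j z * (F (x - z) - F x * ζ (x - z))) +
        F x * cv (dGamE N (eps n) i) (fun y => fderiv ℝ ζ y (ee j)) x := by
    rw [cv_pd (dGamE_contDiff hε i) hζ]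
    simp only [fderiv_dGamE hε]
    unfold cv
    have i1 := KF F D hF hD
    have i2 := KF ζ Dz hζ.cont hDz
    rw [← integral_const_mul]
    have i3 : Integrable fun z => ddGamE N (eps n) i j z * (F (x - z) - F x * ζ (x - z)) := by
      refine (i1.sub (i2.const_mul (F x))).congr (Eventually.of_forall fun z => ?_)
      simp only [Pi.sub_apply]; ring
    rw [← integral_add i3 (i2.const_mul _)]
    refine integral_congr_ae (Eventually.of_forall fun z => ?_)
    simp only; ring
  rw [(hreg n).2 j x, esplit]
  have b1 := hW1 n (fun z => F (x - z) - F x * ζ (x - z)) A1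
    ((hF.comp cx).sub (continuous_const.mul (hζ.cont.comp cx))).measurable (fun z => by
      have sb := shift_bound (by positivity : (0:ℝ) ≤ (N:ℝ) + 1) x z hx
      have hz0 : (0:ℝ) ≤ (1 + ‖z‖) ^ (-((N:ℝ) + 1)) := by positivity
      rcases le_total ‖z‖ 1 with hz | hz
      · have : ζ (x - z) = 1 := hζ1 _ ((norm_sub_le _ _).trans (by linarith))
        rw [this, mul_one]
        have h1 := hH (x - z) x
        rw [show x - z - x = -z by abel, norm_neg] at h1
        have h2 : (1:ℝ) ≤ 2 ^ ((N:ℝ) + 1) * (1 + ‖z‖) ^ (-((N:ℝ) + 1)) := by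
          rw [Real.rpow_neg (by positivity), ← div_eq_mul_inv, one_le_div (by positivity)]
          gcongr
          linarith
        have h3 : 0 ≤ H * ‖z‖ ^ (1/2 : ℝ) := by positivity
        have h4 : 0 ≤ (D + M * Dz) * (1 + R) ^ ((N:ℝ) + 1) * (‖z‖ ^ (1/2 : ℝ) * (1 + ‖z‖) ^ (-((N:ℝ) + 1))) := by
          positivity
        calc |F (x - z) - F x| ≤ H * ‖z‖ ^ (1/2 : ℝ) * 1 := by linarith
          _ ≤ H * ‖z‖ ^ (1/2 : ℝ) * (2 ^ ((N:ℝ) + 1) * (1 + ‖z‖) ^ (-((N:ℝ) + 1))) :=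
              mul_le_mul_of_nonneg_left h2 h3
          _ ≤ _ := by rw [hA1]; nlinarith
      · have hz1 : (1:ℝ) ≤ ‖z‖ ^ (1/2 : ℝ) := Real.one_le_rpow hz (by norm_num)
        have h1 : |F (x - z)| ≤ D * ((1 + R) ^ ((N:ℝ) + 1) * (1 + ‖z‖) ^ (-((N:ℝ) + 1))) :=
          (hD _).trans (mul_le_mul_of_nonneg_left sb hD0)
        have h2 : |F x * ζ (x - z)| ≤ M * (Dz * ((1 + R) ^ ((N:ℝ) + 1) * (1 + ‖z‖) ^ (-((N:ℝ) + 1)))) := by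
          rw [abs_mul]
          exact mul_le_mul (hM x) ((hDz _).trans (mul_le_mul_of_nonneg_left sb hDz0)) (abs_nonneg _) hM0
        have h3 : 0 ≤ H * 2 ^ ((N:ℝ) + 1) * (‖z‖ ^ (1/2 : ℝ) * (1 + ‖z‖) ^ (-((N:ℝ) + 1))) := by positivity
        have h4 : 0 ≤ (D + M * Dz) * (1 + R) ^ ((N:ℝ) + 1) * (1 + ‖z‖) ^ (-((N:ℝ) + 1)) := by positivity
        calc |F (x - z) - F x * ζ (x - z)| ≤ |F (x - z)| + |F x * ζ (x - z)| := abs_sub _ _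
          _ ≤ (D + M * Dz) * (1 + R) ^ ((N:ℝ) + 1) * (1 + ‖z‖) ^ (-((N:ℝ) + 1)) * 1 := by linarith
          _ ≤ (D + M * Dz) * (1 + R) ^ ((N:ℝ) + 1) * (1 + ‖z‖) ^ (-((N:ℝ) + 1)) * ‖z‖ ^ (1/2 : ℝ) :=
              mul_le_mul_of_nonneg_left hz1 h4
          _ ≤ _ := by rw [hA1]; nlinarith)
  have b2 := hW2 n (fun z => fderiv ℝ ζ (x - z) (ee j)) A2 ((hζ.pd (ee j)).cont.comp cx).measurable (fun z => by
    rw [Real.rpow_zero, one_mul, hA2, mul_assoc]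
    exact (hDd _).trans (mul_le_mul_of_nonneg_left (shift_bound (by positivity) x z hx) hDd0))
  have b3 : |F x * cv (dGamE N (eps n) i) (fun y => fderiv ℝ ζ y (ee j)) x -
      F x * cv (dGam N i) (fun y => fderiv ℝ ζ y (ee j)) x| ≤ M * |A2 * e2 n| := by
    rw [← mul_sub, abs_mul]
    exact mul_le_mul (hM x) (b2.trans (le_abs_self _)) (abs_nonneg _) hM0
  have := abs_add_le ((∫ z, ddGamE N (eps n) i j z * (F (x - z) - F x * ζ (x - z))) -
    ∫ z, ddGam N i j z * (F (x - z) - F x * ζ (x - z)))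
    (F x * cv (dGamE N (eps n) i) (fun y => fderiv ℝ ζ y (ee j)) x -
      F x * cv (dGam N i) (fun y => fderiv ℝ ζ y (ee j)) x)
  refine le_trans (le_of_eq ?_) (this.trans (add_le_add b1 b3))
  congr 1; ring

end kfin

section boot
variable {N : ℕ}

/-- Local Hölder classes. -/
def HC : ℕ → (Euc N → ℝ) → Prop
  | 0, f => ∀ R : ℝ, ∃ C, 0 ≤ C ∧ ∀ x y, ‖x‖ ≤ R → ‖y‖ ≤ R → |f x - f y| ≤ C * ‖x - y‖ ^ (1/2 : ℝ)
  | n + 1, f => Differentiable ℝ f ∧ ∀ v, HC n (fun x => fderiv ℝ f x v)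

theorem HC.cont0 {f : Euc N → ℝ} (h : HC 0 f) : Continuous f := by
  rw [continuous_iff_continuousAt]
  intro x
  obtain ⟨C, hC0, hC⟩ := h (‖x‖ + 1)
  rw [ContinuousAt, tendsto_iff_dist_tendsto_zero]
  have hb : Tendsto (fun y => C * ‖y - x‖ ^ (1/2 : ℝ)) (𝓝 x) (𝓝 0) := by
    have : Continuous fun y : Euc N => C * ‖y - x‖ ^ (1/2 : ℝ) :=
      continuous_const.mul ((continuous_id.sub continuous_const).norm.rpow_const fun _ => Or.inr (by norm_num))
    have := this.tendsto x
    simpa using this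
  refine squeeze_zero' (Eventually.of_forall fun _ => dist_nonneg) ?_ hb
  filter_upwards [Metric.ball_mem_nhds x one_pos] with y hy
  rw [Real.dist_eq]
  refine hC y x ?_ (by linarith)
  have : ‖y - x‖ < 1 := by simpa [dist_eq_norm] using hy
  have := norm_le_norm_add_norm_sub' y x
  linarith

theorem HC.of_c1 {f : Euc N → ℝ} (h : ContDiff ℝ 1 f) : HC 0 f := by
  intro R
  obtain ⟨M, hM⟩ := (isCompact_closedBall (0 : Euc N) R).exists_bound_of_continuousOn
    (h.continuous_fderiv one_ne_zero).continuousOn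
  refine ⟨|M| * (2 * |R|) ^ (1/2 : ℝ), by positivity, fun x y hx hy => ?_⟩
  have hmvt := (convex_closedBall (0 : Euc N) R).norm_image_sub_le_of_norm_fderiv_le
    (fun w _ => h.differentiable one_ne_zero w) hM (x := y) (y := x) (by simpa using hy) (by simpa using hx)
  rw [Real.norm_eq_abs] at hmvt
  have e1 : ‖x - y‖ ≤ (2 * |R|) ^ (1/2 : ℝ) * ‖x - y‖ ^ (1/2 : ℝ) := by
    have hle : ‖x - y‖ ≤ 2 * |R| := (norm_sub_le _ _).trans (by linarith [le_abs_self R])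
    have : ‖x - y‖ = ‖x - y‖ ^ (1/2 : ℝ) * ‖x - y‖ ^ (1/2 : ℝ) := by
      rw [← Real.sqrt_eq_rpow, Real.mul_self_sqrt (norm_nonneg _)]
    calc ‖x - y‖ = ‖x - y‖ ^ (1/2 : ℝ) * ‖x - y‖ ^ (1/2 : ℝ) := this
      _ ≤ _ := by gcongr
  calc |f x - f y| ≤ M * ‖x - y‖ := hmvt
    _ ≤ |M| * ‖x - y‖ := by gcongr; exact le_abs_self M
    _ ≤ |M| * ((2 * |R|) ^ (1/2 : ℝ) * ‖x - y‖ ^ (1/2 : ℝ)) := by gcongr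
    _ = _ := by ring

theorem HC.c1 {f : Euc N → ℝ} (h : HC 1 f) : ContDiff ℝ 1 f :=
  c1_of_partials h.1 fun i => (h.2 (ee i)).cont0

theorem HC.pred {n : ℕ} : ∀ {f : Euc N → ℝ}, HC (n + 1) f → HC n f := by
  induction n with
  | zero => exact fun h => HC.of_c1 h.c1
  | succ n ih => exact fun h => ⟨h.1, fun v => ih (h.2 v)⟩

theorem HC.c1' {n : ℕ} {f : Euc N → ℝ} (h : HC (n + 1) f) : ContDiff ℝ 1 f := by
  induction n with
  | zero => exact h.c1
  | succ n ih => exact ih h.pred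

theorem HC.of_cd {n : ℕ} : ∀ {f : Euc N → ℝ}, ContDiff ℝ ((n : ℕ∞) + 1 : WithTop ℕ∞) f → HC n f := by
  induction n with
  | zero => exact fun h => HC.of_c1 (by simpa using h)
  | succ n ih =>
    intro f h
    rw [contDiff_succ_iff_fderiv_apply] at h
    refine ⟨h.1, fun v => ih ?_⟩
    simpa using h.2.2 v

theorem HC.add {n : ℕ} : ∀ {f g : Euc N → ℝ}, HC n f → HC n g → HC n (fun x => f x + g x) := by
  induction n with
  | zero =>
    intro f g hf hg R
    obtain ⟨C, hC, h1⟩ := hf R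
    obtain ⟨D, hD, h2⟩ := hg R
    refine ⟨C + D, by positivity, fun x y hx hy => ?_⟩
    have := abs_add_le (f x - f y) (g x - g y)
    rw [show f x + g x - (f y + g y) = f x - f y + (g x - g y) by ring]
    linarith [h1 x y hx hy, h2 x y hx hy]
  | succ n ih =>
    intro f g hf hg
    refine ⟨hf.1.add hg.1, fun v => ?_⟩
    have := ih (hf.2 v) (hg.2 v)
    convert this using 2 with x
    rw [fderiv_fun_add (hf.1 x) (hg.1 x)]; rfl

theorem HC.mul {n : ℕ} : ∀ {f g : Euc N → ℝ}, HC n f → HC n g → HC n (fun x => f x * g x) := by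
  induction n with
  | zero =>
    intro f g hf hg R
    obtain ⟨C, hC, h1⟩ := hf R
    obtain ⟨D, hD, h2⟩ := hg R
    obtain ⟨A, hA⟩ := (isCompact_closedBall (0 : Euc N) R).exists_bound_of_continuousOn hf.cont0.continuousOn
    obtain ⟨B, hB⟩ := (isCompact_closedBall (0 : Euc N) R).exists_bound_of_continuousOn hg.cont0.continuousOn
    refine ⟨|A| * D + |B| * C, by positivity, fun x y hx hy => ?_⟩
    rw [show f x * g x - f y * g y = f x * (g x - g y) + g y * (f x - f y) by ring]
    refine (abs_add_le _ _).trans ?_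
    rw [abs_mul, abs_mul, add_mul, mul_assoc, mul_assoc]
    refine add_le_add (mul_le_mul ?_ (h2 x y hx hy) (abs_nonneg _) (abs_nonneg _))
      (mul_le_mul ?_ (h1 x y hx hy) (abs_nonneg _) (abs_nonneg _))
    · exact (hA x (by simpa using hx)).trans (le_abs_self _)
    · exact (hB y (by simpa using hy)).trans (le_abs_self _)
  | succ n ih =>
    intro f g hf hg
    refine ⟨hf.1.mul hg.1, fun v => ?_⟩
    have := (ih (hf.2 v) hg.pred).add (ih hf.pred (hg.2 v))
    convert this using 2 with x
    exact fderiv_mul_ee hf.c1' hg.c1' x v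

theorem HC.const (c : ℝ) : HC 0 (fun _ : Euc N => c) := HC.of_c1 contDiff_const

theorem HC.sum0 {ι : Type*} (s : Finset ι) {φ : ι → Euc N → ℝ} (h : ∀ i, HC 0 (φ i)) :
    HC 0 (fun x => ∑ i ∈ s, φ i x) := by
  classical
  induction s using Finset.induction_on with
  | empty => simpa using HC.const (N := N) 0
  | insert a s ha ih => simpa [Finset.sum_insert ha] using (h a).add ih

theorem HC.glob {f : Euc N → ℝ} (h : HC 0 f) (hs : HasCompactSupport f) :
    ∃ H, ∀ x y, |f x - f y| ≤ H * ‖x - y‖ ^ (1/2 : ℝ) := by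
  obtain ⟨M, hM⟩ := hs.exists_bound_of_continuous h.cont0
  have hM0 : 0 ≤ M := (norm_nonneg _).trans (hM 0)
  obtain ⟨R, hR⟩ := hs.isCompact.isBounded.subset_closedBall (0 : Euc N)
  have hz : ∀ x, R < ‖x‖ → f x = 0 := by
    intro x hx
    by_contra h0
    have := hR (subset_tsupport f h0)
    simp at this
    linarith
  obtain ⟨C, hC0, hC⟩ := h (R + 1)
  have key : ∀ x y, ‖x‖ ≤ R → |f x - f y| ≤ (C + M) * ‖x - y‖ ^ (1/2 : ℝ) := by
    intro x y hx
    have h0 : 0 ≤ ‖x - y‖ ^ (1/2 : ℝ) := by positivity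
    rcases le_or_gt ‖y‖ (R + 1) with hy | hy
    · have := hC x y (by linarith) hy
      nlinarith
    · rw [hz y (by linarith), sub_zero]
      have h1 : (1:ℝ) ≤ ‖x - y‖ := by
        have := norm_sub_norm_le y x
        rw [norm_sub_rev] at this
        linarith
      have h2 : (1:ℝ) ≤ ‖x - y‖ ^ (1/2 : ℝ) := Real.one_le_rpow h1 (by norm_num)
      have h3 : |f x| ≤ M := hM x
      nlinarith
  refine ⟨C + M, fun x y => ?_⟩
  rcases le_or_gt ‖x‖ R with hx | hx
  · exact key x y hx
  rcases le_or_gt ‖y‖ R with hy | hy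
  · rw [abs_sub_comm, norm_sub_rev]; exact key y x hy
  · rw [hz x hx, hz y hy]; simp; positivity

theorem HC.of_local {f : Euc N → ℝ} (h : ∀ R : ℝ, ∃ g : Euc N → ℝ, HC 0 g ∧ ∀ x, ‖x‖ ≤ R → f x = g x) :
    HC 0 f := by
  intro R
  obtain ⟨g, hg, hfg⟩ := h R
  obtain ⟨C, hC, hC'⟩ := hg R
  refine ⟨C, hC, fun x y hx hy => ?_⟩
  rw [hfg x hx, hfg y hy]; exact hC' x y hx hy

theorem c1_of_local {f : Euc N → ℝ} (h : ∀ R : ℝ, ∃ g : Euc N → ℝ, ContDiff ℝ 1 g ∧ ∀ x, ‖x‖ ≤ R → f x = g x) :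
    ContDiff ℝ 1 f := by
  rw [contDiff_iff_contDiffAt]
  intro x
  obtain ⟨g, hg, hfg⟩ := h (‖x‖ + 1)
  refine hg.contDiffAt.congr_of_eventuallyEq ?_
  filter_upwards [Metric.ball_mem_nhds x one_pos] with y hy
  refine hfg y ?_
  have : ‖y - x‖ < 1 := by simpa [dist_eq_norm] using hy
  have := norm_le_norm_add_norm_sub' y x
  linarith

theorem TF.hc {φ : Euc N → ℝ} (h : TF φ) : HC 0 φ := HC.of_c1 (h.sm.of_le (by simp))

theorem rep_supp {w f : Euc N → ℝ} {g : Fin N → Euc N → ℝ} {η : Euc N → ℝ}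
    (hw : Continuous w) (hf : Continuous f) (hg : ∀ i, Continuous (g i)) (hη : TF η) :
    (Continuous (fun y => w y * lap η y + f y * η y + ∑ i, g i y * fderiv ℝ η y (ee i)) ∧
      HasCompactSupport (fun y => w y * lap η y + f y * η y + ∑ i, g i y * fderiv ℝ η y (ee i))) ∧
    ∀ i, Continuous (fun y => 2 * (w y * fderiv ℝ η y (ee i)) + g i y * η y) ∧
      HasCompactSupport (fun y => 2 * (w y * fderiv ℝ η y (ee i)) + g i y * η y) := by
  have cs : ∀ (u φ : Euc N → ℝ), TF φ → HasCompactSupport (fun y => u y * φ y) :=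
    fun u φ h => HasCompactSupport.mul_left (f := u) h.cs
  refine ⟨⟨((hw.mul hη.lap.cont).add (hf.mul hη.cont)).add
    (continuous_finsetSum _ fun i _ => (hg i).mul (hη.pd _).cont), ?_⟩, fun i => ⟨?_, ?_⟩⟩
  · refine ((cs w _ hη.lap).add (cs f _ hη)).add ?_
    have : ∀ s : Finset (Fin N), HasCompactSupport (fun y => ∑ i ∈ s, g i y * fderiv ℝ η y (ee i)) := by
      intro s
      classical
      induction s using Finset.induction_on with
      | empty => simp only [Finset.sum_empty]; exact HasCompactSupport.zero
      | insert a s ha ih =>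
        simp only [Finset.sum_insert ha]
        exact (cs (g a) _ (hη.pd (ee a))).add ih
    exact this _
  · exact (continuous_const.mul (hw.mul (hη.pd _).cont)).add ((hg i).mul hη.cont)
  · refine HasCompactSupport.add ?_ (cs (g i) _ hη)
    exact HasCompactSupport.mul_left (f := fun _ => (2:ℝ)) (cs w _ (hη.pd (ee i)))

theorem regH0 (hN : 3 ≤ N) {w f : Euc N → ℝ} {g : Fin N → Euc N → ℝ} (h : WEq w f g)
    (hw : Continuous w) (hf : Continuous f) (hg : ∀ i, Continuous (g i)) : HC 0 w := by
  refine HC.of_local fun R => ?_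
  obtain ⟨η, hη, h1⟩ := exists_cutoff (N := N) R
  have hr := h.rep hN hw hf hg hη
  obtain ⟨⟨a1, a2⟩, a3⟩ := rep_supp hw hf hg hη
  refine ⟨fun x => w x * η x, ?_, fun x hx => by simp only [h1 x hx, mul_one]⟩
  rw [hr]
  refine (HC.const _).mul ?_
  simp only [sub_eq_add_neg, neg_eq_neg_one_mul (∑ _, _)]
  refine (HC.of_c1 (cvGam_c1 hN a1 a2)).add ((HC.const _).mul (HC.sum0 _ fun i => ?_))
  exact fun R => cvdGam_holder hN (a3 i).1 (a3 i).2 i R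

theorem regC0 (hN : 3 ≤ N) {w f : Euc N → ℝ} {g : Fin N → Euc N → ℝ} (h : WEq w f g)
    (hw : HC 0 w) (hf : Continuous f) (hg : ∀ i, HC 0 (g i)) : ContDiff ℝ 1 w := by
  refine c1_of_local fun R => ?_
  obtain ⟨η, hη, h1⟩ := exists_cutoff (N := N) R
  have hr := h.rep hN hw.cont0 hf (fun i => (hg i).cont0) hη
  obtain ⟨⟨a1, a2⟩, a3⟩ := rep_supp hw.cont0 hf (fun i => (hg i).cont0) hη
  refine ⟨fun x => w x * η x, ?_, fun x hx => by simp only [h1 x hx, mul_one]⟩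
  rw [hr]
  refine contDiff_const.mul ((cvGam_c1 hN a1 a2).sub (ContDiff.sum fun i _ => ?_))
  obtain ⟨H, hH⟩ := (((HC.const 2).mul (hw.mul (hη.pd (ee i)).hc)).add ((hg i).mul hη.hc)).glob (a3 i).2
  exact cvdGam_c1 hN (a3 i).1 (a3 i).2 hH i

theorem cd_pd {n : ℕ} {f : Euc N → ℝ} (h : ContDiff ℝ (((n + 1 : ℕ) : ℕ∞) : WithTop ℕ∞) f) :
    ContDiff ℝ 1 f ∧ ∀ v, ContDiff ℝ ((n : ℕ∞) : WithTop ℕ∞) (fun x => fderiv ℝ f x v) := by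
  refine ⟨h.of_le (by exact_mod_cast Nat.le_add_left 1 n), fun v => ?_⟩
  have h' : ContDiff ℝ (((n : ℕ∞) : WithTop ℕ∞) + 1) f := by simpa using h
  rw [contDiff_succ_iff_fderiv_apply] at h'
  exact h'.2.2 v

theorem regH (hN : 3 ≤ N) {n : ℕ} : ∀ {w f : Euc N → ℝ} {g : Fin N → Euc N → ℝ}, WEq w f g →
    ContDiff ℝ ((n : ℕ∞) : WithTop ℕ∞) w → ContDiff ℝ ((n : ℕ∞) : WithTop ℕ∞) f →
    (∀ i, ContDiff ℝ ((n : ℕ∞) : WithTop ℕ∞) (g i)) → HC n w := by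
  induction n with
  | zero => exact fun h hw hf hg => regH0 hN h hw.continuous hf.continuous fun i => (hg i).continuous
  | succ n ih =>
    intro w f g h hw hf hg
    refine ⟨(cd_pd hw).1.differentiable one_ne_zero, fun v => ?_⟩
    exact ih (h.pd (cd_pd hw).1 (cd_pd hf).1 (fun i => (cd_pd (hg i)).1) v) ((cd_pd hw).2 v) ((cd_pd hf).2 v)
      fun i => (cd_pd (hg i)).2 v

theorem regC (hN : 3 ≤ N) {n : ℕ} : ∀ {w f : Euc N → ℝ} {g : Fin N → Euc N → ℝ}, WEq w f g →
    HC n w → ContDiff ℝ ((n : ℕ∞) : WithTop ℕ∞) f →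
    (∀ i, HC n (g i)) → ContDiff ℝ (((n + 1 : ℕ) : ℕ∞) : WithTop ℕ∞) w := by
  induction n with
  | zero => exact fun h hw hf hg => by simpa using regC0 hN h hw hf.continuous hg
  | succ n ih =>
    intro w f g h hw hf hg
    have key : ContDiff ℝ ((((n + 1 : ℕ) : ℕ∞) : WithTop ℕ∞) + 1) w := by
      rw [contDiff_succ_iff_fderiv_apply]
      refine ⟨hw.1, fun h => absurd h (by simp), fun v => ?_⟩
      exact ih (h.pd hw.c1' (cd_pd hf).1 (fun i => (hg i).c1') v) (hw.2 v) ((cd_pd hf).2 v) fun i => (hg i).2 v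
    simpa using key

end boot

section solve
variable {N : ℕ} {p β Λ : ℝ} {U U1 : ℝ → ℝ}

theorem adv_eq (a : Euc N → Euc N) {u : Euc N → ℝ} (hu : Differentiable ℝ u) (x : Euc N) :
    adv a u x = ∑ i, a x i * fderiv ℝ u x (ee i) := by
  unfold adv gradient
  rw [real_inner_comm, InnerProductSpace.toDual_symm_apply]
  conv_lhs => rw [clm_expand (fderiv ℝ u x)]
  rw [ContinuousLinearMap.sum_apply]
  refine Finset.sum_congr rfl fun i _ => ?_
  simp [mul_comm]

theorem smooth_of_weq (hN : 3 ≤ N) {u : Euc N → ℝ} {a : Euc N → Euc N} (ha : ContDiff ℝ (⊤ : ℕ∞) a)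
    (hu : Continuous u) (hpos : ∀ x, 0 < u x)
    (h : WEq u (fun x => u x ^ p) (fun i x => a x i * u x)) : ContDiff ℝ (⊤ : ℕ∞) u := by
  have hai : ∀ i, ContDiff ℝ (⊤ : ℕ∞) fun x => a x i := fun i => contDiff_euclidean.1 ha i
  rw [contDiff_infty]
  intro n
  induction n with
  | zero => exact contDiff_zero.2 hu
  | succ n ih =>
    have ih' : ContDiff ℝ ((n : ℕ∞) : WithTop ℕ∞) u := ih
    have hain : ∀ (m : ℕ) i, ContDiff ℝ ((m : ℕ∞) : WithTop ℕ∞) fun x => a x i := fun m i =>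
      contDiff_infty.1 (hai i) m
    have hf := ih'.rpow_const_of_ne (p := p) (fun x => (hpos x).ne')
    have hH := regH hN h ih' hf (fun i => (hain n i).mul ih')
    exact regC hN h hH hf fun i => HC.mul (HC.of_cd (by simpa using hain (n + 1) i)) hH

theorem pde_of_weq {u : Euc N → ℝ} {a : Euc N → Euc N} (ha : ContDiff ℝ (⊤ : ℕ∞) a)
    (hdiv : ∀ x, divg a x = 0) (hu : ContDiff ℝ (⊤ : ℕ∞) u) (hpos : ∀ x, 0 < u x)
    (h : WEq u (fun x => u x ^ p) (fun i x => a x i * u x)) (x : Euc N) :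
    -lap u x + adv a u x = u x ^ p := by
  have hai : ∀ i, ContDiff ℝ (⊤ : ℕ∞) fun x => a x i := fun i => contDiff_euclidean.1 ha i
  have hai1 : ∀ i, ContDiff ℝ 1 fun x => a x i := fun i => (hai i).of_le (by simp)
  have hu1 : ContDiff ℝ 1 u := hu.of_le (by simp)
  have hpd : ∀ (φ : Euc N → ℝ) (_ : ContDiff ℝ (⊤ : ℕ∞) φ) e, ContDiff ℝ (⊤ : ℕ∞) fun x => fderiv ℝ φ x e :=
    fun φ hφ e => (hφ.fderiv_right (m := (⊤ : ℕ∞)) (by simp)).clm_apply contDiff_const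
  have hlc : Continuous (lap u) := by
    unfold lap
    exact continuous_finsetSum _ fun i _ => (hpd _ (hpd _ hu _) _).continuous
  have hfc : Continuous fun x => u x ^ p := hu.continuous.rpow_const fun x => Or.inl (hpos x).ne'
  have hgs : ∀ i, ContDiff ℝ (⊤ : ℕ∞) fun x => a x i * u x := fun i => (hai i).mul hu
  have hSc : Continuous fun x => ∑ i, fderiv ℝ (fun y => a y i * u y) x (ee i) :=
    continuous_finsetSum _ fun i _ => (hpd _ (hgs i) _).continuous
  have int : ∀ (φ ψ : Euc N → ℝ), Continuous φ → TF ψ → Integrable fun x => φ x * ψ x := fun φ ψ hφ hψ =>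
    (hφ.mul hψ.cont).integrable_of_hasCompactSupport (HasCompactSupport.mul_left (f := φ) hψ.cs)
  have key : lap u = fun x => -(u x ^ p) + ∑ i, fderiv ℝ (fun y => a y i * u y) x (ee i) := by
    refine eq_of_test hlc (hfc.neg.add hSc) fun ψ hψ => ?_
    have e1 : ∫ x, lap u x * ψ x = ∫ x, u x * lap ψ x := by
      unfold lap
      simp only [Finset.sum_mul, Finset.mul_sum]
      rw [integral_finsetSum _ fun i _ => int _ ψ (hpd _ (hpd _ hu _) _).continuous hψ,
        integral_finsetSum _ fun i _ => int _ _ hu.continuous ((hψ.pd _).pd _)]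
      refine Finset.sum_congr rfl fun i _ => ?_
      rw [ibp1 hu1 ((hψ.pd _).sm.of_le (by simp)) (hψ.pd _).cs,
        ibp1 ((hpd _ hu _).of_le (by simp)) (hψ.sm.of_le (by simp)) hψ.cs, neg_neg]
    have e2 : ∀ i, ∫ x, a x i * u x * fderiv ℝ ψ x (ee i) =
        -∫ x, fderiv ℝ (fun y => a y i * u y) x (ee i) * ψ x := fun i =>
      ibp1 ((hgs i).of_le (by simp)) (hψ.sm.of_le (by simp)) hψ.cs _
    have e3 := h ψ hψ
    simp only [e2, Finset.sum_neg_distrib, sub_neg_eq_add] at e3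
    rw [e1, e3]
    have i1 : Integrable fun x => -(u x ^ p) * ψ x := int _ _ hfc.neg hψ
    have i2 : Integrable fun x => (∑ i, fderiv ℝ (fun y => a y i * u y) x (ee i)) * ψ x := int _ _ hSc hψ
    simp only [add_mul]
    rw [integral_add i1 i2]
    simp only [Finset.sum_mul, neg_mul, integral_neg]
    rw [integral_finsetSum _ fun i _ => int _ ψ (hpd _ (hgs i) _).continuous hψ]
  have h1 := congrFun key x
  simp only [fderiv_mul_ee (hai1 _) hu1, Finset.sum_add_distrib] at h1
  have h2 : ∑ i, fderiv ℝ (fun y => a y i) x (ee i) = 0 := by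
    rw [← hdiv x]
    unfold divg
    refine Finset.sum_congr rfl fun i _ => ?_
    have hd : HasFDerivAt a (fderiv ℝ a x) x := (ha.differentiable (by simp) x).hasFDerivAt
    have := (EuclideanSpace.proj i : Euc N →L[ℝ] ℝ).hasFDerivAt.comp x hd
    rw [show (fun y => a y i) = (EuclideanSpace.proj i : Euc N →L[ℝ] ℝ) ∘ a from rfl, this.fderiv]
    rfl
  rw [← Finset.sum_mul, h2, zero_mul, zero_add, ← adv_eq a (hu.differentiable (by simp))] at h1
  linarith

theorem solve (h : Par N p β Λ) (P : Prof N p β Λ U U1) {δ0 : ℝ} (hδ0 : 0 < δ0) :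
    ∃ Cs, 0 < Cs ∧ ∀ a : Euc N → Euc N, ContDiff ℝ (⊤ : ℕ∞) a → (∀ x, divg a x = 0) →
      (∀ x, ‖a x‖ ≤ Cs / (‖x‖ + 1)) → ∃ u : Euc N → ℝ, IsSolution a p Set.univ u ∧
        ∀ x, u x ≤ U ‖x‖ * (1 + δ0) := by
  obtain ⟨Cs, hCs, hfix⟩ := exists_fixed h P hδ0
  obtain ⟨C, hC, hdr⟩ := drift_bd h P
  refine ⟨Cs, hCs, fun a ha hdiv hb => ?_⟩
  obtain ⟨v, hv1, hv2, hv3⟩ := hfix a ha.continuous hb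
  have hN3 : 3 ≤ N := by have := h.hN; omega
  have hcont : Continuous fun x : Euc N => U ‖x‖ * v x := P.Ucont.mul v.continuous
  have hvpos : ∀ x, 0 < v x := fun x => by linarith [hv2 x]
  have hpos : ∀ x : Euc N, 0 < U ‖x‖ * v x := fun x => mul_pos (P.Upos x) (hvpos x)
  have hvb : ∀ x, |v x| ≤ ‖v‖ := fun x => v.norm_coe_le_norm x
  have hvpb : ∀ x, |v x ^ p| ≤ ‖v‖ ^ p := fun x => by
    rw [abs_of_pos (Real.rpow_pos_of_pos (hvpos x) _)]
    exact Real.rpow_le_rpow (hvpos x).le ((le_abs_self _).trans (hvb x)) h.ppos.le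
  have hβ := h.βpos
  have hW : WEq (fun x => U ‖x‖ * v x) (fun x => (U ‖x‖ * v x) ^ p) (fun i x => a x i * (U ‖x‖ * v x)) := by
    refine weak_of_rep (τ := β + 2) (σ := β + 1) hN3 (by linarith) (by linarith) ?_ (fun i => ?_) fun x => ?_
    · have := P.adm h (v.continuous.rpow_const fun x => Or.inl (hvpos x).ne') hvpb
      convert this using 2 with y
      exact Real.mul_rpow (P.Upos y).le (hvpos y).le
    · exact ⟨(contDiff_euclidean.1 ha i).continuous.mul hcont, _, fun y => hdr a Cs hb v ‖v‖ hvb i y⟩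
    · have := hv3 x
      unfold Kop Bop at this
      rw [this]; ring
  have hsm := smooth_of_weq hN3 ha hcont hpos hW
  refine ⟨fun x => U ‖x‖ * v x, ⟨hsm.contDiffOn, fun x _ => hpos x, fun x _ =>
    pde_of_weq ha hdiv hsm hpos hW x⟩, fun x => ?_⟩
  have := (abs_le.1 (hv1 x)).2
  exact mul_le_mul_of_nonneg_left (by linarith) (P.Upos x).le

end solve

section stab
variable {N : ℕ} {p β Λ : ℝ} {U U1 : ℝ → ℝ}

theorem hardy_E (a : Euc N → Euc N) {Cs ε W A c : ℝ} (hN : 11 ≤ N) (hε : 0 < ε) (x : Euc N)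
    (ha : ‖a x‖ ≤ Cs / (‖x‖ + 1)) (hW0 : 0 ≤ W) (hWA : W ≤ A) (hWc : W * ‖x‖ ^ 2 ≤ c)
    (hc : c ≤ ((N:ℝ) - 2) / 2 * (((N:ℝ) - 2) / 2 - Cs)) (hCs : Cs ≤ 1) (hA : A * ε ^ 2 ≤ 1) :
    W * (ε ^ 2 + ‖x‖ ^ 2) ^ (-(((N:ℝ) - 2) / 4)) ≤
      -lap (fun y : Euc N => (ε ^ 2 + ‖y‖ ^ 2) ^ (-(((N:ℝ) - 2) / 4))) x +
        adv a (fun y : Euc N => (ε ^ 2 + ‖y‖ ^ 2) ^ (-(((N:ℝ) - 2) / 4))) x := by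
  have hN' : (11:ℝ) ≤ N := by exact_mod_cast hN
  set t : ℝ := -(((N:ℝ) - 2) / 4) with ht
  set γ : ℝ := ((N:ℝ) - 2) / 2 with hγ
  have hγ4 : 4 ≤ γ := by rw [hγ]; linarith
  have hcd : ContDiff ℝ 2 (fun y : Euc N => (ε ^ 2 + ‖y‖ ^ 2) ^ t) := reg_contDiff hε.ne'
  have hHL := reg_HL (t := t) hε.ne' x
  rw [hHL.lap_eq hcd, adv_eq a (hcd.differentiable (by norm_num))]
  simp only [hHL.fderiv_eq hcd]
  set q : ℝ := ε ^ 2 + ‖x‖ ^ 2 with hq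
  have hq0 : 0 < q := by positivity
  set E := q ^ t with hE
  have hE0 : 0 < E := Real.rpow_pos_of_pos hq0 _
  have e1 : q ^ (t - 1) = E / q := by rw [Real.rpow_sub hq0, Real.rpow_one]
  have e2 : q ^ (t - 2) = E / q ^ 2 := by
    rw [Real.rpow_sub hq0, Real.rpow_two]
  rw [e1, e2]
  have s1 : ∑ i, (4 * t * (t - 1) * x i ^ 2 * (E / q ^ 2) + 2 * t * (E / q)) =
      4 * t * (t - 1) * ‖x‖ ^ 2 * (E / q ^ 2) + N * (2 * t * (E / q)) := by
    rw [Finset.sum_add_distrib, ← Finset.sum_mul, ← Finset.mul_sum, sum_sq_eq]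
    simp
  have s2 : ∑ i, a x i * (2 * t * (x i * (E / q))) = -(γ * (E / q)) * ⟪a x, x⟫_ℝ := by
    rw [PiLp.inner_apply, Finset.mul_sum]
    refine Finset.sum_congr rfl fun i _ => ?_
    simp only [RCLike.inner_apply, conj_trivial]
    rw [ht, hγ]; ring
  rw [s1, s2]
  have hax : ⟪a x, x⟫_ℝ ≤ Cs := by
    refine (real_inner_le_norm _ _).trans ?_
    have hCs0 : 0 ≤ Cs := by
      have h0 := (norm_nonneg _).trans ha
      have : 0 < ‖x‖ + 1 := by positivity
      by_contra hneg
      push Not at hneg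
      exact absurd h0 (not_le.2 (div_neg_of_neg_of_pos hneg this))
    calc ‖a x‖ * ‖x‖ ≤ Cs / (‖x‖ + 1) * ‖x‖ := by gcongr
      _ = Cs * (‖x‖ / (‖x‖ + 1)) := by ring
      _ ≤ Cs * 1 := by
        gcongr
        rw [div_le_one (by positivity)]; linarith
      _ = Cs := mul_one _
  have h1 : -(γ * (E / q)) * Cs ≤ -(γ * (E / q)) * ⟪a x, x⟫_ℝ :=
    mul_le_mul_of_nonpos_left hax (by have : 0 ≤ γ * (E / q) := by positivity
                                      linarith)
  refine le_trans ?_ (add_le_add le_rfl h1)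
  have e3 : -(4 * t * (t - 1) * ‖x‖ ^ 2 * (E / q ^ 2) + N * (2 * t * (E / q))) + -(γ * (E / q)) * Cs =
      E / q ^ 2 * (γ * ((N - Cs) * ε ^ 2 + (γ - Cs) * ‖x‖ ^ 2)) := by
    have : E / q = E / q ^ 2 * (ε ^ 2 + ‖x‖ ^ 2) := by rw [← hq]; field_simp
    rw [this, ht, hγ]; ring
  rw [e3]
  have e4 : W * E = E / q ^ 2 * (W * (ε ^ 2 + ‖x‖ ^ 2) ^ 2) := by rw [← hq]; field_simp
  rw [e4]
  refine mul_le_mul_of_nonneg_left ?_ (by positivity)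
  have hε2 : 0 < ε ^ 2 := by positivity
  set r2 := ‖x‖ ^ 2 with hr2
  have hr0 : 0 ≤ r2 := by positivity
  have f1 : W * (ε ^ 2 + r2) ^ 2 ≤ ε ^ 2 * (1 + 2 * c) + c * r2 := by
    have g1 : W * ε ^ 2 ≤ 1 := (mul_le_mul_of_nonneg_right hWA hε2.le).trans hA
    have g2 : W * r2 * r2 ≤ c * r2 := mul_le_mul_of_nonneg_right hWc hr0
    have g3 : W * r2 * ε ^ 2 ≤ c * ε ^ 2 := mul_le_mul_of_nonneg_right hWc hε2.le
    have g4 : W * ε ^ 2 * ε ^ 2 ≤ 1 * ε ^ 2 := mul_le_mul_of_nonneg_right g1 hε2.le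
    linarith
  have hNγ : (N:ℝ) = 2 * γ + 2 := by rw [hγ]; ring
  have f2 : 1 + 2 * c ≤ γ * (N - Cs) := by
    rw [hNγ]
    have hCs0 : 0 ≤ Cs := by
      have h0 := (norm_nonneg _).trans ha
      have : 0 < ‖x‖ + 1 := by positivity
      by_contra hneg
      push Not at hneg
      exact absurd h0 (not_le.2 (div_neg_of_neg_of_pos hneg this))
    nlinarith [mul_nonneg (by linarith : 0 ≤ γ) hCs0]
  have f3 := mul_le_mul_of_nonneg_right f2 hε2.le
  have f4 := mul_le_mul_of_nonneg_right hc hr0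
  linarith

theorem main_aux (h : Par N p β Λ) (P : Prof N p β Λ U U1) :
    ∃ Cstar : ℝ, 0 < Cstar ∧
      ∀ (a : Euc N → Euc N), ContDiff ℝ (⊤ : ℕ∞) a → (∀ x, divg a x = 0) →
        (∀ x, ‖a x‖ ≤ Cstar / (‖x‖ + 1)) →
          ∃ u : Euc N → ℝ, IsStableSolution a p Set.univ u := by
  have hN' := h.N11
  have hp := h.hp
  have hh := h.hardy
  set γ : ℝ := ((N:ℝ) - 2) / 2 with hγ
  have hγ4 : 4 ≤ γ := by rw [hγ]; linarith
  obtain ⟨δ, hδ0, hδ⟩ : ∃ δ : ℝ, 0 < δ ∧ (1 + δ) ^ (p - 1) * (p * Λ) < γ ^ 2 := by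
    have hc : Tendsto (fun δ : ℝ => (1 + δ) ^ (p - 1) * (p * Λ)) (𝓝 0) (𝓝 (p * Λ)) := by
      have : Continuous fun δ : ℝ => (1 + δ) ^ (p - 1) * (p * Λ) :=
        ((continuous_const.add continuous_id).rpow_const fun _ => Or.inr (by linarith)).mul continuous_const
      simpa using this.tendsto 0
    have h1 := (hc.eventually (gt_mem_nhds hh)).filter_mono (nhdsWithin_le_nhds (s := Set.Ioi 0))
    obtain ⟨δ, h2, h3⟩ := (h1.and self_mem_nhdsWithin).exists
    exact ⟨δ, h3, h2⟩
  set B := (1 + δ) ^ (p - 1) with hB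
  have hB0 : 0 < B := by positivity
  have hp0 : 0 < p := h.ppos
  obtain ⟨C1, hC1, hsol⟩ := solve h P hδ0
  set d := (γ ^ 2 - B * (p * Λ)) / γ with hd
  have hd0 : 0 < d := div_pos (by linarith) (by linarith)
  refine ⟨min C1 (min 1 d), lt_min hC1 (lt_min one_pos hd0), fun a ha hdiv hb => ?_⟩
  obtain ⟨u, hu, hub⟩ := hsol a ha hdiv (fun x => (hb x).trans (by
    gcongr
    exact min_le_left _ _))
  set Cs := min C1 (min 1 d) with hCs
  have hCs1 : Cs ≤ 1 := (min_le_right _ _).trans (min_le_left _ _)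
  have hCsd : Cs ≤ d := (min_le_right _ _).trans (min_le_right _ _)
  set A := p * B with hA
  have hA0 : 0 < A := by positivity
  have hε : 0 < √(1 / A) := Real.sqrt_pos.2 (by positivity)
  have hcond : B * (p * Λ) ≤ γ * (γ - Cs) := by
    have : d * γ = γ ^ 2 - B * (p * Λ) := by rw [hd]; field_simp
    nlinarith
  have hcd : ContDiff ℝ (⊤ : ℕ∞) (fun y : Euc N => ((√(1 / A)) ^ 2 + ‖y‖ ^ 2) ^ (-(((N:ℝ) - 2) / 4))) :=
    reg_contDiff hε.ne'
  refine ⟨u, hu, _, hcd.contDiffOn, fun x _ => Real.rpow_pos_of_pos (by positivity) _, fun x _ => ?_⟩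
  have hux : 0 < u x := hu.2.1 x trivial
  have hU := P.Upos x
  have hup : u x ^ (p - 1) ≤ U ‖x‖ ^ (p - 1) * B := by
    rw [hB, ← Real.mul_rpow hU.le (by positivity)]
    exact Real.rpow_le_rpow hux.le (hub x) (by linarith)
  refine hardy_E a (A := A) (c := B * (p * Λ)) h.hN hε x (hb x) (by positivity) ?_ ?_ hcond hCs1 ?_
  · have : U ‖x‖ ^ (p - 1) ≤ 1 := Real.rpow_le_one hU.le (P.le1 _ (norm_nonneg _)) (by linarith)
    rw [hA]
    refine mul_le_mul_of_nonneg_left (hup.trans ?_) hp0.le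
    nlinarith
  · have hw := P.wle ‖x‖ (norm_nonneg _)
    calc p * u x ^ (p - 1) * ‖x‖ ^ 2 ≤ p * (U ‖x‖ ^ (p - 1) * B) * ‖x‖ ^ 2 := by gcongr
      _ = B * (p * (‖x‖ ^ 2 * U ‖x‖ ^ (p - 1))) := by ring
      _ ≤ B * (p * Λ) := by gcongr
  · rw [Real.sq_sqrt (by positivity)]
    field_simp
    exact le_rfl

end stab
/-- For `N ≥ 11` and `p > p_c` there is `C* > 0`, depending only
on `N` and `p`, such that for every smooth divergence-free vector field `a` with
`|a(x)| ≤ C*/(|x|+1)`, the equation `-Δu + a·∇u = u^p` has a positive stable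
solution on ℝ^N. -/
theorem exists_positive_stable_solution (N : ℕ) (hN : 11 ≤ N) (p : ℝ)
    (hp : pJL N < p) :
    ∃ Cstar : ℝ, 0 < Cstar ∧
      ∀ (a : Euc N → Euc N), ContDiff ℝ (⊤ : ℕ∞) a → (∀ x, divg a x = 0) →
        (∀ x, ‖a x‖ ≤ Cstar / (‖x‖ + 1)) →
          ∃ u : Euc N → ℝ, IsStableSolution a p Set.univ u := by
  have h := par_of_pJL N hN p hp
  obtain ⟨U, U1, P⟩ := exists_prof h
  exact main_aux h P
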